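/- The pretentious large sieve for primes: For every natural number J ≥ 1 and every ε > 0 there is a constant C = C(J,ε) > 0 such that for all natural numbers q ≥ 1 and all real x ≥ max(q^{10}, C), setting Q = q·log x, there exists a set 𝒳̃ of Dirichlet characters mod q containing the principal character, with at most J+1 elements, such that ∑ over Dirichlet characters χ mod q with χ ∉ 𝒳̃ of | ∑_{n ≤ x} Λ(n)·χ(n) |² ≤ C · x² · (log Q/log x)^{2(1 − 1/√(J+1)) − ε}. -/

import Mathlib

namespace PretentiousSieve

open MeasureTheory FourierTransform SchwartzMap
open scoped ENNReal

theorem fourier_ae_eq_fourier_Lp {f : ℝ → ℂ} (hf : Integrable f) (hf2 : MemLp f 2) :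
    𝓕 f =ᵐ[volume] (𝓕 (hf2.toLp f) : Lp ℂ 2) := by
  have hcont : Continuous (𝓕 f) :=
    VectorFourier.fourierIntegral_continuous Real.continuous_fourierChar (by exact continuous_inner)
      hf
  refine ae_eq_of_integral_contDiff_smul_eq hcont.locallyIntegrable
    ((Lp.memLp _).locallyIntegrable (by norm_num)) ?_
  intro g hg hgc
  let G : 𝓢(ℝ, ℂ) := HasCompactSupport.toSchwartzMap (f := fun x => (g x : ℂ))
    (hgc.comp_left (g := fun x : ℝ => (x : ℂ)) (by simp))
    (Complex.ofRealCLM.contDiff.comp hg)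
  have hG : ∀ x, G x = (g x : ℂ) := fun x => rfl
  have h := Lp.fourier_toTemperedDistribution_eq (hf2.toLp f)
  have h2 := congrArg (fun T : TemperedDistribution ℝ ℂ => T G) h
  simp only [TemperedDistribution.fourier_apply, Lp.toTemperedDistribution_apply] at h2
  have h3 : ∫ x, g x • 𝓕 f x = ∫ x, (𝓕 G) x • f x := by
    have := VectorFourier.integral_fourierIntegral_smul_eq_flip (L := innerₗ ℝ)
      Real.continuous_fourierChar continuous_inner hf G.integrable (μ := volume) (ν := volume)
    rw [flip_innerₗ] at this
    convert this using 1
    · refine integral_congr_ae (.of_forall fun x => ?_)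
      simp only [hG]
      rw [Complex.real_smul, smul_eq_mul, mul_comm]; rfl
    · refine integral_congr_ae (.of_forall fun x => ?_)
      simp only [smul_eq_mul, SchwartzMap.fourier_coe]
      rw [mul_comm]; rfl
  rw [h3]
  have h4 : ∫ x, (𝓕 G) x • (hf2.toLp f) x = ∫ x, (𝓕 G) x • f x := by
    refine integral_congr_ae ?_
    filter_upwards [hf2.coeFn_toLp] with x hx
    rw [hx]
  rw [← h4, h2]
  refine integral_congr_ae (.of_forall fun x => ?_)
  simp only [hG]
  rw [Complex.real_smul, smul_eq_mul]

theorem plancherel {f : ℝ → ℂ} (hf : Integrable f) (hf2 : MemLp f 2) :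
    MemLp (𝓕 f) 2 ∧ ∫ ξ, ‖𝓕 f ξ‖ ^ 2 = ∫ x, ‖f x‖ ^ 2 := by
  have hae := fourier_ae_eq_fourier_Lp hf hf2
  have h1 : MemLp (𝓕 f) 2 := (memLp_congr_ae hae).2 (Lp.memLp _)
  refine ⟨h1, ?_⟩
  have h2 := Lp.norm_fourier_eq (hf2.toLp f)
  have h3 : ∀ {g : ℝ → ℂ}, MemLp g 2 → 
      ∫ x, ‖g x‖ ^ 2 = (eLpNorm g 2 volume).toReal ^ 2 := by
    intro g hg
    rw [hg.eLpNorm_eq_integral_rpow_norm (by norm_num) (by norm_num)]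
    rw [ENNReal.toReal_ofReal (by positivity)]
    simp only [ENNReal.toReal_ofNat, Real.rpow_ofNat]
    rw [← Real.rpow_natCast, ← Real.rpow_mul (integral_nonneg fun _ => by positivity)]
    norm_num
  rw [h3 h1, h3 hf2, eLpNorm_congr_ae hae]
  rw [Lp.norm_def, Lp.norm_toLp] at h2
  rw [h2]

end PretentiousSieve

namespace PretentiousSieve

open MeasureTheory FourierTransform Set Filter Topology
open scoped ENNReal Real

/-- A measurable function vanishing to the left of `1` and of growth at most `y ^ (1 + o(1))`. -/
structure SlowGrowth (A : ℝ → ℂ) : Prop where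
  meas : Measurable A
  zero : ∀ y < 1, A y = 0
  bound : ∀ a : ℝ, 1 < a → ∃ C, ∀ y, 1 ≤ y → ‖A y‖ ≤ C * y ^ a

/-- `s ↦ ∫ A(y) y^{-s-1} dy`. -/
noncomputable def mel (A : ℝ → ℂ) (s : ℂ) : ℂ := mellin A (-s)

/-- Multiplication by the logarithm. -/
noncomputable def logMul (A : ℝ → ℂ) (y : ℝ) : ℂ := (Real.log y : ℂ) * A y

theorem SlowGrowth.mul_log {A : ℝ → ℂ} (hA : SlowGrowth A) : SlowGrowth (logMul A) where
  meas := by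
    unfold logMul
    exact (Complex.measurable_ofReal.comp Real.measurable_log).mul hA.meas
  zero y hy := by simp [logMul, hA.zero y hy]
  bound a ha := by
    obtain ⟨C, hC⟩ := hA.bound ((1 + a) / 2) (by linarith)
    refine ⟨(2 / (a - 1)) * C, fun y hy => ?_⟩
    have h0 : 0 < (a - 1) / 2 := by linarith
    have h1 := Real.log_le_rpow_div (x := y) (by linarith) h0
    have h2 := Real.log_nonneg hy
    have e : y ^ a = y ^ ((a - 1) / 2) * y ^ ((1 + a) / 2) := by
      rw [← Real.rpow_add (by linarith)]; ring_nf
    rw [logMul, norm_mul, Complex.norm_real, Real.norm_of_nonneg h2, e]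
    calc Real.log y * ‖A y‖ ≤ (y ^ ((a - 1) / 2) / ((a - 1) / 2)) * (C * y ^ ((1 + a) / 2)) := by
          gcongr
          exact hC y hy
      _ = _ := by field_simp

theorem SlowGrowth.isBigO {A : ℝ → ℂ} (hA : SlowGrowth A) {a : ℝ} (ha : 1 < a) :
    A =O[atTop] (fun y : ℝ => y ^ (-(-a))) := by
  obtain ⟨C, hC⟩ := hA.bound a ha
  refine Asymptotics.IsBigO.of_bound C ?_
  filter_upwards [eventually_ge_atTop 1] with y hy
  rw [neg_neg, Real.norm_of_nonneg (by positivity)]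
  exact hC y hy

theorem SlowGrowth.locallyIntegrable {A : ℝ → ℂ} (hA : SlowGrowth A) :
    LocallyIntegrable A := by
  obtain ⟨C, hC⟩ := hA.bound 2 (by norm_num)
  have hcont : Continuous (fun y : ℝ => |C| * y ^ 2) := by fun_prop
  refine hcont.locallyIntegrable.mono hA.meas.aestronglyMeasurable (.of_forall fun y => ?_)
  rw [Real.norm_of_nonneg (by positivity)]
  rcases lt_or_ge y 1 with h | h
  · simp only [hA.zero y h, norm_zero]; positivity
  · have h3 := hC y h
    rw [Real.rpow_two] at h3
    refine h3.trans ?_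
    gcongr
    exact le_abs_self C

theorem SlowGrowth.hasDerivAt_mel {A : ℝ → ℂ} (hA : SlowGrowth A) {s : ℂ} (hs : 1 < s.re) :
    HasDerivAt (mel A) (-mel (logMul A) s) s := by
  have h := (mellin_hasDerivAt_of_isBigO_rpow (s := -s) (a := -((1 + s.re) / 2))
    (b := -s.re - 1) (f := A)
    (hA.locallyIntegrable.locallyIntegrableOn _) (hA.isBigO (by linarith))
    (by simp only [Complex.neg_re]; linarith) (by
      refine Asymptotics.IsBigO.of_bound 0 ?_
      have : Set.Iio (1:ℝ) ∈ 𝓝[>] (0:ℝ) := mem_nhdsWithin_of_mem_nhds (Iio_mem_nhds one_pos)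
      filter_upwards [this] with y hy
      simp [hA.zero y hy]) (by simp)).2
  have h2 := HasDerivAt.comp s h (hasDerivAt_neg s)
  have e : mellin (fun t => Real.log t • A t) (-s) = mel (logMul A) s := by
    simp only [mel, Complex.real_smul]; rfl
  rw [e, mul_neg_one] at h2
  exact h2

theorem SlowGrowth.integrable_exp {A : ℝ → ℂ} (hA : SlowGrowth A) {σ : ℝ} (hσ : 1 < σ) :
    Integrable (fun u : ℝ => Real.exp (σ * u) • A (Real.exp (-u))) ∧
    MemLp (fun u : ℝ => Real.exp (σ * u) • A (Real.exp (-u))) 2 := by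
  obtain ⟨C, hC⟩ := hA.bound ((1 + σ) / 2) (by linarith)
  have hb : ∀ u, ‖Real.exp (σ * u) • A (Real.exp (-u))‖ ≤
      (Set.Iic (0:ℝ)).indicator (fun u => C * Real.exp ((σ - 1) / 2 * u)) u := by
    intro u
    by_cases hu : u ≤ 0
    · rw [Set.indicator_of_mem (by exact hu), norm_smul, Real.norm_of_nonneg (by positivity)]
      have h := hC (Real.exp (-u)) (by rw [Real.one_le_exp_iff]; linarith)
      rw [← Real.exp_mul] at h
      calc _ ≤ Real.exp (σ * u) * (C * Real.exp (-u * ((1 + σ) / 2))) := by gcongr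
        _ = C * (Real.exp (σ * u) * Real.exp (-u * ((1 + σ) / 2))) := by ring
        _ = _ := by rw [← Real.exp_add]; ring_nf
    · rw [Set.indicator_of_notMem (by simpa using hu), hA.zero _ (by
        rw [Real.exp_lt_one_iff]; linarith [not_le.1 hu])]
      simp
  have hm : AEStronglyMeasurable (fun u : ℝ => Real.exp (σ * u) • A (Real.exp (-u))) := by
    refine Measurable.aestronglyMeasurable ?_
    have m1 : Measurable fun u : ℝ => Real.exp (σ * u) := by fun_prop
    have m2 : Measurable fun u : ℝ => Real.exp (-u) := by fun_prop
    exact m1.smul (hA.meas.comp m2)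
  have hInt : ∀ D c : ℝ, 0 < c →
      Integrable ((Set.Iic (0:ℝ)).indicator (fun u => D * Real.exp (c * u))) := by
    intro D c hc
    rw [integrable_indicator_iff measurableSet_Iic]
    exact (integrableOn_exp_mul_Iic hc 0).const_mul D
  refine ⟨(hInt C ((σ - 1) / 2) (by linarith)).mono' hm (.of_forall hb), ?_⟩
  rw [memLp_two_iff_integrable_sq_norm hm]
  refine (hInt (C ^ 2) (σ - 1) (by linarith)).mono' (hm.norm.pow 2) (.of_forall fun u => ?_)
  rw [norm_pow, norm_norm]
  calc _ ≤ ((Set.Iic (0:ℝ)).indicator (fun u => C * Real.exp ((σ - 1) / 2 * u)) u) ^ 2 := by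
        gcongr; exact hb u
    _ = _ := by
        by_cases hu : u ∈ Set.Iic (0:ℝ)
        · rw [Set.indicator_of_mem hu, Set.indicator_of_mem hu, mul_pow, ← Real.exp_nat_mul]
          push_cast; ring_nf
        · rw [Set.indicator_of_notMem hu, Set.indicator_of_notMem hu]; simp

theorem integral_Ioi_eq_integral_exp (g : ℝ → ℝ) :
    ∫ y in Ioi (0:ℝ), g y = ∫ u : ℝ, Real.exp (-u) * g (Real.exp (-u)) := by
  have himg : (Real.exp ∘ Neg.neg) '' univ = Ioi (0:ℝ) := by
    rw [Set.image_comp, Set.image_univ_of_surjective neg_surjective, Set.image_univ,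
      Real.range_exp]
  have hd : ∀ x ∈ (univ : Set ℝ),
      HasDerivWithinAt (Real.exp ∘ Neg.neg) (-Real.exp (-x)) univ x := fun x _ ↦
    mul_neg_one (Real.exp (-x)) ▸
      ((Real.hasDerivAt_exp (-x)).comp x (hasDerivAt_neg x)).hasDerivWithinAt
  rw [← himg, integral_image_eq_integral_abs_deriv_smul MeasurableSet.univ hd
    (Real.exp_injective.injOn.comp neg_injective.injOn (univ.mapsTo_univ _))]
  simp

theorem SlowGrowth.mel_eq_fourier (A : ℝ → ℂ) (σ t : ℝ) :
    mel A (σ + t * Complex.I) =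
      𝓕 (fun u : ℝ => Real.exp (σ * u) • A (Real.exp (-u))) (-t / (2 * π)) := by
  rw [mel, mellin_eq_fourier]
  simp

theorem SlowGrowth.mel_plancherel {A : ℝ → ℂ} (hA : SlowGrowth A) {σ : ℝ} (hσ : 1 < σ) :
    Integrable (fun t : ℝ => ‖mel A (σ + t * Complex.I)‖ ^ 2) ∧
    ∫ t : ℝ, ‖mel A (σ + t * Complex.I)‖ ^ 2 =
      2 * π * ∫ y in Ioi (0:ℝ), ‖A y‖ ^ 2 * y ^ (-2 * σ - 1) := by
  obtain ⟨h1, h2⟩ := hA.integrable_exp hσ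
  obtain ⟨p1, p2⟩ := plancherel h1 h2
  have hπ : (0:ℝ) < 2 * π := by positivity
  have e : (fun t : ℝ => ‖mel A (σ + t * Complex.I)‖ ^ 2) = fun t : ℝ =>
      (fun ξ => ‖𝓕 (fun u : ℝ => Real.exp (σ * u) • A (Real.exp (-u))) ξ‖ ^ 2)
        ((-(2 * π)⁻¹) * t) := by
    funext t
    have e : -t / (2 * π) = -(2 * π)⁻¹ * t := by ring
    simp only [SlowGrowth.mel_eq_fourier, e]
  rw [e]
  constructor
  · exact ((memLp_two_iff_integrable_sq_norm p1.1).1 p1).comp_mul_left' (R := -(2 * π)⁻¹)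
      (neg_ne_zero.2 (inv_ne_zero hπ.ne'))
  · rw [Measure.integral_comp_mul_left
      (fun ξ => ‖𝓕 (fun u : ℝ => Real.exp (σ * u) • A (Real.exp (-u))) ξ‖ ^ 2), p2,
      integral_Ioi_eq_integral_exp, smul_eq_mul]
    congr 1
    · rw [inv_neg, inv_inv, abs_neg, abs_of_pos hπ]
    · congr 1
      funext u
      rw [norm_smul, Real.norm_of_nonneg (by positivity), mul_pow, ← Real.exp_mul, ← Real.exp_nat_mul,
        mul_left_comm (Real.exp (-u)), ← Real.exp_add, mul_comm]
      congr 2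
      push_cast; ring

end PretentiousSieve

namespace PretentiousSieve

open MeasureTheory Set Filter Topology
open scoped Real

/-- The summatory function of an arithmetic function. -/
noncomputable def psum (g : ℕ → ℂ) (y : ℝ) : ℂ := ∑ k ∈ Finset.Icc 1 ⌊y⌋₊, g k

/-- Arithmetic functions of size `n ^ o(1)`. -/
def Subpoly (g : ℕ → ℂ) : Prop := ∀ ε : ℝ, 0 < ε → ∃ C, ∀ n : ℕ, 1 ≤ n → ‖g n‖ ≤ C * (n : ℝ) ^ ε

theorem Subpoly.psum_bound {g : ℕ → ℂ} (hg : Subpoly g) (a : ℝ) (ha : 1 < a) :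
    ∃ C, 0 ≤ C ∧ ∀ y : ℝ, 1 ≤ y → ∑ k ∈ Finset.Icc 1 ⌊y⌋₊, ‖g k‖ ≤ C * y ^ a := by
  obtain ⟨C, hC⟩ := hg (a - 1) (by linarith)
  have hC0 : 0 ≤ C := by
    have := (norm_nonneg _).trans (hC 1 le_rfl)
    simpa using this
  refine ⟨C, hC0, fun y hy => ?_⟩
  have hy0 : 0 < y := by linarith
  calc ∑ k ∈ Finset.Icc 1 ⌊y⌋₊, ‖g k‖ ≤ ∑ k ∈ Finset.Icc 1 ⌊y⌋₊, C * y ^ (a - 1) := by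
        refine Finset.sum_le_sum fun k hk => ?_
        rw [Finset.mem_Icc] at hk
        refine (hC k hk.1).trans ?_
        gcongr
        exact (Nat.le_floor_iff hy0.le).1 hk.2
    _ = ⌊y⌋₊ * (C * y ^ (a - 1)) := by simp
    _ ≤ y * (C * y ^ (a - 1)) := by
        gcongr
        exact Nat.floor_le hy0.le
    _ = C * y ^ a := by
        rw [mul_left_comm]
        congr 1
        rw [← Real.rpow_one_add' hy0.le (by linarith)]; ring_nf

theorem measurable_psum (g : ℕ → ℂ) : Measurable (psum g) := by
  have : psum g = (fun n : ℕ => ∑ k ∈ Finset.Icc 1 n, g k) ∘ (fun y : ℝ => ⌊y⌋₊) := rfl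
  rw [this]
  exact (measurable_from_top).comp Nat.measurable_floor

theorem Subpoly.slowGrowth {g : ℕ → ℂ} (hg : Subpoly g) : SlowGrowth (psum g) where
  meas := measurable_psum g
  zero y hy := by simp [psum, Nat.floor_eq_zero.2 hy]
  bound a ha := by
    obtain ⟨C, -, hC⟩ := hg.psum_bound a ha
    exact ⟨C, fun y hy => (norm_sum_le _ _).trans (hC y hy)⟩

theorem setIntegral_Ioi_zero_eq {E : Type*} [NormedAddCommGroup E] [NormedSpace ℝ E]
    {F : ℝ → E} (h : ∀ y < 1, F y = 0) :
    ∫ y in Ioi (0:ℝ), F y = ∫ y in Ioi (1:ℝ), F y := by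
  rw [← integral_Ici_eq_integral_Ioi (x := (1:ℝ))]
  refine (setIntegral_eq_of_subset_of_forall_sdiff_eq_zero
      measurableSet_Ioi (fun y hy => lt_of_lt_of_le (one_pos : (0:ℝ) < 1) (mem_Ici.1 hy)) ?_)
  intro y hy
  exact h y (by simpa using hy.2)

theorem Subpoly.lseries_eq {g : ℕ → ℂ} (hg : Subpoly g) {s : ℂ} (hs : 1 < s.re) :
    LSeries g s = s * mel (psum g) s := by
  rw [LSeries_eq_mul_integral' g (r := (1 + s.re) / 2) (by linarith) (by linarith)]
  · rw [mel, mellin]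
    congr 1
    rw [setIntegral_Ioi_zero_eq (by intro y hy; rw [hg.slowGrowth.zero y hy, smul_zero])]
    refine setIntegral_congr_fun measurableSet_Ioi fun y hy => ?_
    simp only [smul_eq_mul, psum]
    rw [mul_comm]; ring_nf
  · obtain ⟨C, -, hC⟩ := hg.psum_bound ((1 + s.re) / 2) (by linarith)
    refine Asymptotics.IsBigO.of_bound C ?_
    filter_upwards [eventually_ge_atTop 1] with n hn
    have := hC n (by exact_mod_cast hn)
    rw [Nat.floor_natCast] at this
    rwa [Real.norm_of_nonneg (by positivity), Real.norm_of_nonneg (by positivity)]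

theorem log_pow_le {y β : ℝ} (hy : 1 ≤ y) (hβ : 0 < β) (k : ℕ) :
    Real.log y ^ k ≤ (k / β) ^ k * y ^ β := by
  rcases Nat.eq_zero_or_pos k with rfl | hk
  · simpa using Real.one_le_rpow hy hβ.le
  · have hk' : (0:ℝ) < k := by exact_mod_cast hk
    have h1 := Real.log_le_rpow_div (x := y) (by linarith) (div_pos hβ hk')
    calc Real.log y ^ k ≤ (y ^ (β / k) / (β / k)) ^ k := by
          gcongr
          exact Real.log_nonneg hy
      _ = (k / β) ^ k * (y ^ (β / k)) ^ k := by rw [← mul_pow]; congr 1; field_simp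
      _ = _ := by
          rw [← Real.rpow_mul_natCast (by linarith)]
          congr 2; field_simp

theorem logMul_iterate (A : ℝ → ℂ) (k : ℕ) (y : ℝ) :
    (logMul^[k] A) y = (Real.log y : ℂ) ^ k * A y := by
  induction k with
  | zero => simp
  | succ k ih => rw [Function.iterate_succ_apply', logMul, ih]; ring

theorem SlowGrowth.iterate {A : ℝ → ℂ} (hA : SlowGrowth A) (k : ℕ) :
    SlowGrowth (logMul^[k] A) := by
  induction k with
  | zero => exact hA
  | succ k ih => rw [Function.iterate_succ_apply']; exact ih.mul_log

theorem integrableOn_log_pow {β : ℝ} (hβ : 0 < β) (k : ℕ) :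
    IntegrableOn (fun y : ℝ => Real.log y ^ k * y ^ (-β - 1)) (Ioi 1) ∧
    ∫ y in Ioi (1:ℝ), Real.log y ^ k * y ^ (-β - 1) ≤ (2 * k / β) ^ k * (2 / β) := by
  have hb : ∀ y ∈ Ioi (1:ℝ), Real.log y ^ k * y ^ (-β - 1) ≤
      (2 * k / β) ^ k * y ^ (-(β / 2) - 1) := by
    intro y hy
    have hy0 : (0:ℝ) < y := lt_trans one_pos hy
    have h := log_pow_le (le_of_lt hy) (half_pos hβ) k
    calc _ ≤ ((k / (β / 2)) ^ k * y ^ (β / 2)) * y ^ (-β - 1) := by gcongr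
      _ = (k / (β / 2)) ^ k * (y ^ (β / 2) * y ^ (-β - 1)) := by ring
      _ = _ := by
        rw [← Real.rpow_add hy0]
        congr 2
        · field_simp
        · ring
  have hi : IntegrableOn (fun y : ℝ => (2 * k / β) ^ k * y ^ (-(β / 2) - 1)) (Ioi 1) :=
    (integrableOn_Ioi_rpow_of_lt (by linarith) one_pos).const_mul _
  have h1 : IntegrableOn (fun y : ℝ => Real.log y ^ k * y ^ (-β - 1)) (Ioi 1) := by
    refine hi.mono' ?_ ?_
    · exact (by fun_prop : Measurable fun y : ℝ => Real.log y ^ k * y ^ (-β - 1)).aestronglyMeasurable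
    · refine (ae_restrict_iff' measurableSet_Ioi).2 (.of_forall fun y hy => ?_)
      have hy' : (1:ℝ) < y := hy
      have := Real.log_nonneg hy'.le
      rw [Real.norm_of_nonneg (by positivity)]
      exact hb y hy
  refine ⟨h1, (setIntegral_mono_on h1 hi measurableSet_Ioi hb).trans (le_of_eq ?_)⟩
  rw [integral_const_mul, integral_Ioi_rpow_of_lt (by linarith) one_pos]
  congr 1
  rw [Real.one_rpow]; field_simp; ring_nf; field_simp

theorem SlowGrowth.norm_mel_le {A : ℝ → ℂ} (hA : SlowGrowth A) {M α β : ℝ} (hβ : 0 < β)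
    (hM : ∀ y, 1 ≤ y → ‖A y‖ ≤ M * y ^ α) {s : ℂ} (hs : α + β ≤ s.re) (k : ℕ) :
    ‖mel (logMul^[k] A) s‖ ≤ M * ((2 * k / β) ^ k * (2 / β)) := by
  have hM0 : 0 ≤ M := by
    have := (norm_nonneg _).trans (hM 1 le_rfl)
    simpa using this
  obtain ⟨h1, h2⟩ := integrableOn_log_pow hβ k
  rw [mel, mellin, setIntegral_Ioi_zero_eq (by
    intro y hy; rw [(hA.iterate k).zero y hy, smul_zero])]
  refine (norm_integral_le_of_norm_le (h1.const_mul M) ?_).trans ?_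
  · refine (ae_restrict_iff' measurableSet_Ioi).2 (.of_forall fun y hy => ?_)
    have hy' : (1:ℝ) < y := hy
    have hl := Real.log_nonneg hy'.le
    have hy0 : 0 < y := by linarith
    rw [norm_smul, Complex.norm_cpow_eq_rpow_re_of_pos hy0, logMul_iterate, norm_mul, norm_pow,
      Complex.norm_real, Real.norm_of_nonneg hl]
    calc _ ≤ y ^ (-s - 1).re * (Real.log y ^ k * (M * y ^ α)) := by
          gcongr; exact hM y hy'.le
      _ ≤ y ^ (-(α + β) - 1) * (Real.log y ^ k * (M * y ^ α)) := by
          gcongr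
          · exact hy'.le
          · simp; linarith
      _ = M * (Real.log y ^ k * (y ^ (-(α + β) - 1) * y ^ α)) := by ring
      _ = _ := by rw [← Real.rpow_add hy0]; ring_nf
  · rw [integral_const_mul]
    gcongr

theorem Subpoly.mul_log {g : ℕ → ℂ} (hg : Subpoly g) :
    Subpoly (fun n => (Real.log n : ℂ) * g n) := by
  intro ε hε
  obtain ⟨C, hC⟩ := hg (ε / 2) (by linarith)
  refine ⟨(2 / ε) * C, fun n hn => ?_⟩
  have hn' : (1:ℝ) ≤ n := by exact_mod_cast hn
  have h1 := log_pow_le hn' (half_pos hε) 1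
  have h2 := Real.log_nonneg hn'
  rw [norm_mul, Complex.norm_real, Real.norm_of_nonneg h2]
  calc Real.log n * ‖g n‖ ≤ ((1 / (ε / 2)) * (n:ℝ) ^ (ε / 2)) * (C * (n:ℝ) ^ (ε / 2)) := by
        gcongr
        · simpa using h1
        · exact hC n hn
    _ = 2 / ε * C * ((n:ℝ) ^ (ε / 2) * (n:ℝ) ^ (ε / 2)) := by field_simp
    _ = _ := by rw [← Real.rpow_add (by linarith)]; ring_nf

theorem subpoly_of_norm_le_one {g : ℕ → ℂ} (hg : ∀ n, ‖g n‖ ≤ 1) : Subpoly g := fun ε hε =>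
  ⟨1, fun n hn => (hg n).trans (by
    rw [one_mul]; exact Real.one_le_rpow (by exact_mod_cast hn) hε.le)⟩

theorem Subpoly.mono {g h : ℕ → ℂ} (hg : Subpoly g) (H : ∀ n, ‖h n‖ ≤ ‖g n‖) : Subpoly h :=
  fun ε hε => (hg ε hε).imp fun _ hC n hn => (H n).trans (hC n hn)

theorem subpoly_vonMangoldt_mul {g : ℕ → ℂ} (hg : ∀ n, ‖g n‖ ≤ 1) :
    Subpoly (fun n => (ArithmeticFunction.vonMangoldt n : ℂ) * g n) := by
  refine (subpoly_of_norm_le_one hg).mul_log.mono fun n => ?_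
  rw [norm_mul, norm_mul]
  gcongr
  rw [Complex.norm_real, Complex.norm_real, Real.norm_of_nonneg ArithmeticFunction.vonMangoldt_nonneg,
    Real.norm_of_nonneg (Real.log_natCast_nonneg n)]
  exact ArithmeticFunction.vonMangoldt_le_log

end PretentiousSieve

namespace PretentiousSieve

open Finset

/-- Elementary symmetric sums. -/
noncomputable def esum (k : ℕ) (S : Finset ℕ) (x : ℕ → ℝ) : ℝ :=
  ∑ s ∈ S.powersetCard k, ∏ p ∈ s, x p

/-- Truncated inclusion-exclusion sums. -/
noncomputable def trunc (b : ℕ) (S : Finset ℕ) (x : ℕ → ℝ) : ℝ :=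
  ∑ k ∈ range (b + 1), (-1) ^ k * esum k S x

theorem esum_zero (S : Finset ℕ) (x : ℕ → ℝ) : esum 0 S x = 1 := by simp [esum]

theorem esum_insert {p : ℕ} {S : Finset ℕ} (hp : p ∉ S) (k : ℕ) (x : ℕ → ℝ) :
    esum (k + 1) (insert p S) x = esum (k + 1) S x + x p * esum k S x := by
  rw [esum, powersetCard_succ_insert hp, sum_union, sum_image, esum, esum, mul_sum]
  · congr 1
    refine sum_congr rfl fun s hs => ?_
    rw [prod_insert]
    exact fun h => hp ((mem_powersetCard.1 hs).1 h)
  · intro s hs t ht h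
    have h1 : p ∉ s := fun h => hp ((mem_powersetCard.1 hs).1 h)
    have h2 : p ∉ t := fun h => hp ((mem_powersetCard.1 ht).1 h)
    simpa [erase_insert h1, erase_insert h2] using congrArg (fun u => u.erase p) h
  · rw [disjoint_left]
    intro s hs ht
    obtain ⟨t, -, rfl⟩ := mem_image.1 ht
    exact hp ((mem_powersetCard.1 hs).1 (mem_insert_self _ _))

theorem trunc_zero (S : Finset ℕ) (x : ℕ → ℝ) : trunc 0 S x = 1 := by simp [trunc, esum_zero]

theorem trunc_succ (b : ℕ) (S : Finset ℕ) (x : ℕ → ℝ) :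
    trunc (b + 1) S x = trunc b S x + (-1) ^ (b + 1) * esum (b + 1) S x := by
  rw [trunc, sum_range_succ, trunc]

theorem trunc_insert {p : ℕ} {S : Finset ℕ} (hp : p ∉ S) (b : ℕ) (x : ℕ → ℝ) :
    trunc (b + 1) (insert p S) x = trunc (b + 1) S x - x p * trunc b S x := by
  induction b with
  | zero => simp [trunc_succ, trunc_zero, esum_insert hp, esum_zero]; ring
  | succ b ih => rw [trunc_succ, ih, trunc_succ (b + 1) S, trunc_succ b S, esum_insert hp]; ring

theorem esum_nonneg {S : Finset ℕ} {x : ℕ → ℝ} (hx : ∀ p, 0 ≤ x p) (k : ℕ) : 0 ≤ esum k S x :=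
  sum_nonneg fun _ _ => prod_nonneg fun p _ => hx p

theorem bonferroni_nonneg {x : ℕ → ℝ} (hx : ∀ p, 0 ≤ x p) (hx1 : ∀ p, x p ≤ 1) (S : Finset ℕ)
    (b : ℕ) : 0 ≤ (-1) ^ b * (trunc b S x - ∏ p ∈ S, (1 - x p)) := by
  induction S using Finset.induction_on generalizing b with
  | empty =>
    have : trunc b ∅ x = 1 := by
      induction b with
      | zero => exact trunc_zero _ _
      | succ b ih =>
        rw [trunc_succ, ih, esum, powersetCard_eq_empty.2 (by simp)]; simp
    simp [this]
  | insert p S hp ih =>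
    cases b with
    | zero =>
      rw [trunc_zero, pow_zero, one_mul, sub_nonneg]
      exact prod_le_one (fun i _ => by linarith [hx1 i]) (fun i _ => by linarith [hx i])
    | succ b =>
      rw [trunc_insert hp, prod_insert hp]
      have h1 := ih (b + 1)
      have h2 := mul_nonneg (hx p) (ih b)
      rw [pow_succ] at h1 ⊢
      linarith

theorem bonferroni_le {x : ℕ → ℝ} (hx : ∀ p, 0 ≤ x p) (hx1 : ∀ p, x p ≤ 1) (S : Finset ℕ)
    (b : ℕ) : (-1) ^ b * (trunc b S x - ∏ p ∈ S, (1 - x p)) ≤ esum (b + 1) S x := by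
  have h := bonferroni_nonneg hx hx1 S (b + 1)
  rw [trunc_succ, pow_succ] at h
  have h2 : ((-1:ℝ) ^ b) ^ 2 = 1 := by rw [← pow_mul, mul_comm, pow_mul]; simp
  linear_combination h + esum (b + 1) S x * h2

theorem pow_add_mul_le {A x : ℝ} (hA : 0 ≤ A) (hx : 0 ≤ x) (k : ℕ) :
    A ^ (k + 1) + (k + 1) * x * A ^ k ≤ (A + x) ^ (k + 1) := by
  induction k with
  | zero => simp
  | succ k ih =>
    have h1 : 0 ≤ A ^ k := by positivity
    calc A ^ (k + 1 + 1) + ((k + 1 : ℕ) + 1) * x * A ^ (k + 1)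
        ≤ A ^ (k + 1 + 1) + ((k + 1 : ℕ) + 1) * x * A ^ (k + 1) + (k + 1) * x ^ 2 * A ^ k := by
          have : 0 ≤ (k + 1) * x ^ 2 * A ^ k := by positivity
          linarith
      _ = (A ^ (k + 1) + (k + 1) * x * A ^ k) * (A + x) := by push_cast; ring
      _ ≤ _ := by rw [pow_succ (A + x)]; gcongr

theorem esum_le {x : ℕ → ℝ} (hx : ∀ p, 0 ≤ x p) (S : Finset ℕ) (k : ℕ) :
    esum k S x ≤ (∑ p ∈ S, x p) ^ k / k.factorial := by
  induction S using Finset.induction_on generalizing k with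
  | empty =>
    cases k with
    | zero => simp [esum_zero]
    | succ k => simp [esum, powersetCard_eq_empty.2 (show #(∅ : Finset ℕ) < k + 1 by simp)]
  | insert p S hp ih =>
    cases k with
    | zero => simp [esum_zero]
    | succ k =>
      rw [esum_insert hp, sum_insert hp]
      have hA : 0 ≤ ∑ p ∈ S, x p := sum_nonneg fun p _ => hx p
      have h := pow_add_mul_le hA (hx p) k
      have hk : (0:ℝ) < k.factorial := by positivity
      calc _ ≤ (∑ p ∈ S, x p) ^ (k + 1) / (k + 1).factorial
            + x p * ((∑ p ∈ S, x p) ^ k / k.factorial) := by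
            have := hx p
            gcongr
            · exact ih (k + 1)
            · exact ih k
        _ = ((∑ p ∈ S, x p) ^ (k + 1) + (k + 1) * x p * (∑ p ∈ S, x p) ^ k)
            / (k + 1).factorial := by
            rw [Nat.factorial_succ]; push_cast; field_simp
        _ ≤ _ := by
            rw [add_comm (x p)]
            gcongr

/-- `φ` is a multilinear polynomial in the variables indexed by `S` whose coefficients have
absolute sum at most `N`. -/
def Rep (S : Finset ℕ) (N : ℝ) (φ : (ℕ → ℝ) → ℝ) : Prop :=
  ∃ (ι : Type) (I : Finset ι) (c : ι → ℝ) (s : ι → Finset ℕ), (∀ i ∈ I, s i ⊆ S) ∧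
    ∑ i ∈ I, |c i| ≤ N ∧ ∀ x, φ x = ∑ i ∈ I, c i * ∏ p ∈ s i, x p

theorem Rep.mono {S S' : Finset ℕ} {N N' : ℝ} {φ : (ℕ → ℝ) → ℝ} (h : Rep S N φ) (hS : S ⊆ S')
    (hN : N ≤ N') : Rep S' N' φ := by
  obtain ⟨ι, I, c, s, h1, h2, h3⟩ := h
  exact ⟨ι, I, c, s, fun i hi => (h1 i hi).trans hS, h2.trans hN, h3⟩

theorem Rep.add {S : Finset ℕ} {N N' : ℝ} {φ ψ : (ℕ → ℝ) → ℝ} (h : Rep S N φ) (h' : Rep S N' ψ) :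
    Rep S (N + N') (fun x => φ x + ψ x) := by
  obtain ⟨ι, I, c, s, h1, h2, h3⟩ := h
  obtain ⟨ι', I', c', s', h1', h2', h3'⟩ := h'
  refine ⟨ι ⊕ ι', I.disjSum I', Sum.elim c c', Sum.elim s s', ?_, ?_, ?_⟩
  · rintro (i | i) hi
    · exact h1 i (by simpa using hi)
    · exact h1' i (by simpa using hi)
  · simp only [sum_disjSum, Sum.elim_inl, Sum.elim_inr]; linarith
  · intro x; simp only [sum_disjSum, Sum.elim_inl, Sum.elim_inr, h3, h3']

theorem Rep.mul {S S' : Finset ℕ} {N N' : ℝ} {φ ψ : (ℕ → ℝ) → ℝ} (h : Rep S N φ)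
    (h' : Rep S' N' ψ) (hd : Disjoint S S') :
    Rep (S ∪ S') (N * N') (fun x => φ x * ψ x) := by
  obtain ⟨ι, I, c, s, h1, h2, h3⟩ := h
  obtain ⟨ι', I', c', s', h1', h2', h3'⟩ := h'
  refine ⟨ι × ι', I ×ˢ I', fun i => c i.1 * c' i.2, fun i => s i.1 ∪ s' i.2, ?_, ?_, ?_⟩
  · intro i hi
    rw [mem_product] at hi
    exact union_subset_union (h1 _ hi.1) (h1' _ hi.2)
  · rw [sum_product]
    simp only [abs_mul, ← mul_sum, ← sum_mul]
    have : 0 ≤ ∑ i ∈ I', |c' i| := sum_nonneg fun _ _ => abs_nonneg _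
    exact mul_le_mul h2 h2' this ((sum_nonneg fun _ _ => abs_nonneg _).trans h2)
  · intro x
    simp only [h3, h3']
    rw [sum_mul_sum, sum_product]
    refine sum_congr rfl fun i hi => sum_congr rfl fun j hj => ?_
    rw [prod_union (disjoint_of_subset_left (h1 i hi) (disjoint_of_subset_right (h1' j hj) hd))]
    ring

theorem rep_one (S : Finset ℕ) : Rep S 1 (fun _ => 1) :=
  ⟨Unit, {()}, fun _ => 1, fun _ => ∅, by simp, by simp, by simp⟩

theorem rep_zero (S : Finset ℕ) : Rep S 0 (fun _ => 0) :=
  ⟨Unit, ∅, fun _ => 1, fun _ => ∅, by simp, by simp, by simp⟩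

theorem rep_esum (k : ℕ) (S : Finset ℕ) : Rep S ((#S + 1 : ℝ) ^ k) (esum k S) := by
  refine ⟨Finset ℕ, S.powersetCard k, fun _ => 1, id, fun s hs => (mem_powersetCard.1 hs).1,
    ?_, fun x => by simp [esum]⟩
  simp only [abs_one, sum_const, card_powersetCard, nsmul_eq_mul, mul_one]
  have : (#S).choose k ≤ (#S + 1) ^ k := (Nat.choose_le_pow _ _).trans (by gcongr; omega)
  exact_mod_cast this

theorem sum_choose_le (m b : ℕ) : ∑ k ∈ range (b + 1), m.choose k ≤ (m + 1) ^ b := by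
  have h : ∀ k ∈ range (b + 1), m.choose k ≤ m ^ k * 1 ^ (b - k) * b.choose k := by
    intro k hk
    rw [one_pow, mul_one]
    have h2 : 0 < b.choose k := Nat.choose_pos (by simpa [Nat.lt_succ_iff] using hk)
    exact (Nat.choose_le_pow _ _).trans (Nat.le_mul_of_pos_right _ h2)
  refine (sum_le_sum h).trans (le_of_eq ?_)
  rw [add_pow]; rfl

theorem rep_trunc (b : ℕ) (S : Finset ℕ) : Rep S ((#S + 1 : ℝ) ^ b) (trunc b S) := by
  have key : Rep S (∑ k ∈ range (b + 1), ((#S).choose k : ℝ)) (trunc b S) := by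
    induction b with
    | zero =>
      have : trunc 0 S = fun _ => 1 := by funext x; exact trunc_zero S x
      rw [this]; simpa using rep_one S
    | succ b ih =>
      have : trunc (b + 1) S = fun x => trunc b S x + (-1) ^ (b + 1) * esum (b + 1) S x := by
        funext x; exact trunc_succ b S x
      rw [this, sum_range_succ]
      refine ih.add ⟨Finset ℕ, S.powersetCard (b + 1), fun _ => (-1) ^ (b + 1), id,
        fun s hs => (mem_powersetCard.1 hs).1, ?_, fun x => by simp [esum, mul_sum]⟩
      simp
  exact key.mono subset_rfl (by exact_mod_cast sum_choose_le (#S) b)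

end PretentiousSieve

namespace PretentiousSieve

open Finset

/-- The Brun-Hooley upper bound majorant. -/
noncomputable def theta (P : ℕ → Finset ℕ) (b : ℕ → ℕ) : ℕ → (ℕ → ℝ) → ℝ
  | 0, _ => 1
  | K + 1, x => theta P b K x * trunc (b K) (P K) x

/-- The error of the Brun-Hooley majorant. -/
noncomputable def ups (P : ℕ → Finset ℕ) (b : ℕ → ℕ) : ℕ → (ℕ → ℝ) → ℝ
  | 0, _ => 0
  | K + 1, x => ups P b K x * trunc (b K) (P K) x + theta P b K x * esum (b K + 1) (P K) x

variable {P : ℕ → Finset ℕ} {b : ℕ → ℕ}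

theorem biUnion_range_succ (P : ℕ → Finset ℕ) (K : ℕ) :
    (range (K + 1)).biUnion P = (range K).biUnion P ∪ P K := by
  rw [range_add_one, biUnion_insert, union_comm]

theorem disjoint_biUnion_range (hd : Pairwise (fun i j => Disjoint (P i) (P j))) (K : ℕ) :
    Disjoint ((range K).biUnion P) (P K) := by
  rw [disjoint_biUnion_left]
  intro i hi
  exact hd (by simp at hi; omega)

theorem one_le_prod_block (K : ℕ) : 1 ≤ ∏ j ∈ range K, (#(P j) + 1 : ℝ) ^ (b j + 1) := by
  have : (1 : ℝ) = ∏ j ∈ range K, 1 := by simp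
  rw [this]
  refine prod_le_prod (fun _ _ => zero_le_one) fun j _ => one_le_pow₀ (by simp)

theorem rep_theta (hd : Pairwise (fun i j => Disjoint (P i) (P j))) (K : ℕ) :
    Rep ((range K).biUnion P) (∏ j ∈ range K, (#(P j) + 1 : ℝ) ^ (b j + 1)) (theta P b K) := by
  induction K with
  | zero =>
    have : theta P b 0 = fun _ => 1 := by funext x; rfl
    rw [this]; simpa using rep_one ∅
  | succ K ih =>
    rw [biUnion_range_succ, prod_range_succ]
    refine (ih.mul (rep_trunc (b K) (P K)) (disjoint_biUnion_range hd K)).mono subset_rfl ?_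
    have := one_le_prod_block (P := P) (b := b) K
    gcongr
    · simp
    · omega

theorem rep_ups (hd : Pairwise (fun i j => Disjoint (P i) (P j))) (K : ℕ) :
    Rep ((range K).biUnion P) (K * ∏ j ∈ range K, (#(P j) + 1 : ℝ) ^ (b j + 1)) (ups P b K) := by
  induction K with
  | zero =>
    have : ups P b 0 = fun _ => 0 := by funext x; rfl
    rw [this]; simpa using rep_zero ∅
  | succ K ih =>
    rw [biUnion_range_succ, prod_range_succ]
    have h1 := ih.mul (rep_trunc (b K) (P K)) (disjoint_biUnion_range hd K)
    have h2 := (rep_theta (b := b) hd K).mul (rep_esum (b K + 1) (P K))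
      (disjoint_biUnion_range hd K)
    refine (h1.add h2).mono subset_rfl ?_
    have h3 := one_le_prod_block (P := P) (b := b) K
    have hm : (1:ℝ) ≤ #(P K) + 1 := by simp
    generalize (∏ j ∈ range K, (#(P j) + 1 : ℝ) ^ (b j + 1)) = W at h3 ⊢
    generalize (#(P K) + 1 : ℝ) = m at hm ⊢
    have h4 : m ^ (b K) ≤ m ^ (b K + 1) := pow_le_pow_right₀ hm (by omega)
    calc K * W * m ^ b K + W * m ^ (b K + 1) ≤ K * W * m ^ (b K + 1) + W * m ^ (b K + 1) := by
          gcongr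
      _ = _ := by push_cast; ring

theorem theta_bounds (hd : Pairwise (fun i j => Disjoint (P i) (P j))) (hb : ∀ j, Even (b j))
    {x : ℕ → ℝ} (hx : ∀ p, 0 ≤ x p) (hx1 : ∀ p, x p ≤ 1) (K : ℕ) :
    ∏ p ∈ (range K).biUnion P, (1 - x p) ≤ theta P b K x ∧
    theta P b K x - ∏ p ∈ (range K).biUnion P, (1 - x p) ≤ ups P b K x := by
  induction K with
  | zero => simp [theta, ups]
  | succ K ih =>
    rw [biUnion_range_succ, prod_union (disjoint_biUnion_range hd K), theta, ups]
    have h1 := bonferroni_nonneg hx hx1 (P K) (b K)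
    have h2 := bonferroni_le hx hx1 (P K) (b K)
    rw [(hb K).neg_one_pow, one_mul] at h1 h2
    set V := ∏ p ∈ (range K).biUnion P, (1 - x p)
    set v := ∏ p ∈ P K, (1 - x p)
    have hV : 0 ≤ V := prod_nonneg fun p _ => by linarith [hx1 p]
    have hv : 0 ≤ v := prod_nonneg fun p _ => by linarith [hx1 p]
    obtain ⟨i1, i2⟩ := ih
    constructor
    · exact mul_le_mul i1 (by linarith) hv (hV.trans i1)
    · have e : theta P b K x * trunc (b K) (P K) x - V * v =
        (theta P b K x - V) * trunc (b K) (P K) x + V * (trunc (b K) (P K) x - v) := by ring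
      rw [e]
      have : 0 ≤ trunc (b K) (P K) x := by linarith
      have h3 := esum_nonneg (S := P K) hx (b K + 1)
      have h00 := hV.trans i1
      gcongr

theorem theta_eval (hd : Pairwise (fun i j => Disjoint (P i) (P j))) (hb : ∀ j, Even (b j))
    {x : ℕ → ℝ} (hx : ∀ p, 0 ≤ x p) (hx1 : ∀ p, x p ≤ 1) {ε : ℕ → ℝ} (hε : ∀ j, 0 ≤ ε j)
    (he : ∀ j, esum (b j + 1) (P j) x ≤ ε j * ∏ p ∈ P j, (1 - x p)) (K : ℕ) :
    theta P b K x ≤ (∏ j ∈ range K, (1 + ε j)) * ∏ p ∈ (range K).biUnion P, (1 - x p) ∧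
    ups P b K x ≤ ((∑ j ∈ range K, ε j) * ∏ j ∈ range K, (1 + ε j)) *
      ∏ p ∈ (range K).biUnion P, (1 - x p) := by
  induction K with
  | zero => simp [theta, ups]
  | succ K ih =>
    rw [biUnion_range_succ, prod_union (disjoint_biUnion_range hd K), theta, ups,
      prod_range_succ, sum_range_succ]
    have h1 := bonferroni_nonneg hx hx1 (P K) (b K)
    have h2 := bonferroni_le hx hx1 (P K) (b K)
    have h0 := theta_bounds hd hb hx hx1 K
    have h6 := he K
    have h7 := hε K
    rw [(hb K).neg_one_pow, one_mul] at h1 h2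
    set V := ∏ p ∈ (range K).biUnion P, (1 - x p)
    set v := ∏ p ∈ P K, (1 - x p)
    set E := ∏ j ∈ range K, (1 + ε j)
    set s := ∑ j ∈ range K, ε j
    have hV : 0 ≤ V := prod_nonneg fun p _ => by linarith [hx1 p]
    have hv : 0 ≤ v := prod_nonneg fun p _ => by linarith [hx1 p]
    have hE : 0 ≤ E := prod_nonneg fun p _ => by linarith [hε p]
    have hs : 0 ≤ s := sum_nonneg fun p _ => hε p
    have hes := esum_nonneg (S := P K) hx (b K + 1)
    have ht : trunc (b K) (P K) x ≤ (1 + ε K) * v := by linarith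
    have ht0 : 0 ≤ trunc (b K) (P K) x := by linarith
    obtain ⟨i1, i2⟩ := ih
    have h00 : 0 ≤ theta P b K x := hV.trans h0.1
    constructor
    · calc _ ≤ (E * V) * ((1 + ε K) * v) := by gcongr
        _ = _ := by ring
    · calc _ ≤ (s * E * V) * ((1 + ε K) * v) + (E * V) * (ε K * v) := by gcongr
        _ ≤ (s * E * V) * ((1 + ε K) * v) + (E * V) * (ε K * v) + E * V * v * ε K ^ 2 := by
            have : 0 ≤ E * V * v * ε K ^ 2 := by positivity
            linarith
        _ = _ := by ring

open Real in
theorem sum_inv_prime_le_aux {w : ℝ} (hw : 1 < w) (m : ℕ) : ∀ S : Finset ℕ, (∀ p ∈ S, p.Prime) →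
    (∀ p ∈ S, w < p) → (∀ p ∈ S, (p:ℝ) ≤ 2 ^ m * w) →
    ∑ p ∈ S, (1 / p : ℝ) ≤ m * (2 * log 4 / log w) := by
  have hlw := Real.log_pos hw
  induction m with
  | zero =>
    intro S _ h2 h3
    have : S = ∅ := by
      rw [eq_empty_iff_forall_notMem]
      intro p hp
      have := h2 p hp; have := h3 p hp
      norm_num at this; linarith
    simp [this]
  | succ m ih =>
    intro S h1 h2 h3
    rw [← sum_filter_add_sum_filter_not S (fun p : ℕ => (p:ℝ) ≤ 2 ^ m * w)]
    have i1 := ih (S.filter (fun p : ℕ => (p:ℝ) ≤ 2 ^ m * w)) (fun p hp => h1 p (mem_filter.1 hp).1)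
      (fun p hp => h2 p (mem_filter.1 hp).1) (fun p hp => (mem_filter.1 hp).2)
    have i2 : ∑ p ∈ S.filter (fun p : ℕ => ¬ (p:ℝ) ≤ 2 ^ m * w), (1 / p : ℝ) ≤
        2 * log 4 / log w := by
      have hW : 0 < 2 ^ m * w := by positivity
      calc _ ≤ ∑ p ∈ S.filter (fun p : ℕ => ¬ (p:ℝ) ≤ 2 ^ m * w),
            log p * (1 / (log w * (2 ^ m * w))) := by
            refine sum_le_sum fun p hp => ?_
            rw [mem_filter, not_le] at hp
            have hp1 := h2 p hp.1
            have hl : log w ≤ log p := Real.log_le_log (by linarith) hp1.le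
            have hp0 : (0:ℝ) < p := by linarith
            rw [mul_one_div, div_le_div_iff₀ hp0 (by positivity), one_mul]
            exact mul_le_mul hl hp.2.le hW.le (by linarith)
        _ = (∑ p ∈ S.filter (fun p : ℕ => ¬ (p:ℝ) ≤ 2 ^ m * w), log p)
            * (1 / (log w * (2 ^ m * w))) := by rw [sum_mul]
        _ ≤ (log 4 * (2 ^ (m + 1) * w)) * (1 / (log w * (2 ^ m * w))) := by
            gcongr
            refine le_trans ?_ (Chebyshev.theta_le_log4_mul_x (x := 2 ^ (m + 1) * w) (by positivity))
            rw [Chebyshev.theta]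
            refine sum_le_sum_of_subset_of_nonneg ?_ ?_
            · intro p hp
              have hpS := (mem_filter.1 hp).1
              simp only [mem_filter, mem_Ioc]
              exact ⟨⟨(h1 p hpS).pos, (Nat.le_floor_iff (by positivity)).2 (h3 p hpS)⟩, h1 p hpS⟩
            · intro p _ _
              exact Real.log_natCast_nonneg p
        _ = _ := by rw [pow_succ]; field_simp
    push_cast
    linarith

open Real in
theorem sum_inv_prime_le {w : ℝ} (hw : 0 < w) {S : Finset ℕ} (h1 : ∀ p ∈ S, p.Prime)
    (h2 : ∀ p ∈ S, w < p) (h3 : ∀ p ∈ S, (p:ℝ) ≤ w ^ 2) : ∑ p ∈ S, (1 / p : ℝ) ≤ 12 := by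
  rcases S.eq_empty_or_nonempty with rfl | ⟨p, hp⟩
  · simp
  have hw2 : 2 ≤ w ^ 2 := le_trans (by exact_mod_cast (h1 p hp).two_le) (h3 p hp)
  have hw1 : 1 < w := by nlinarith
  have hlw := Real.log_pos hw1
  have hl2 : log 2 ≤ 2 * log w := by
    have := Real.log_le_log (by norm_num) hw2
    rwa [Real.log_pow] at this
  have hl0 : 0 < log 2 := Real.log_pos (by norm_num)
  set m := ⌈log w / log 2⌉₊
  have hm : log w / log 2 ≤ m := Nat.le_ceil _
  have hm2 : m ≤ log w / log 2 + 1 := (Nat.ceil_lt_add_one (by positivity)).le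
  have h4 : log 4 = 2 * log 2 := by
    rw [show (4:ℝ) = 2 ^ 2 by norm_num, Real.log_pow]; norm_num
  have := sum_inv_prime_le_aux hw1 m S h1 h2 (fun p hp => (h3 p hp).trans (by
    rw [sq]
    gcongr
    rw [div_le_iff₀ hl0, ← Real.log_pow] at hm
    exact (Real.log_le_log_iff hw (by positivity)).1 hm))
  refine this.trans ?_
  calc m * (2 * log 4 / log w) ≤ (log w / log 2 + 1) * (2 * log 4 / log w) := by
        rw [h4]; gcongr
    _ = 4 + 4 * (log 2 / log w) := by rw [h4]; field_simp; norm_num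
    _ ≤ 4 + 4 * 2 := by
        gcongr
        rw [div_le_iff₀ hlw]; exact hl2
    _ = 12 := by norm_num

open Real in
theorem exp_le_prod_one_sub_inv {S : Finset ℕ} (h1 : ∀ p ∈ S, p.Prime)
    (h : ∑ p ∈ S, (1 / p : ℝ) ≤ 12) : exp (-24) ≤ ∏ p ∈ S, (1 - 1 / (p:ℝ)) := by
  calc exp (-24) ≤ exp (∑ p ∈ S, (-2 * (1 / p : ℝ))) := by
        rw [Real.exp_le_exp, ← mul_sum]; linarith
    _ = ∏ p ∈ S, exp (-2 * (1 / p : ℝ)) := by rw [Real.exp_sum]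
    _ ≤ _ := by
        refine prod_le_prod (fun _ _ => (exp_pos _).le) fun p hp => ?_
        have h2 : (2:ℝ) ≤ p := by exact_mod_cast (h1 p hp).two_le
        set y : ℝ := 1 / p
        have hy : y ≤ 1 / 2 := by
          simp only [y]; gcongr
        have hy0 : 0 ≤ y := by positivity
        have h3 := Real.add_one_le_exp (2 * y)
        rw [show -2 * y = -(2 * y) by ring, Real.exp_neg]
        rw [inv_le_comm₀ (exp_pos _) (by linarith)]
        refine le_trans ?_ h3
        rw [inv_le_iff_one_le_mul₀ (by linarith)]
        nlinarith

end PretentiousSieve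

namespace PretentiousSieve

open Finset

theorem sum_block_exponents (c : ℝ) (K : ℕ) :
    ∑ j ∈ range K, (1 / 2 : ℝ) ^ j * (c + 2 * j) = 2 * c + 4 - (2 * c + 4 * K + 4) / 2 ^ K := by
  induction K with
  | zero => simp
  | succ K ih =>
    rw [sum_range_succ, ih, one_div, inv_pow, pow_succ]
    push_cast
    field_simp
    ring

theorem block_level_aux {z K W : ℝ} {b : ℕ} (hz : 1 ≤ z) (hK : K ≤ z ^ 2) (hW : 0 ≤ W)
    (h : W ≤ z ^ (4 * b + 6)) : W ≤ z ^ (4 * b + 8) ∧ K * W ≤ z ^ (4 * b + 8) := by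
  refine ⟨h.trans (pow_le_pow_right₀ hz (by lia)), ?_⟩
  rw [show 4 * b + 8 = 2 + (4 * b + 6) by ring, pow_add]
  exact mul_le_mul hK h hW (by positivity)

set_option maxHeartbeats 1600000 in
theorem brun_hooley : ∃ C : ℝ, 1 ≤ C ∧ ∀ z : ℝ, 2 ≤ z → ∀ b : ℕ, ∀ S : Finset ℕ,
    (∀ p ∈ S, p.Prime) → (∀ p ∈ S, (p:ℝ) ≤ z) → ∃ φ ψ : (ℕ → ℝ) → ℝ,
      Rep S (z ^ (4 * b + 8)) φ ∧ Rep S (z ^ (4 * b + 8)) ψ ∧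
      (∀ x : ℕ → ℝ, (∀ p, 0 ≤ x p) → (∀ p, x p ≤ 1) →
        ∏ p ∈ S, (1 - x p) ≤ φ x ∧ φ x - ∏ p ∈ S, (1 - x p) ≤ ψ x) ∧
      φ (fun p => 1 / p) ≤ C * ∏ p ∈ S, (1 - 1 / (p:ℝ)) ∧
      ψ (fun p => 1 / p) ≤ C * Real.exp (-b) * ∏ p ∈ S, (1 - 1 / (p:ℝ)) := by
  set A : ℝ := Real.exp (24 + 12 * Real.exp 1) with hA
  have hA0 : 0 < A := Real.exp_pos _
  refine ⟨(1 + A) * Real.exp A, ?_, ?_⟩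
  · have := Real.one_le_exp hA0.le
    nlinarith
  intro z hz b S hS hSz
  have hz0 : 0 < z := by linarith
  have hz1 : 1 ≤ z := by linarith
  set w : ℕ → ℝ := fun j => z ^ ((1 / 2 : ℝ) ^ j) with hw
  have hw0 : ∀ j, 0 < w j := fun j => Real.rpow_pos_of_pos hz0 _
  have hw1 : ∀ j, 1 ≤ w j := fun j => Real.one_le_rpow hz1 (by positivity)
  have hwsq : ∀ j, w (j + 1) ^ 2 = w j := by
    intro j
    simp only [hw]
    rw [← Real.rpow_mul_natCast hz0.le, pow_succ]
    congr 1; push_cast; ring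
  have hanti : Antitone w := antitone_nat_of_succ_le fun j => by
    rw [← hwsq j]; nlinarith [hw1 (j + 1)]
  set P : ℕ → Finset ℕ := fun j => S.filter (fun p : ℕ => w (j + 1) < p ∧ (p:ℝ) ≤ w j) with hP
  set K : ℕ := ⌈z⌉₊ with hK
  have hK1 : 1 ≤ K := Nat.one_le_ceil_iff.2 hz0
  have hwK : w K < 2 := by
    have h1 : z < 2 ^ 2 ^ K := by
      have h2 : K < 2 ^ 2 ^ K := (Nat.lt_two_pow_self).trans Nat.lt_two_pow_self
      calc z ≤ K := Nat.le_ceil z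
        _ < _ := by exact_mod_cast h2
    have : w K < ((2:ℝ) ^ 2 ^ K) ^ ((1 / 2 : ℝ) ^ K) :=
      Real.rpow_lt_rpow hz0.le h1 (by positivity)
    refine this.trans_le (le_of_eq ?_)
    rw [← Real.rpow_natCast_mul (by norm_num)]
    push_cast
    rw [← mul_pow]; norm_num
  have hd : Pairwise (fun i j => Disjoint (P i) (P j)) := by
    have key : ∀ i j, i < j → Disjoint (P i) (P j) := by
      intro i j hij
      rw [disjoint_left]
      intro p hp hp'
      have h1 := (mem_filter.1 hp).2.1
      have h2 := (mem_filter.1 hp').2.2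
      have h3 := hanti (show i + 1 ≤ j by omega)
      linarith
    intro i j hij
    rcases lt_or_gt_of_ne hij with h | h
    · exact key i j h
    · exact (key j i h).symm
  have hU : (range K).biUnion P = S := by
    ext p
    rw [mem_biUnion]
    constructor
    · rintro ⟨j, -, hj⟩; exact (mem_filter.1 hj).1
    · intro hp
      have hex : ∃ j, w (j + 1) < p := ⟨K - 1, by
        rw [Nat.sub_add_cancel hK1]
        exact hwK.trans_le (by exact_mod_cast (hS p hp).two_le)⟩
      classical
      have hle : Nat.find hex ≤ K - 1 := Nat.find_min' hex (by
        rw [Nat.sub_add_cancel hK1]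
        exact hwK.trans_le (by exact_mod_cast (hS p hp).two_le))
      refine ⟨Nat.find hex, by rw [mem_range]; omega, mem_filter.2 ⟨hp, Nat.find_spec hex, ?_⟩⟩
      rcases Nat.eq_zero_or_pos (Nat.find hex) with h0 | h0
      · rw [h0]; simpa [hw] using hSz p hp
      · have := Nat.find_min hex (m := Nat.find hex - 1) (by omega)
        rw [Nat.sub_add_cancel h0] at this
        exact not_lt.1 this
  set bs : ℕ → ℕ := fun j => 2 * (b + j) with hbs
  have hbe : ∀ j, Even (bs j) := fun j => even_two_mul _
  have hcard : ∀ j, (#(P j) + 1 : ℝ) ≤ w j := by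
    intro j
    have h1 : P j ⊆ Ioc 1 ⌊w j⌋₊ := by
      intro p hp
      obtain ⟨h1, h2, h3⟩ := mem_filter.1 hp
      exact mem_Ioc.2 ⟨(hS p h1).one_lt, (Nat.le_floor_iff (hw0 j).le).2 h3⟩
    have h2 := card_le_card h1
    rw [Nat.card_Ioc] at h2
    have h3 : 1 ≤ ⌊w j⌋₊ := (Nat.one_le_floor_iff _).2 (hw1 j)
    have h4 : #(P j) + 1 ≤ ⌊w j⌋₊ := by omega
    calc (#(P j) + 1 : ℝ) ≤ (⌊w j⌋₊ : ℝ) := by exact_mod_cast h4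
      _ ≤ w j := Nat.floor_le (hw0 j).le
  have hprod : ∏ j ∈ range K, (#(P j) + 1 : ℝ) ^ (bs j + 1) ≤ z ^ (4 * b + 6) := by
    calc _ ≤ ∏ j ∈ range K, z ^ ((1 / 2 : ℝ) ^ j * ((2 * b + 1 : ℝ) + 2 * j)) := by
          refine prod_le_prod (fun _ _ => by positivity) fun j _ => ?_
          calc _ ≤ w j ^ (bs j + 1) := by gcongr; exact hcard j
            _ = _ := by
              simp only [hw, hbs]
              rw [← Real.rpow_mul_natCast hz0.le]
              congr 1; push_cast; ring
      _ = z ^ (∑ j ∈ range K, (1 / 2 : ℝ) ^ j * ((2 * b + 1 : ℝ) + 2 * j)) := by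
          rw [Real.rpow_sum_of_pos hz0]
      _ ≤ z ^ ((4 * b + 6 : ℕ) : ℝ) := by
          refine Real.rpow_le_rpow_of_exponent_le hz1 ?_
          rw [sum_block_exponents]
          have : (0:ℝ) ≤ (2 * (2 * b + 1) + 4 * K + 4) / 2 ^ K := by positivity
          push_cast
          linarith
      _ = _ := Real.rpow_natCast _ _
  have hKz : (K:ℝ) ≤ z ^ 2 := by
    have := (Nat.ceil_lt_add_one hz0.le).le
    nlinarith
  have hW0 : 0 ≤ ∏ j ∈ range K, (#(P j) + 1 : ℝ) ^ (bs j + 1) :=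
    prod_nonneg fun _ _ => by positivity
  obtain ⟨hN1, hN2⟩ := block_level_aux hz1 hKz hW0 hprod
  set ε : ℕ → ℝ := fun j => A * Real.exp (-b) * (1 / 2) ^ (j + 1) with hεdef
  have hε : ∀ j, 0 ≤ ε j := fun j => by positivity
  set x : ℕ → ℝ := fun p => 1 / (p:ℝ) with hx
  have hx0 : ∀ p, 0 ≤ x p := fun p => by positivity
  have hx1 : ∀ p, x p ≤ 1 := fun p => by
    simp only [hx, one_div]; exact Nat.cast_inv_le_one p
  have he : ∀ j, esum (bs j + 1) (P j) x ≤ ε j * ∏ p ∈ P j, (1 - x p) := by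
    intro j
    have hpr : ∀ p ∈ P j, p.Prime := fun p hp => hS p (mem_filter.1 hp).1
    have h12 : ∑ p ∈ P j, x p ≤ 12 := sum_inv_prime_le (hw0 (j + 1)) hpr
      (fun p hp => (mem_filter.1 hp).2.1) (fun p hp => by
        rw [hwsq]; exact (mem_filter.1 hp).2.2)
    have hv := exp_le_prod_one_sub_inv hpr h12
    set m := bs j + 1 with hm
    have hsum0 : 0 ≤ ∑ p ∈ P j, x p := sum_nonneg fun p _ => hx0 p
    have h1 : (12 * Real.exp 1) ^ m / m.factorial ≤ Real.exp (12 * Real.exp 1) :=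
      Real.pow_div_factorial_le_exp _ (by positivity) m
    have h2 : Real.exp (-1) ≤ 1 / 2 := by
      rw [Real.exp_neg, one_div]
      gcongr
      have := Real.add_one_le_exp 1
      linarith
    calc esum m (P j) x ≤ (∑ p ∈ P j, x p) ^ m / m.factorial := esum_le hx0 _ _
      _ ≤ 12 ^ m / m.factorial := by gcongr
      _ = ((12 * Real.exp 1) ^ m / m.factorial) * Real.exp (-1) ^ m := by
          rw [mul_pow, div_mul_eq_mul_div, mul_assoc, ← mul_pow, ← Real.exp_add]; simp
      _ ≤ Real.exp (12 * Real.exp 1) * (Real.exp (-b) * (1 / 2) ^ (j + 1)) := by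
          refine mul_le_mul h1 ?_ (by positivity) (by positivity)
          rw [show m = b + (b + j) + (j + 1) by simp only [hm, hbs]; ring, pow_add, pow_add]
          have e1 : Real.exp (-1) ^ b = Real.exp (-b) := by
            rw [← Real.exp_nat_mul]; ring_nf
          rw [e1]
          have e2 : Real.exp (-1) ^ (b + j) ≤ 1 :=
            pow_le_one₀ (by positivity) (h2.trans (by norm_num))
          calc _ ≤ Real.exp (-b) * 1 * (1 / 2) ^ (j + 1) := by gcongr
            _ = _ := by ring
      _ = ε j * Real.exp (-24) := by
          simp only [hεdef, hA]
          rw [Real.exp_add]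
          have : Real.exp 24 * Real.exp (-24) = 1 := by rw [← Real.exp_add]; simp
          linear_combination -(Real.exp (12 * Real.exp 1) * (Real.exp (-b) * (1 / 2) ^ (j + 1))) * this
      _ ≤ _ := by
          have := hε j
          gcongr
  have hεsum : ∑ j ∈ range K, ε j ≤ A * Real.exp (-b) := by
    simp only [hεdef]
    rw [← mul_sum]
    have : ∑ j ∈ range K, (1 / 2 : ℝ) ^ (j + 1) ≤ 1 := by
      simp only [pow_succ]
      rw [← sum_mul, geom_sum_eq (by norm_num)]
      have : (0:ℝ) ≤ (1 / 2) ^ K := by positivity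
      rw [show ((1:ℝ) / 2 - 1) = -(1 / 2) by norm_num, div_neg, neg_mul,
        div_mul_cancel₀ _ (by norm_num)]
      linarith
    calc _ ≤ A * Real.exp (-b) * 1 := by gcongr
      _ = _ := mul_one _
  have hεprod : ∏ j ∈ range K, (1 + ε j) ≤ Real.exp A := by
    calc _ ≤ ∏ j ∈ range K, Real.exp (ε j) :=
          prod_le_prod (fun j _ => by linarith [hε j]) fun j _ => by
            rw [add_comm]; exact Real.add_one_le_exp _
      _ = Real.exp (∑ j ∈ range K, ε j) := (Real.exp_sum _ _).symm
      _ ≤ _ := by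
          rw [Real.exp_le_exp]
          refine hεsum.trans ?_
          have : Real.exp (-b) ≤ 1 := Real.exp_le_one_iff.2 (by simp)
          nlinarith
  have hr1 := rep_theta (b := bs) hd K
  have hr2 := rep_ups (b := bs) hd K
  obtain ⟨t1, t2⟩ := theta_eval hd hbe hx0 hx1 hε he K
  rw [hU] at hr1 hr2 t1 t2
  have hV : 0 ≤ ∏ p ∈ S, (1 - x p) := prod_nonneg fun p _ => by linarith [hx1 p]
  have hprod0 : 0 ≤ ∏ j ∈ range K, (1 + ε j) := prod_nonneg fun p _ => by linarith [hε p]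
  refine ⟨theta P bs K, ups P bs K, hr1.mono subset_rfl hN1, hr2.mono subset_rfl hN2, ?_, ?_, ?_⟩
  · intro y hy hy1
    have := theta_bounds hd hbe hy hy1 K
    rwa [hU] at this
  · refine t1.trans (mul_le_mul_of_nonneg_right ?_ hV)
    refine hεprod.trans ?_
    have := Real.exp_pos A
    nlinarith
  · refine t2.trans (mul_le_mul_of_nonneg_right ?_ hV)
    calc _ ≤ A * Real.exp (-b) * Real.exp A := by gcongr
      _ ≤ (1 + A) * Real.exp A * Real.exp (-b) := by
          have : 0 < Real.exp (-(b:ℝ)) * Real.exp A := by positivity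
          nlinarith

end PretentiousSieve

namespace PretentiousSieve

open Finset

/-- The primes up to `v` which do not divide `q`. -/
noncomputable def sievePrimes (q : ℕ) (v : ℝ) : Finset ℕ :=
  (Icc 1 ⌊v⌋₊).filter fun p => p.Prime ∧ ¬ p ∣ q

/-- `Rough v n` means that all prime factors of `n` exceed `v`. -/
def Rough (v : ℝ) (n : ℕ) : Prop := ∀ p : ℕ, p.Prime → p ∣ n → v < p

/-- The real number `1` if `p ∣ n` and `0` otherwise. -/
noncomputable def divInd (n p : ℕ) : ℝ := if p ∣ n then 1 else 0

theorem divInd_nonneg (n p : ℕ) : 0 ≤ divInd n p := by unfold divInd; split_ifs <;> norm_num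

theorem divInd_le_one (n p : ℕ) : divInd n p ≤ 1 := by unfold divInd; split_ifs <;> norm_num

theorem prod_divInd {s : Finset ℕ} (hs : ∀ p ∈ s, p.Prime) (n : ℕ) :
    ∏ p ∈ s, divInd n p = if (∏ p ∈ s, p) ∣ n then 1 else 0 := by
  classical
  split_ifs with h
  · refine prod_eq_one fun p hp => if_pos ((dvd_prod_of_mem _ hp).trans h)
  · by_contra h2
    refine h (prod_primes_dvd _ (fun p hp => (hs p hp).prime) fun p hp => ?_)
    by_contra h3
    exact h2 (prod_eq_zero hp (if_neg h3))

theorem prod_one_sub_divInd (S : Finset ℕ) (n : ℕ) [Decidable (∀ p ∈ S, ¬ p ∣ n)] :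
    ∏ p ∈ S, (1 - divInd n p) = if ∀ p ∈ S, ¬ p ∣ n then 1 else 0 := by
  split_ifs with h
  · exact prod_eq_one fun p hp => by simp [divInd, h p hp]
  · push Not at h
    obtain ⟨p, hp, hd⟩ := h
    exact prod_eq_zero hp (by simp [divInd, hd])

theorem Rep.norm_sum_sub_le {S : Finset ℕ} {N : ℝ} {φ : (ℕ → ℝ) → ℝ} (h : Rep S N φ)
    (hS : ∀ p ∈ S, p.Prime) {𝒜 : Finset ℕ} {a : ℕ → ℂ} {X : ℂ} {r : ℝ} (hr : 0 ≤ r)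
    (ha : ∀ s ⊆ S, ‖∑ n ∈ 𝒜 with (∏ p ∈ s, p) ∣ n, a n - X * ∏ p ∈ s, (1 / (p:ℝ) : ℝ)‖ ≤ r) :
    ‖∑ n ∈ 𝒜, a n * (φ (divInd n) : ℝ) - X * (φ (fun p => 1 / p) : ℝ)‖ ≤ N * r := by
  obtain ⟨ι, I, c, s, hs, hc, hφ⟩ := h
  have key : ∑ n ∈ 𝒜, a n * (φ (divInd n) : ℝ) - X * (φ (fun p => 1 / p) : ℝ) =
      ∑ i ∈ I, (c i : ℂ) * (∑ n ∈ 𝒜 with (∏ p ∈ s i, p) ∣ n, a n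
        - X * ∏ p ∈ s i, (1 / (p:ℝ) : ℝ)) := by
    simp only [hφ]
    simp_rw [mul_sub]
    rw [sum_sub_distrib]
    congr 1
    · push_cast
      simp_rw [mul_sum]
      rw [sum_comm]
      refine sum_congr rfl fun i hi => ?_
      rw [sum_filter]
      refine sum_congr rfl fun n _ => ?_
      have := prod_divInd (fun p hp => hS p (hs i hi hp)) n
      rw [← Complex.ofReal_prod, this]
      split_ifs <;> push_cast <;> ring
    · push_cast
      rw [mul_sum]
      exact sum_congr rfl fun i _ => by ring
  rw [key]
  calc _ ≤ ∑ i ∈ I, |c i| * r := by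
        refine norm_sum_le_of_le _ fun i hi => ?_
        rw [norm_mul, Complex.norm_real, Real.norm_eq_abs]
        exact mul_le_mul_of_nonneg_left (ha _ (hs i hi)) (abs_nonneg _)
    _ = (∑ i ∈ I, |c i|) * r := (sum_mul _ _ _).symm
    _ ≤ _ := mul_le_mul_of_nonneg_right hc hr

open Classical in
theorem sieve_sums : ∃ C : ℝ, 1 ≤ C ∧ ∀ z : ℝ, 2 ≤ z → ∀ b : ℕ, ∀ S : Finset ℕ,
    (∀ p ∈ S, p.Prime) → (∀ p ∈ S, (p:ℝ) ≤ z) → ∃ M : ℝ,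
    ∀ (𝒜 : Finset ℕ) (a : ℕ → ℂ) (a' : ℕ → ℝ) (X : ℂ) (X' r : ℝ), 0 ≤ r → 0 ≤ X' →
      (∀ n ∈ 𝒜, ‖a n‖ ≤ a' n) →
      (∀ s ⊆ S, ‖∑ n ∈ 𝒜 with (∏ p ∈ s, p) ∣ n, a n - X * ∏ p ∈ s, (1 / (p:ℝ) : ℝ)‖ ≤ r) →
      (∀ s ⊆ S, |∑ n ∈ 𝒜 with (∏ p ∈ s, p) ∣ n, a' n - X' * ∏ p ∈ s, (1 / (p:ℝ))| ≤ r) →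
      ‖∑ n ∈ 𝒜 with ∀ p ∈ S, ¬ p ∣ n, a n - X * M‖ ≤
        C * Real.exp (-b) * X' * ∏ p ∈ S, (1 - 1 / (p:ℝ)) + 2 * z ^ (4 * b + 8) * r ∧
      ∑ n ∈ 𝒜 with ∀ p ∈ S, ¬ p ∣ n, a' n ≤
        C * X' * ∏ p ∈ S, (1 - 1 / (p:ℝ)) + z ^ (4 * b + 8) * r := by
  obtain ⟨C, hC, H⟩ := brun_hooley
  refine ⟨C, hC, fun z hz b S hS hSz => ?_⟩
  obtain ⟨φ, ψ, hφ, hψ, hb, hφ1, hψ1⟩ := H z hz b S hS hSz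
  refine ⟨φ (fun p => 1 / p), fun 𝒜 a a' X X' r hr hX' haa' ha ha' => ?_⟩
  have ha'0 : ∀ n ∈ 𝒜, 0 ≤ a' n := fun n hn => (norm_nonneg _).trans (haa' n hn)
  have e1 := hφ.norm_sum_sub_le hS hr ha
  have ha'c : ∀ s ⊆ S, ‖∑ n ∈ 𝒜 with (∏ p ∈ s, p) ∣ n, (a' n : ℂ)
      - (X' : ℂ) * ∏ p ∈ s, (1 / (p:ℝ) : ℝ)‖ ≤ r := by
    intro s hs
    have := ha' s hs
    rw [← Real.norm_eq_abs, ← Complex.norm_real] at this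
    push_cast at this ⊢
    exact this
  have e2 := hφ.norm_sum_sub_le hS hr ha'c
  have e3 := hψ.norm_sum_sub_le hS hr ha'c
  simp only [← Complex.ofReal_mul, ← Complex.ofReal_sum, ← Complex.ofReal_sub,
    Complex.norm_real, Real.norm_eq_abs] at e2 e3
  have hbn := fun n => hb (divInd n) (divInd_nonneg n) (divInd_le_one n)
  simp only [prod_one_sub_divInd] at hbn
  constructor
  · rw [sum_filter]
    have e4 : ‖∑ n ∈ 𝒜, (if ∀ p ∈ S, ¬ p ∣ n then a n else 0) - ∑ n ∈ 𝒜, a n * (φ (divInd n) : ℝ)‖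
        ≤ ∑ n ∈ 𝒜, a' n * ψ (divInd n) := by
      rw [← sum_sub_distrib]
      refine norm_sum_le_of_le _ fun n hn => ?_
      have h1 := hbn n
      have : (if ∀ p ∈ S, ¬ p ∣ n then a n else 0) - a n * (φ (divInd n) : ℝ) =
          a n * (((if ∀ p ∈ S, ¬ p ∣ n then 1 else 0) - φ (divInd n) : ℝ) : ℂ) := by
        split_ifs <;> push_cast <;> ring
      rw [this, norm_mul, Complex.norm_real, Real.norm_eq_abs, abs_sub_comm, abs_of_nonneg
        (by linarith)]
      exact mul_le_mul (haa' n hn) h1.2 (by linarith) (ha'0 n hn)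
    have e5 := (abs_le.1 e3).2
    have e6 := mul_le_mul_of_nonneg_left hψ1 hX'
    have e7 := norm_sub_le_norm_sub_add_norm_sub
      (∑ n ∈ 𝒜, (if ∀ p ∈ S, ¬ p ∣ n then a n else 0)) (∑ n ∈ 𝒜, a n * (φ (divInd n) : ℝ))
      (X * (φ (fun p => 1 / p) : ℝ))
    linarith
  · rw [sum_filter]
    have e4 : ∑ n ∈ 𝒜, (if ∀ p ∈ S, ¬ p ∣ n then a' n else 0) ≤ ∑ n ∈ 𝒜, a' n * φ (divInd n) := by
      refine sum_le_sum fun n hn => ?_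
      have h1 := (hbn n).1
      have h2 := mul_le_mul_of_nonneg_left h1 (ha'0 n hn)
      refine le_trans (le_of_eq ?_) h2
      split_ifs <;> ring
    have e5 := (abs_le.1 e2).2
    have e6 := mul_le_mul_of_nonneg_left hφ1 hX'
    linarith

theorem mem_sievePrimes {q : ℕ} {v : ℝ} (hv : 0 ≤ v) {p : ℕ} :
    p ∈ sievePrimes q v ↔ p.Prime ∧ (p:ℝ) ≤ v ∧ ¬ p ∣ q := by
  rw [sievePrimes, mem_filter, mem_Icc, Nat.le_floor_iff hv]
  exact ⟨fun h => ⟨h.2.1, h.1.2, h.2.2⟩, fun h => ⟨⟨h.1.one_lt.le, h.2.1⟩, h.1, h.2.2⟩⟩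

theorem one_sub_inv_prime_pos {p : ℕ} (hp : p.Prime) : 0 < 1 - 1 / (p:ℝ) := by
  have : (1:ℝ) < p := by exact_mod_cast hp.one_lt
  rw [sub_pos, div_lt_one (by linarith)]; exact this

theorem log_le_prod_inv {v : ℝ} (hv : 1 ≤ v) :
    Real.log v ≤ ∏ p ∈ (Icc 1 ⌊v⌋₊) with p.Prime, (1 - 1 / (p:ℝ))⁻¹ := by
  let f : ℕ →* ℝ := 
    { toFun := fun n => 1 / (n:ℝ)
      map_one' := by simp
      map_mul' := fun a b => by rw [Nat.cast_mul, one_div_mul_one_div] }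
  have hf : ∀ {p : ℕ}, p.Prime → ‖f p‖ < 1 := by
    intro p hp
    have := one_sub_inv_prime_pos hp
    change ‖1 / (p:ℝ)‖ < 1
    rw [Real.norm_of_nonneg (by positivity)]; linarith
  obtain ⟨h1, h2⟩ :=
    EulerProduct.summable_and_hasSum_factoredNumbers_prod_filter_prime_geometric hf (Icc 1 ⌊v⌋₊)
  change HasSum _ (∏ p ∈ (Icc 1 ⌊v⌋₊) with p.Prime, (1 - 1 / (p:ℝ))⁻¹) at h2
  have h3 : ∀ n ∈ Icc 1 ⌊v⌋₊, n ∈ Nat.factoredNumbers (Icc 1 ⌊v⌋₊) := by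
    intro n hn
    rw [mem_Icc] at hn
    rw [Nat.mem_factoredNumbers']
    intro p hp hpn
    exact mem_Icc.2 ⟨hp.one_lt.le, (Nat.le_of_dvd (by lia) hpn).trans hn.2⟩
  have h4 : ∑ n ∈ Icc 1 ⌊v⌋₊, 1 / (n:ℝ) ≤
      ∏ p ∈ (Icc 1 ⌊v⌋₊) with p.Prime, (1 - 1 / (p:ℝ))⁻¹ := by
    have := sum_le_hasSum (f := fun m : Nat.factoredNumbers (Icc 1 ⌊v⌋₊) => f m)
      ((Icc 1 ⌊v⌋₊).attach.map ⟨fun n => ⟨n.1, h3 n.1 n.2⟩, fun a b h => by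
        exact Subtype.ext (Subtype.mk.inj h)⟩) (fun i _ => by change 0 ≤ 1 / ((i:ℕ):ℝ); positivity) h2
    refine le_trans (le_of_eq ?_) this
    rw [sum_map, ← sum_attach]
    rfl
  refine le_trans ?_ h4
  have h5 := log_add_one_le_harmonic ⌊v⌋₊
  rw [harmonic_eq_sum_Icc] at h5
  push_cast at h5
  simp only [one_div]
  refine le_trans (Real.log_le_log (by linarith) ?_) h5
  exact (Nat.lt_floor_add_one v).le

theorem prod_sievePrimes_le {q : ℕ} (hq : q ≠ 0) {v : ℝ} (hv : 1 < v) :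
    ∏ p ∈ sievePrimes q v, (1 - 1 / (p:ℝ)) ≤ (q / q.totient) / Real.log v := by
  have hφ : (q.totient : ℝ) = q * ∏ p ∈ q.primeFactors, (1 - 1 / (p:ℝ)) := by
    have := Nat.totient_eq_mul_prod_factors q
    simp only [one_div]
    have h := congrArg (fun t : ℚ => (t:ℝ)) this
    push_cast at h
    exact h
  have hφ0 : 0 < (q.totient : ℝ) := by exact_mod_cast Nat.totient_pos.2 (by lia)
  have hq0 : 0 < (q:ℝ) := by exact_mod_cast Nat.pos_of_ne_zero hq
  have hl := Real.log_pos hv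
  have h1 := log_le_prod_inv hv.le
  rw [prod_inv_distrib] at h1
  set W := ∏ p ∈ (Icc 1 ⌊v⌋₊) with p.Prime, (1 - 1 / (p:ℝ)) with hW
  have hW0 : 0 < W := prod_pos fun p hp => one_sub_inv_prime_pos (mem_filter.1 hp).2
  have h2 : (∏ p ∈ sievePrimes q v, (1 - 1 / (p:ℝ))) * ∏ p ∈ q.primeFactors, (1 - 1 / (p:ℝ)) ≤ W := by
    rw [← prod_union]
    · have hsub : ((Icc 1 ⌊v⌋₊).filter Nat.Prime) ⊆ sievePrimes q v ∪ q.primeFactors := by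
        intro p hp
        rw [mem_filter] at hp
        by_cases h : p ∣ q
        · exact mem_union_right _ (Nat.mem_primeFactors.2 ⟨hp.2, h, hq⟩)
        · exact mem_union_left _ (mem_filter.2 ⟨hp.1, hp.2, h⟩)
      rw [← prod_sdiff hsub]
      refine mul_le_of_le_one_left hW0.le (prod_le_one (fun p hp => ?_) fun p hp => ?_)
      · have : p.Prime := by
          rcases mem_union.1 (mem_sdiff.1 hp).1 with h | h
          · exact (mem_filter.1 h).2.1
          · exact Nat.prime_of_mem_primeFactors h
        exact (one_sub_inv_prime_pos this).le
      · have : (0:ℝ) ≤ 1 / p := by positivity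
        linarith
    · rw [disjoint_left]
      intro p hp hp'
      exact (mem_filter.1 hp).2.2 (Nat.dvd_of_mem_primeFactors hp')
  have h3 : W ≤ 1 / Real.log v := by
    rw [le_div_iff₀ hl]
    calc W * Real.log v ≤ W * W⁻¹ := by gcongr
      _ = 1 := mul_inv_cancel₀ hW0.ne'
  rw [div_div, le_div_iff₀ (by positivity)]
  have h4 : (∏ p ∈ sievePrimes q v, (1 - 1 / (p:ℝ))) * (q.totient / q) ≤ 1 / Real.log v := by
    rw [hφ, mul_div_cancel_left₀ _ hq0.ne']
    exact h2.trans h3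
  rw [le_div_iff₀ hl] at h4
  calc _ = (∏ p ∈ sievePrimes q v, (1 - 1 / (p:ℝ))) * (q.totient / q) * Real.log v * q := by
        field_simp
    _ ≤ 1 * q := by gcongr
    _ = q := one_mul _

end PretentiousSieve

namespace PretentiousSieve

open Finset

open Classical in
theorem abs_card_modEq_sub_le {m : ℕ} (hm : 0 < m) (c : ℕ) {w h : ℝ} (hw : 0 ≤ w) (hh : 0 ≤ h) :
    |(#{n ∈ Ioc ⌊w⌋₊ ⌊w + h⌋₊ | n ≡ c [MOD m]} : ℝ) - h / m| ≤ 2 := by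
  have h1 := Nat.Ioc_filter_modEq_card ⌊w⌋₊ ⌊w + h⌋₊ hm c
  have hm' : (1:ℝ) ≤ m := by exact_mod_cast hm
  have hm0 : (0:ℝ) < m := by linarith
  have hmq : (0:ℚ) < m := by exact_mod_cast hm
  have hmono : ⌊w⌋₊ ≤ ⌊w + h⌋₊ := Nat.floor_mono (by linarith)
  have h2 : (0:ℤ) ≤ ⌊((⌊w + h⌋₊ : ℚ) - c) / m⌋ - ⌊((⌊w⌋₊ : ℚ) - c) / m⌋ := by
    rw [sub_nonneg]
    refine Int.floor_mono ?_
    gcongr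
  rw [max_eq_left h2] at h1
  have h1' := congrArg (fun t : ℤ => (t:ℝ)) h1
  push_cast at h1'
  have a1 : ((⌊((⌊w + h⌋₊ : ℚ) - c) / m⌋ : ℤ) : ℝ) ≤ ((⌊w + h⌋₊ : ℝ) - c) / m := by
    have := Int.floor_le (((⌊w + h⌋₊ : ℚ) - c) / m)
    exact_mod_cast this
  have a2 : ((⌊w + h⌋₊ : ℝ) - c) / m < ((⌊((⌊w + h⌋₊ : ℚ) - c) / m⌋ : ℤ) : ℝ) + 1 := by
    have := Int.lt_floor_add_one (((⌊w + h⌋₊ : ℚ) - c) / m)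
    exact_mod_cast this
  have b1 : ((⌊((⌊w⌋₊ : ℚ) - c) / m⌋ : ℤ) : ℝ) ≤ ((⌊w⌋₊ : ℝ) - c) / m := by
    have := Int.floor_le (((⌊w⌋₊ : ℚ) - c) / m)
    exact_mod_cast this
  have b2 : ((⌊w⌋₊ : ℝ) - c) / m < ((⌊((⌊w⌋₊ : ℚ) - c) / m⌋ : ℤ) : ℝ) + 1 := by
    have := Int.lt_floor_add_one (((⌊w⌋₊ : ℚ) - c) / m)
    exact_mod_cast this
  have c1 := Nat.floor_le (show 0 ≤ w + h by linarith)
  have c2 := Nat.lt_floor_add_one (w + h)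
  have c3 := Nat.floor_le hw
  have c4 := Nat.lt_floor_add_one w
  have d : ((⌊w + h⌋₊ : ℝ) - c) / m - ((⌊w⌋₊ : ℝ) - c) / m = ((⌊w + h⌋₊ : ℝ) - ⌊w⌋₊) / m := by ring
  have d1 : ((⌊w + h⌋₊ : ℝ) - ⌊w⌋₊) / m ≤ h / m + 1 := by
    rw [div_add_one hm0.ne', div_le_div_iff_of_pos_right hm0]; linarith
  have d2 : h / m - 1 ≤ ((⌊w + h⌋₊ : ℝ) - ⌊w⌋₊) / m := by
    rw [div_sub_one hm0.ne', div_le_div_iff_of_pos_right hm0]; linarith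
  rw [abs_le]
  constructor <;> linarith

open Classical in
theorem abs_card_ap_dvd_sub_le {q d : ℕ} (hq : 0 < q) (hd : 0 < d) (hqd : q.Coprime d) (a : ZMod q)
    {w h : ℝ} (hw : 0 ≤ w) (hh : 0 ≤ h) :
    |(#((Ioc ⌊w⌋₊ ⌊w + h⌋₊).filter fun n : ℕ => (n : ZMod q) = a ∧ d ∣ n) : ℝ) - h / q * (1 / d)| ≤ 2 := by
  have : NeZero q := ⟨hq.ne'⟩
  obtain ⟨c, hc1, hc2⟩ := Nat.chineseRemainder hqd a.val 0
  have h1 := abs_card_modEq_sub_le (Nat.mul_pos hq hd) c hw hh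
  have h2 : ∀ n : ℕ, ((n : ZMod q) = a ∧ d ∣ n) ↔ n ≡ c [MOD (q * d)] := by
    intro n
    rw [← Nat.modEq_and_modEq_iff_modEq_mul hqd]
    have e1 : (n : ZMod q) = a ↔ n ≡ c [MOD q] := by
      rw [← ZMod.natCast_zmod_val a, ZMod.natCast_eq_natCast_iff]
      exact ⟨fun h => h.trans hc1.symm, fun h => h.trans hc1⟩
    have e2 : d ∣ n ↔ n ≡ c [MOD d] := by
      rw [← Nat.modEq_zero_iff_dvd]
      exact ⟨fun h => h.trans hc2.symm, fun h => h.trans hc2⟩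
    rw [e1, e2]
  simp only [h2]
  push_cast at h1
  rwa [div_mul_div_comm, mul_one]

theorem rough_iff_of_coprime {q n : ℕ} {v : ℝ} (hv : 0 ≤ v) (hn : n.Coprime q) :
    Rough v n ↔ ∀ p ∈ sievePrimes q v, ¬ p ∣ n := by
  constructor
  · intro h p hp hpn
    rw [mem_sievePrimes hv] at hp
    exact absurd (h p hp.1 hpn) (not_lt.2 hp.2.1)
  · intro h p hp hpn
    by_contra hlt
    refine h p ((mem_sievePrimes hv).2 ⟨hp, not_lt.1 hlt, fun hpq => ?_⟩) hpn
    exact hp.one_lt.ne' (Nat.eq_one_of_dvd_coprimes hn hpn hpq)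

theorem coprime_prod_sievePrimes {q : ℕ} {v : ℝ} {s : Finset ℕ} (hs : s ⊆ sievePrimes q v) :
    q.Coprime (∏ p ∈ s, p) := by
  refine Nat.Coprime.prod_right fun p hp => ?_
  obtain ⟨-, hp, hpq⟩ := mem_filter.1 (hs hp)
  exact ((Nat.Prime.coprime_iff_not_dvd hp).2 hpq).symm

theorem prod_pos_of_subset_sievePrimes {q : ℕ} {v : ℝ} {s : Finset ℕ} (hs : s ⊆ sievePrimes q v) :
    0 < ∏ p ∈ s, p := prod_pos fun _ hp => (mem_filter.1 (hs hp)).2.1.pos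

open Classical in
/-- The number of `v`-rough integers in an interval and a residue class. -/
noncomputable def roughCount {q : ℕ} (v w h : ℝ) (a : ZMod q) : ℕ :=
  #((Ioc ⌊w⌋₊ ⌊w + h⌋₊).filter fun n : ℕ => (n : ZMod q) = a ∧ Rough v n)

theorem roughCount_estimate : ∃ C : ℝ, 1 ≤ C ∧ ∀ z : ℝ, 2 ≤ z → ∀ b q : ℕ, 0 < q → ∃ M : ℝ,
    ∀ w h : ℝ, 0 ≤ w → 0 ≤ h → ∀ a : ZMod q, IsUnit a →
      |roughCount z w h a - M * h| ≤
        C * Real.exp (-b) * (h / (q.totient * Real.log z)) + 4 * z ^ (4 * b + 8) ∧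
      roughCount z w h a ≤ C * (h / (q.totient * Real.log z)) + 2 * z ^ (4 * b + 8) := by
  classical
  obtain ⟨C, hC, H⟩ := sieve_sums
  refine ⟨C, hC, fun z hz b q hq => ?_⟩
  have hz0 : 0 ≤ z := by linarith
  obtain ⟨M, hM⟩ := H z hz b (sievePrimes q z) (fun p hp => ((mem_sievePrimes hz0).1 hp).1)
    (fun p hp => ((mem_sievePrimes hz0).1 hp).2.1)
  refine ⟨M / q, fun w h hw hh a ha => ?_⟩
  have hq0 : (0:ℝ) < q := by exact_mod_cast hq
  have hX : (0:ℝ) ≤ h / q := by positivity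
  have hV := prod_sievePrimes_le hq.ne' (show 1 < z by linarith)
  set V := ∏ p ∈ sievePrimes q z, (1 - 1 / (p:ℝ))
  have hφ : 0 < (q.totient : ℝ) := by exact_mod_cast Nat.totient_pos.2 hq
  have hXV : h / q * V ≤ h / (q.totient * Real.log z) := by
    calc _ ≤ h / q * (q / q.totient / Real.log z) := by gcongr
      _ = _ := by field_simp
  have hcnt : ∀ s ⊆ sievePrimes q z,
      |(#(((Ioc ⌊w⌋₊ ⌊w + h⌋₊).filter fun n : ℕ => (n : ZMod q) = a).filter fun n => (∏ p ∈ s, p) ∣ n) : ℝ)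
        - h / q * ∏ p ∈ s, (1 / (p:ℝ))| ≤ 2 := by
    intro s hs
    have := abs_card_ap_dvd_sub_le hq (prod_pos_of_subset_sievePrimes hs)
      (coprime_prod_sievePrimes hs) a hw hh
    rw [filter_filter, prod_div_distrib, prod_const_one]
    push_cast at this
    exact this
  have hrc : (((Ioc ⌊w⌋₊ ⌊w + h⌋₊).filter fun n : ℕ => (n : ZMod q) = a).filter fun n => ∀ p ∈ sievePrimes q z, ¬ p ∣ n) =
      ((Ioc ⌊w⌋₊ ⌊w + h⌋₊).filter fun n : ℕ => (n : ZMod q) = a ∧ Rough z n) := by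
    rw [filter_filter]
    refine filter_congr fun n _ => and_congr_right fun hn => ?_
    refine (rough_iff_of_coprime hz0 ?_).symm
    rw [← ZMod.isUnit_iff_coprime, hn]
    exact ha
  obtain ⟨h1, h2⟩ := hM ((Ioc ⌊w⌋₊ ⌊w + h⌋₊).filter fun n : ℕ => (n : ZMod q) = a) (fun _ => 1) (fun _ => 1)
    ((h / q : ℝ) : ℂ) (h / q) 2 (by norm_num) hX (fun _ _ => by simp)
    (fun s hs => by
      have := hcnt s hs
      rw [← Real.norm_eq_abs, ← Complex.norm_real] at this
      simpa using this)
    (fun s hs => by simpa using hcnt s hs)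
  rw [hrc] at h1 h2
  simp only [sum_const, nsmul_eq_mul, mul_one] at h1 h2
  constructor
  · rw [roughCount, ← Real.norm_eq_abs, ← Complex.norm_real]
    push_cast at h1 ⊢
    rw [show (M / q * h : ℂ) = h / q * M by ring]
    refine h1.trans ?_
    have := mul_le_mul_of_nonneg_left hXV (show 0 ≤ C * Real.exp (-b) by positivity)
    linarith
  · refine h2.trans ?_
    have := mul_le_mul_of_nonneg_left hXV (show 0 ≤ C by positivity)
    linarith

theorem roughCount_le : ∃ C : ℝ, 1 ≤ C ∧ ∀ v : ℝ, 2 ≤ v → ∀ q : ℕ, 0 < q → ∀ w h : ℝ, 0 ≤ w →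
    q * v ^ 9 ≤ h → ∀ a : ZMod q, IsUnit a →
      roughCount v w h a ≤ C * (h / (q.totient * Real.log v)) := by
  obtain ⟨C, hC, H⟩ := roughCount_estimate
  refine ⟨C + 2, by linarith, fun v hv q hq w h hw hh a ha => ?_⟩
  obtain ⟨M, hM⟩ := H v hv 0 q hq
  have hh0 : 0 ≤ h := le_trans (by positivity) hh
  refine (hM w h hw hh0 a ha).2.trans ?_
  have hφ : 0 < (q.totient : ℝ) := by exact_mod_cast Nat.totient_pos.2 hq
  have hφq : (q.totient : ℝ) ≤ q := by exact_mod_cast Nat.totient_le q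
  have hl : 0 < Real.log v := Real.log_pos (by linarith)
  have hl2 : Real.log v ≤ v := (Real.log_le_sub_one_of_pos (by linarith)).trans (by linarith)
  have : v ^ 8 ≤ h / (q.totient * Real.log v) := by
    rw [le_div_iff₀ (by positivity)]
    calc v ^ 8 * (q.totient * Real.log v) ≤ v ^ 8 * (q * v) := by gcongr
      _ = q * v ^ 9 := by ring
      _ ≤ h := hh
  norm_num
  linarith

end PretentiousSieve

namespace PretentiousSieve

open Finset

theorem norm_natCast_cpow_sub_le {n : ℕ} (hn : 1 ≤ n) (t : ℝ) :
    ‖(n : ℂ) ^ (-(t * Complex.I)) - ((n + 1 : ℕ) : ℂ) ^ (-(t * Complex.I))‖ ≤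
      |t| * (Real.log (n + 1) - Real.log n) := by
  have h1 : ∀ m : ℕ, 1 ≤ m → (m : ℂ) ^ (-(t * Complex.I)) =
      Complex.exp (Complex.I * ((-t * Real.log m : ℝ) : ℂ)) := by
    intro m hm
    rw [Complex.cpow_def_of_ne_zero (by exact_mod_cast (by lia : m ≠ 0)), ← Complex.natCast_log]
    push_cast; ring_nf
  rw [h1 n hn, h1 (n + 1) (by lia)]
  have h2 : Complex.exp (Complex.I * ((-t * Real.log n : ℝ) : ℂ)) =
      Complex.exp (Complex.I * ((-t * Real.log (n + 1 : ℕ) : ℝ) : ℂ)) *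
      Complex.exp (Complex.I * ((t * (Real.log (n + 1 : ℕ) - Real.log n) : ℝ) : ℂ)) := by
    rw [← Complex.exp_add]; push_cast; ring_nf
  rw [h2, ← mul_sub_one, norm_mul, mul_comm Complex.I, Complex.norm_exp_ofReal_mul_I, one_mul]
  refine Real.norm_exp_I_mul_ofReal_sub_one_le.trans (le_of_eq ?_)
  rw [Real.norm_eq_abs, abs_mul, abs_of_nonneg (a := _ - _)]
  · push_cast; rfl
  · rw [sub_nonneg]
    exact Real.log_le_log (by exact_mod_cast hn) (by push_cast; linarith)

theorem norm_sum_char_le {q : ℕ} (hq : 0 < q) {χ : DirichletCharacter ℂ q} (hχ : χ ≠ 1) (k : ℕ) :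
    ‖∑ n ∈ Ioc 0 k, χ n‖ ≤ 2 * q := by
  classical
  have : NeZero q := ⟨hq.ne'⟩
  have h1 : ∑ n ∈ Ioc 0 k, χ n =
      ∑ a : ZMod q, χ a * ((#((Ioc 0 k).filter fun n : ℕ => (n : ZMod q) = a) : ℂ) - k / q) := by
    simp_rw [mul_sub]
    rw [sum_sub_distrib, ← sum_mul, MulChar.sum_eq_zero_of_ne_one hχ, zero_mul, sub_zero,
      ← sum_fiberwise (Ioc 0 k) (fun n : ℕ => (n : ZMod q))]
    refine sum_congr rfl fun a _ => ?_
    rw [sum_congr rfl fun n hn => by rw [(mem_filter.1 hn).2], sum_const, nsmul_eq_mul, mul_comm]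
  rw [h1]
  calc _ ≤ ∑ a : ZMod q, (2 : ℝ) := by
        refine norm_sum_le_of_le _ fun a _ => ?_
        rw [norm_mul]
        have h2 := abs_card_ap_dvd_sub_le hq one_pos (Nat.coprime_one_right q) a le_rfl
          (Nat.cast_nonneg (α := ℝ) k)
        simp only [one_dvd, and_true, Nat.cast_one, div_one, mul_one, zero_add, Nat.floor_zero,
          Nat.floor_natCast] at h2
        rw [← Real.norm_eq_abs, ← Complex.norm_real] at h2
        push_cast at h2
        calc _ ≤ 1 * (2:ℝ) := mul_le_mul (χ.norm_le_one a) h2 (norm_nonneg _) zero_le_one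
          _ = 2 := one_mul _
    _ = 2 * q := by simp [ZMod.card, mul_comm]

theorem norm_sum_char_cpow_le {q : ℕ} (hq : 0 < q) {χ : DirichletCharacter ℂ q} (hχ : χ ≠ 1)
    (t : ℝ) (M : ℕ) :
    ‖∑ n ∈ Ioc 0 M, χ n * (n : ℂ) ^ (-(t * Complex.I))‖ ≤ 2 * q * (1 + |t| * Real.log M) := by
  rcases Nat.eq_zero_or_pos M with rfl | hM
  · simp
  have hB := norm_sum_char_le hq hχ
  have hg : ∀ m : ℕ, 1 ≤ m → ‖(m : ℂ) ^ (-(t * Complex.I))‖ = 1 := by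
    intro m hm
    rw [Complex.norm_natCast_cpow_of_pos hm]; simp
  have key : ‖∑ n ∈ Ioc 0 M, χ n * (n : ℂ) ^ (-(t * Complex.I)) -
      (∑ n ∈ Ioc 0 M, χ n) * (M : ℂ) ^ (-(t * Complex.I))‖ ≤ 2 * q * (|t| * Real.log M) := by
    induction M, hM using Nat.le_induction with
    | base => simp
    | succ M hM ih =>
      rw [sum_Ioc_succ_top (Nat.zero_le _), sum_Ioc_succ_top (Nat.zero_le _)]
      have h1 := norm_natCast_cpow_sub_le hM t
      have h2 : ∑ n ∈ Ioc 0 M, χ n * (n : ℂ) ^ (-(t * Complex.I)) +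
          χ (M + 1 : ℕ) * ((M + 1 : ℕ) : ℂ) ^ (-(t * Complex.I)) -
          (∑ n ∈ Ioc 0 M, χ n + χ (M + 1 : ℕ)) * ((M + 1 : ℕ) : ℂ) ^ (-(t * Complex.I)) =
          (∑ n ∈ Ioc 0 M, χ n * (n : ℂ) ^ (-(t * Complex.I)) -
            (∑ n ∈ Ioc 0 M, χ n) * (M : ℂ) ^ (-(t * Complex.I))) +
          (∑ n ∈ Ioc 0 M, χ n) * ((M : ℂ) ^ (-(t * Complex.I)) -
            ((M + 1 : ℕ) : ℂ) ^ (-(t * Complex.I))) := by ring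
      have h3 : ‖(∑ n ∈ Ioc 0 M, χ n) * ((M : ℂ) ^ (-(t * Complex.I)) -
            ((M + 1 : ℕ) : ℂ) ^ (-(t * Complex.I)))‖ ≤
            2 * q * (|t| * (Real.log (M + 1) - Real.log M)) := by
        rw [norm_mul]
        exact mul_le_mul (hB M) h1 (norm_nonneg _) (by positivity)
      rw [h2]
      refine (norm_add_le _ _).trans ((add_le_add ih h3).trans (le_of_eq ?_))
      push_cast
      ring
  have h4 : ‖(∑ n ∈ Ioc 0 M, χ n) * (M : ℂ) ^ (-(t * Complex.I))‖ ≤ 2 * q := by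
    rw [norm_mul, hg M hM, mul_one]; exact hB M
  have := norm_le_norm_sub_add (∑ n ∈ Ioc 0 M, χ n * (n : ℂ) ^ (-(t * Complex.I)))
    ((∑ n ∈ Ioc 0 M, χ n) * (M : ℂ) ^ (-(t * Complex.I)))
  linarith

theorem sum_filter_dvd_eq {d : ℕ} (hd : 0 < d) (N : ℕ) (F : ℕ → ℂ) :
    ∑ n ∈ (Ioc 0 N).filter (fun n => d ∣ n), F n = ∑ m ∈ Ioc 0 (N / d), F (d * m) := by
  refine (sum_nbij (fun m => d * m) ?_ ?_ ?_ ?_).symm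
  · intro m hm
    rw [mem_Ioc] at hm
    rw [mem_filter, mem_Ioc]
    refine ⟨⟨Nat.mul_pos hd hm.1, ?_⟩, dvd_mul_right _ _⟩
    exact (Nat.mul_le_mul_left d hm.2).trans (Nat.mul_div_le N d)
  · intro a _ b _ h
    exact Nat.eq_of_mul_eq_mul_left hd h
  · intro n hn
    rw [coe_filter, Set.mem_ofPred_eq, mem_Ioc] at hn
    obtain ⟨⟨h1, h2⟩, m, rfl⟩ := hn
    refine ⟨m, ?_, rfl⟩
    rw [coe_Ioc, Set.mem_Ioc]
    exact ⟨Nat.pos_of_mul_pos_left h1, (Nat.le_div_iff_mul_le hd).2 (by rwa [mul_comm])⟩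
  · intro _ _; rfl

open Classical in
theorem abs_card_coprime_dvd_sub_le {q d : ℕ} (hq : 0 < q) (hd : 0 < d) (hqd : q.Coprime d)
    {y : ℝ} (hy : 0 ≤ y) :
    |(#((Ioc 0 ⌊y⌋₊).filter fun n : ℕ => n.Coprime q ∧ d ∣ n) : ℝ)
      - y * (q.totient / q) * (1 / d)| ≤ 2 * q.totient := by
  have : NeZero q := ⟨hq.ne'⟩
  have hU : (#(univ.filter fun a : ZMod q => IsUnit a)) = q.totient := by
    rw [← ZMod.card_units_eq_totient, Fintype.card, ← card_map ⟨((↑) : (ZMod q)ˣ → ZMod q),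
      Units.val_injective⟩]
    congr 1
    ext a
    rw [mem_filter, mem_map]
    exact ⟨fun ⟨_, u, hu⟩ => ⟨u, mem_univ _, hu⟩, fun ⟨u, _, hu⟩ => ⟨mem_univ _, u, hu⟩⟩
  have h1 : (#((Ioc 0 ⌊y⌋₊).filter fun n : ℕ => n.Coprime q ∧ d ∣ n)) =
      ∑ a ∈ univ.filter fun a : ZMod q => IsUnit a,
        #((Ioc 0 ⌊y⌋₊).filter fun n : ℕ => (n : ZMod q) = a ∧ d ∣ n) := by
    rw [card_eq_sum_card_fiberwise (f := fun n : ℕ => (n : ZMod q))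
      (t := univ.filter fun a : ZMod q => IsUnit a)]
    · refine sum_congr rfl fun a ha => ?_
      rw [filter_filter]
      congr 1
      refine filter_congr fun n _ => ?_
      have ha' := (mem_filter.1 ha).2
      have hu : (n : ZMod q) = a → n.Coprime q := fun h => by
        rw [← ZMod.isUnit_iff_coprime, h]; exact ha'
      constructor
      · exact fun h => ⟨h.2, h.1.2⟩
      · exact fun h => ⟨⟨hu h.1, h.2⟩, h.1⟩
    · intro n hn
      simpa [ZMod.isUnit_iff_coprime] using (mem_filter.1 hn).2.1
  have hq0 : (0:ℝ) < q := by exact_mod_cast hq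
  have h2 : y * (q.totient / q) * (1 / d) =
      ∑ a ∈ univ.filter fun a : ZMod q => IsUnit a, y / q * (1 / (d:ℝ)) := by
    rw [sum_const, hU, nsmul_eq_mul]; ring
  rw [h1, h2]
  push_cast
  rw [← sum_sub_distrib]
  calc _ ≤ ∑ a ∈ univ.filter fun a : ZMod q => IsUnit a, (2:ℝ) := by
        refine (abs_sum_le_sum_abs _ _).trans (sum_le_sum fun a _ => ?_)
        have := abs_card_ap_dvd_sub_le hq hd hqd a le_rfl hy
        rwa [zero_add, Nat.floor_zero] at this
    _ = _ := by rw [sum_const, hU, nsmul_eq_mul, mul_comm]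

set_option maxHeartbeats 1000000 in
open Classical in
theorem norm_rough_char_sum_le : ∃ C : ℝ, 1 ≤ C ∧ ∀ z : ℝ, 2 ≤ z → ∀ b q : ℕ, 0 < q →
    ∀ χ : DirichletCharacter ℂ q, χ ≠ 1 → ∀ t y : ℝ, 1 ≤ y →
    ‖∑ n ∈ (Ioc 0 ⌊y⌋₊).filter (fun n => Rough z n), χ n * (n : ℂ) ^ (-(t * Complex.I))‖ ≤
      C * Real.exp (-b) * (y / Real.log z) +
        4 * z ^ (4 * b + 8) * (q * (1 + |t| * Real.log y)) := by
  obtain ⟨C, hC, H⟩ := sieve_sums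
  refine ⟨C, hC, fun z hz b q hq χ hχ t y hy => ?_⟩
  have : NeZero q := ⟨hq.ne'⟩
  have hz0 : 0 ≤ z := by linarith
  obtain ⟨M, hM⟩ := H z hz b (sievePrimes q z) (fun p hp => ((mem_sievePrimes hz0).1 hp).1)
    (fun p hp => ((mem_sievePrimes hz0).1 hp).2.1)
  have hq0 : (0:ℝ) < q := by exact_mod_cast hq
  have hV := prod_sievePrimes_le hq.ne' (show 1 < z by linarith)
  set V := ∏ p ∈ sievePrimes q z, (1 - 1 / (p:ℝ))
  have hφ : 0 < (q.totient : ℝ) := by exact_mod_cast Nat.totient_pos.2 hq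
  have hφq : (q.totient : ℝ) ≤ q := by exact_mod_cast Nat.totient_le q
  have hly : 0 ≤ Real.log y := Real.log_nonneg hy
  have hXV : y * (q.totient / q) * V ≤ y / Real.log z := by
    calc _ ≤ y * (q.totient / q) * (q / q.totient / Real.log z) := by gcongr
      _ = _ := by field_simp
  set 𝒜 := (Ioc 0 ⌊y⌋₊).filter (fun n : ℕ => n.Coprime q) with h𝒜
  have hzero : ∀ n : ℕ, ¬ n.Coprime q → χ n * (n : ℂ) ^ (-(t * Complex.I)) = 0 :=
    fun n hn => by
      rw [← ZMod.isUnit_iff_coprime] at hn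
      rw [χ.map_nonunit hn, zero_mul]
  have hpow : ∀ m : ℕ, ‖(m : ℂ) ^ (-(t * Complex.I))‖ ≤ 1 := by
    intro m
    rcases Nat.eq_zero_or_pos m with rfl | hm
    · by_cases ht : t = 0
      · simp [ht]
      · rw [Nat.cast_zero, Complex.zero_cpow (by simpa using ht)]; simp
    · rw [Complex.norm_natCast_cpow_of_pos hm]; simp
  set r : ℝ := 2 * (q * (1 + |t| * Real.log y)) with hr
  have hr0 : 2 * (q:ℝ) ≤ r := by
    have : 0 ≤ (q:ℝ) * (|t| * Real.log y) := by positivity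
    rw [hr]; linarith
  obtain ⟨h1, -⟩ := hM 𝒜 (fun n => χ n * (n : ℂ) ^ (-(t * Complex.I))) (fun _ => 1) 0
    (y * (q.totient / q)) r (by linarith) (by positivity)
    (fun n _ => by
      rw [norm_mul]
      exact mul_le_one₀ (χ.norm_le_one _) (norm_nonneg _) (hpow n))
    (fun s hs => by
      have hd := prod_pos_of_subset_sievePrimes hs
      set d := ∏ p ∈ s, p
      rw [zero_mul, sub_zero, h𝒜, filter_filter]
      have e1 : ∑ n ∈ (Ioc 0 ⌊y⌋₊).filter (fun n : ℕ => n.Coprime q ∧ d ∣ n),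
          χ n * (n : ℂ) ^ (-(t * Complex.I)) = ∑ n ∈ (Ioc 0 ⌊y⌋₊).filter (fun n : ℕ => d ∣ n),
          χ n * (n : ℂ) ^ (-(t * Complex.I)) := by
        refine sum_subset (fun n hn => ?_) fun n hn hn' => hzero n fun hu => hn' ?_
        · rw [mem_filter] at hn ⊢; exact ⟨hn.1, hn.2.2⟩
        · rw [mem_filter] at hn ⊢; exact ⟨hn.1, hu, hn.2⟩
      rw [e1, sum_filter_dvd_eq hd]
      have e2 : ∀ m : ℕ, χ (d * m : ℕ) * ((d * m : ℕ) : ℂ) ^ (-(t * Complex.I)) =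
          χ d * (d : ℂ) ^ (-(t * Complex.I)) * (χ m * (m : ℂ) ^ (-(t * Complex.I))) := by
        intro m
        rw [Nat.cast_mul, Nat.cast_mul, map_mul, Complex.natCast_mul_natCast_cpow]; ring
      simp_rw [e2]
      rw [← mul_sum, norm_mul, norm_mul]
      have e3 := norm_sum_char_cpow_le hq hχ t (⌊y⌋₊ / d)
      have e4 : Real.log ((⌊y⌋₊ / d : ℕ) : ℝ) ≤ Real.log y := by
        rcases Nat.eq_zero_or_pos (⌊y⌋₊ / d) with h0 | h0
        · rw [h0]; simpa using hly
        · refine Real.log_le_log (by exact_mod_cast h0) ?_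
          have : ((⌊y⌋₊ / d : ℕ) : ℝ) ≤ ⌊y⌋₊ := by exact_mod_cast Nat.div_le_self _ _
          exact this.trans (Nat.floor_le (by linarith))
      calc _ ≤ 1 * 1 * (2 * q * (1 + |t| * Real.log ((⌊y⌋₊ / d : ℕ) : ℝ))) := by
            gcongr
            · exact χ.norm_le_one _
            · exact hpow d
        _ ≤ r := by
            rw [hr, one_mul, one_mul, mul_assoc]
            gcongr)
    (fun s hs => by
      have hd := prod_pos_of_subset_sievePrimes hs
      have hc := coprime_prod_sievePrimes hs
      have e1 := abs_card_coprime_dvd_sub_le hq hd hc (show 0 ≤ y by linarith)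
      rw [h𝒜, filter_filter, sum_const, nsmul_eq_mul, mul_one, prod_div_distrib, prod_const_one]
      push_cast at e1 ⊢
      refine e1.trans (le_trans ?_ hr0)
      linarith)
  rw [zero_mul, sub_zero, h𝒜, filter_filter] at h1
  have e0 : ∑ n ∈ (Ioc 0 ⌊y⌋₊).filter (fun n => Rough z n), χ n * (n : ℂ) ^ (-(t * Complex.I)) =
      ∑ n ∈ (Ioc 0 ⌊y⌋₊).filter (fun n : ℕ => n.Coprime q ∧ ∀ p ∈ sievePrimes q z, ¬ p ∣ n),
        χ n * (n : ℂ) ^ (-(t * Complex.I)) := by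
    symm
    refine sum_subset (fun n hn => ?_) fun n hn hn' => hzero n fun hu => hn' ?_
    · rw [mem_filter] at hn ⊢
      exact ⟨hn.1, (rough_iff_of_coprime hz0 hn.2.1).2 hn.2.2⟩
    · rw [mem_filter] at hn ⊢
      exact ⟨hn.1, hu, (rough_iff_of_coprime hz0 hu).1 hn.2⟩
  rw [e0]
  refine h1.trans ?_
  have := mul_le_mul_of_nonneg_left hXV (show 0 ≤ C * Real.exp (-b) by positivity)
  rw [hr]
  linarith

end PretentiousSieve

namespace PretentiousSieve

open Finset

/-- The exponent saved by the fundamental lemma. -/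
noncomputable def saving (z : ℝ) : ℝ := 1 / (16 * Real.log z)

theorem large_range_aux {z y : ℝ} (hz : Real.exp 1 ≤ z) (hy : z ^ 40 ≤ y) :
    Real.exp (-(⌊saving z * Real.log y⌋₊ : ℝ)) * y ≤ Real.exp 1 * y ^ (1 - saving z) ∧
    z ^ (4 * ⌊saving z * Real.log y⌋₊ + 8) * (z ^ 2 * Real.log y) ≤ 8 * y ^ (1 - saving z) := by
  have hz0 : 0 < z := (Real.exp_pos 1).trans_le hz
  have hy0 : 0 < y := (pow_pos hz0 40).trans_le hy
  set l := Real.log z with hl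
  set Y := Real.log y with hY
  have hzl : z = Real.exp l := (Real.exp_log hz0).symm
  have hyY : y = Real.exp Y := (Real.exp_log hy0).symm
  have hl1 : 1 ≤ l := by rw [hl, Real.le_log_iff_exp_le hz0]; exact hz
  have hYl : 40 * l ≤ Y := by
    have := Real.log_le_log (by positivity) hy
    rw [Real.log_pow] at this
    exact_mod_cast this
  have hs : saving z = 1 / (16 * l) := rfl
  have hs0 : 0 ≤ saving z := by rw [hs]; positivity
  set b := ⌊saving z * Y⌋₊ with hb
  have hb1 : (b:ℝ) ≤ saving z * Y := Nat.floor_le (by have : 0 ≤ Y := by linarith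
                                                      positivity)
  have hb2 : saving z * Y < b + 1 := Nat.lt_floor_add_one _
  have hpow : y ^ (1 - saving z) = Real.exp (Y * (1 - saving z)) := by
    rw [hyY, ← Real.exp_mul]
  have hsl : saving z * l = 1 / 16 := by rw [hs]; field_simp
  have hs1 : saving z ≤ 1 / 16 := by nlinarith
  rw [hpow]
  constructor
  · rw [hyY, ← Real.exp_add, ← Real.exp_add, Real.exp_le_exp]
    linarith
  · have e1 : Y ≤ 8 * Real.exp (Y / 8) := by
      have := Real.add_one_le_exp (Y / 8); linarith
    have e2 : z ^ (4 * b + 8) * z ^ 2 = Real.exp (l * (4 * b + 10)) := by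
      rw [hzl, ← pow_add, ← Real.exp_nat_mul]; push_cast; ring_nf
    rw [← mul_assoc, e2]
    calc _ ≤ Real.exp (l * (4 * b + 10)) * (8 * Real.exp (Y / 8)) := by gcongr
      _ = 8 * Real.exp (l * (4 * b + 10) + Y / 8) := by rw [Real.exp_add]; ring
      _ ≤ _ := by
          gcongr
          have : l * b ≤ Y / 16 := by nlinarith
          nlinarith

theorem Rough.lt {z : ℝ} {n : ℕ} (h : Rough z n) (hn : 1 < n) : z < n :=
  (h n.minFac (Nat.minFac_prime hn.ne') n.minFac_dvd).trans_le
    (by exact_mod_cast Nat.minFac_le (by lia))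

theorem roughCount_eq_zero {q : ℕ} {z y : ℝ} (hy : 1 ≤ y) (h : y ≤ z) (a : ZMod q) :
    roughCount z 1 (y - 1) a = 0 := by
  classical
  rw [roughCount, card_eq_zero, filter_eq_empty_iff]
  rintro n hn ⟨-, hr⟩
  rw [Nat.floor_one, mem_Ioc, add_sub_cancel] at hn
  have h1 : (n:ℝ) ≤ y := (Nat.le_floor_iff (by linarith)).1 hn.2
  have := hr.lt hn.1
  linarith

/-- The sieving parameters: `q ≤ Q`, `z = Q ^ 100`. -/
structure Regime (q : ℕ) (Q z : ℝ) : Prop where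
  pos : 0 < q
  le : (q:ℝ) ≤ Q
  two_le : 2 ≤ Q
  z_eq : z = Q ^ 100

namespace Regime

variable {q : ℕ} {Q z : ℝ}

theorem log_pos (h : Regime q Q z) : 0 < Real.log Q := Real.log_pos (by linarith [h.two_le])

theorem log_z (h : Regime q Q z) : Real.log z = 100 * Real.log Q := by
  rw [h.z_eq, Real.log_pow]; norm_num

theorem exp_le (h : Regime q Q z) : Real.exp 1 ≤ z := by
  have h1 : Real.exp 1 ≤ 2 ^ 100 := Real.exp_one_lt_d9.le.trans (by norm_num)
  rw [h.z_eq]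
  exact h1.trans (pow_le_pow_left₀ (by norm_num) h.two_le 100)

theorem two_le_z (h : Regime q Q z) : 2 ≤ z := by
  have := h.exp_le
  have h2 := Real.add_one_le_exp (1:ℝ)
  linarith

theorem Q_le_z (h : Regime q Q z) : Q ≤ z := by
  rw [h.z_eq]; exact le_self_pow₀ (by linarith [h.two_le]) (by norm_num)

theorem one_le_log_z (h : Regime q Q z) : 1 ≤ Real.log z := by
  rw [Real.le_log_iff_exp_le (by linarith [h.two_le_z])]; exact h.exp_le

theorem one (h : Regime q Q z) : Regime 1 Q z :=
  ⟨one_pos, by push_cast; linarith [h.two_le], h.two_le, h.z_eq⟩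

theorem saving_pos (h : Regime q Q z) : 0 < saving z := by
  have := h.one_le_log_z
  unfold saving; positivity

theorem saving_le (h : Regime q Q z) : saving z ≤ 1 / 16 := by
  have := h.one_le_log_z
  unfold saving
  gcongr
  linarith

end Regime

theorem roughCount_mono {q : ℕ} {v z w h : ℝ} (hvz : v ≤ z) (a : ZMod q) :
    roughCount z w h a ≤ roughCount v w h a := by
  classical
  refine card_le_card fun n hn => ?_
  rw [mem_filter] at hn ⊢
  exact ⟨hn.1, hn.2.1, fun p hp hpn => hvz.trans_lt (hn.2.2 p hp hpn)⟩

theorem roughCount_le_of_le : ∃ C : ℝ, 0 ≤ C ∧ ∀ (q : ℕ) (Q z : ℝ), Regime q Q z →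
    ∀ y : ℝ, 1 ≤ y → y ≤ z ^ 40 → ∀ a : ZMod q, IsUnit a →
      roughCount z 1 (y - 1) a ≤ C * (y ^ (1 - saving z) / (q.totient * Real.log z)) := by
  obtain ⟨C, hC, H⟩ := roughCount_le
  refine ⟨20 * C * Real.exp (5 / 2), by positivity, fun q Q z hR y hy hyz a ha => ?_⟩
  have hl := hR.one_le_log_z
  have hφ : 0 < (q.totient : ℝ) := by exact_mod_cast Nat.totient_pos.2 hR.pos
  rcases le_or_gt y z with h | h
  · rw [roughCount_eq_zero hy h]
    simp only [Nat.cast_zero]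
    positivity
  have hQ2 := hR.two_le
  have hQ1 : 1 ≤ Q := by linarith
  have h1 : (q:ℝ) * (Q ^ 5) ^ 9 ≤ y - 1 := by
    have e1 : (q:ℝ) * (Q ^ 5) ^ 9 ≤ Q ^ 46 := by
      calc _ ≤ Q * (Q ^ 5) ^ 9 := by gcongr; exact hR.le
        _ = Q ^ 46 := by ring
    have e2 : Q ^ 46 * 2 ≤ z := by
      rw [hR.z_eq]
      calc Q ^ 46 * 2 ≤ Q ^ 46 * Q := by gcongr
        _ = Q ^ 47 := by ring
        _ ≤ Q ^ 100 := pow_le_pow_right₀ hQ1 (by norm_num)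
    have e3 : 1 ≤ Q ^ 46 := one_le_pow₀ hQ1
    linarith
  have h2 := H (Q ^ 5) (hQ2.trans (le_self_pow₀ hQ1 (by norm_num))) q hR.pos 1 (y - 1) zero_le_one h1 a ha
  have h3 : (roughCount z 1 (y - 1) a : ℝ) ≤ roughCount (Q ^ 5) 1 (y - 1) a := by
    exact_mod_cast roughCount_mono (by rw [hR.z_eq]; exact pow_le_pow_right₀ hQ1 (by norm_num)) a
  refine h3.trans (h2.trans ?_)
  have h4 : Real.log (Q ^ 5) = Real.log z / 20 := by
    rw [hR.log_z, Real.log_pow]; push_cast; ring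
  rw [h4]
  have hy0 : 0 < y := by linarith
  have hyl : Real.log y ≤ 40 * Real.log z := by
    have := Real.log_le_log hy0 hyz
    rw [Real.log_pow] at this
    exact_mod_cast this
  have h5 : y ≤ Real.exp (5 / 2) * y ^ (1 - saving z) := by
    have e : saving z * Real.log y ≤ 5 / 2 := by
      calc saving z * Real.log y ≤ saving z * (40 * Real.log z) := by
            have := hR.saving_pos
            gcongr
        _ = 5 / 2 := by unfold saving; field_simp; norm_num
    calc y = Real.exp (Real.log y) := (Real.exp_log hy0).symm
      _ ≤ Real.exp (5 / 2 + Real.log y * (1 - saving z)) := by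
          rw [Real.exp_le_exp]; linarith
      _ = _ := by rw [Real.exp_add, Real.rpow_def_of_pos hy0]
  calc C * ((y - 1) / (q.totient * (Real.log z / 20)))
      ≤ C * ((Real.exp (5 / 2) * y ^ (1 - saving z)) / (q.totient * (Real.log z / 20))) := by
        gcongr; linarith
    _ = _ := by field_simp

theorem roughCount_equidistribution : ∃ C : ℝ, 0 ≤ C ∧ ∀ (q : ℕ) (Q z : ℝ), Regime q Q z →
    ∀ y : ℝ, 1 ≤ y → ∃ M : ℝ, ∀ a : ZMod q, IsUnit a →
      |roughCount z 1 (y - 1) a - M| ≤ C * (y ^ (1 - saving z) / (q.totient * Real.log z)) := by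
  obtain ⟨C₁, hC₁, H₁⟩ := roughCount_le_of_le
  obtain ⟨C₂, hC₂, H₂⟩ := roughCount_estimate
  refine ⟨C₁ + (C₂ * Real.exp 1 + 32), by positivity, fun q Q z hR y hy => ?_⟩
  have hl := hR.one_le_log_z
  have hφ : 0 < (q.totient : ℝ) := by exact_mod_cast Nat.totient_pos.2 hR.pos
  have hX : 0 ≤ y ^ (1 - saving z) / (q.totient * Real.log z) := by positivity
  rcases le_or_gt y (z ^ 40) with h | h
  · refine ⟨0, fun a ha => ?_⟩
    rw [sub_zero, abs_of_nonneg (by positivity)]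
    refine (H₁ q Q z hR y hy h a ha).trans ?_
    gcongr
    have := Real.exp_pos 1
    have : 0 ≤ C₂ * Real.exp 1 := by positivity
    linarith
  · obtain ⟨e1, e2⟩ := large_range_aux hR.exp_le h.le
    set b := ⌊saving z * Real.log y⌋₊
    obtain ⟨M, hM⟩ := H₂ z hR.two_le_z b q hR.pos
    refine ⟨M * (y - 1), fun a ha => ?_⟩
    refine (hM 1 (y - 1) zero_le_one (by linarith) a ha).1.trans ?_
    have hly : 1 ≤ Real.log y := by
      rw [Real.le_log_iff_exp_le (by linarith)]
      exact hR.exp_le.trans ((le_self_pow₀ (by linarith [hR.two_le_z]) (by norm_num)).trans h.le)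
    have f1 : C₂ * Real.exp (-b) * ((y - 1) / (q.totient * Real.log z)) ≤
        C₂ * Real.exp 1 * (y ^ (1 - saving z) / (q.totient * Real.log z)) := by
      calc _ ≤ C₂ * Real.exp (-b) * (y / (q.totient * Real.log z)) := by gcongr; linarith
        _ = C₂ * ((Real.exp (-b) * y) / (q.totient * Real.log z)) := by ring
        _ ≤ C₂ * ((Real.exp 1 * y ^ (1 - saving z)) / (q.totient * Real.log z)) := by gcongr
        _ = _ := by ring
    have f2 : z ^ (4 * b + 8) ≤ 8 * (y ^ (1 - saving z) / (q.totient * Real.log z)) := by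
      rw [← mul_div_assoc, le_div_iff₀ (by positivity)]
      refine le_trans ?_ e2
      have g1 : (q.totient : ℝ) ≤ z :=
        (show (q.totient : ℝ) ≤ q by exact_mod_cast Nat.totient_le q).trans (hR.le.trans hR.Q_le_z)
      have g2 : Real.log z ≤ z := (Real.log_le_sub_one_of_pos (by linarith [hR.two_le_z])).trans
        (by linarith)
      have hz0 : 0 ≤ z := by linarith [hR.two_le_z]
      calc z ^ (4 * b + 8) * (q.totient * Real.log z) ≤ z ^ (4 * b + 8) * (z * z) := by gcongr
        _ = z ^ (4 * b + 8) * (z ^ 2 * 1) := by ring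
        _ ≤ _ := by gcongr
    have : 0 ≤ C₁ * (y ^ (1 - saving z) / (q.totient * Real.log z)) := by positivity
    linarith

end PretentiousSieve

namespace PretentiousSieve

open Finset

theorem sum_norm_sq_units (q : ℕ) [NeZero q] (h : (ZMod q)ˣ → ℂ) :
    ∑ χ : DirichletCharacter ℂ q, ‖∑ a : (ZMod q)ˣ, h a * χ a‖ ^ 2 =
      q.totient * ∑ a : (ZMod q)ˣ, ‖h a‖ ^ 2 := by
  have key : ∀ a b : (ZMod q)ˣ, ∑ χ : DirichletCharacter ℂ q, χ a * (starRingEnd ℂ) (χ b) =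
      if b = a then (q.totient : ℂ) else 0 := by
    intro a b
    have := DirichletCharacter.sum_char_inv_mul_char_eq ℂ (n := q) b.isUnit (a : ZMod q)
    simp only [Units.val_inj] at this
    rw [← this]
    refine sum_congr rfl fun χ _ => ?_
    rw [mul_comm]
    congr 1
    rw [← RCLike.star_def, MulChar.star_apply', MulChar.inv_apply_eq_inv', ZMod.inv_coe_unit,
      ← map_units_inv]
  have e : ((∑ χ : DirichletCharacter ℂ q, ‖∑ a : (ZMod q)ˣ, h a * χ a‖ ^ 2 : ℝ) : ℂ) =
      ((q.totient * ∑ a : (ZMod q)ˣ, ‖h a‖ ^ 2 : ℝ) : ℂ) := by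
    push_cast
    simp_rw [← Complex.mul_conj', map_sum, map_mul, sum_mul_sum]
    rw [sum_comm]
    simp_rw [sum_comm (s := (univ : Finset (DirichletCharacter ℂ q)))]
    have : ∀ a b : (ZMod q)ˣ, ∑ χ : DirichletCharacter ℂ q,
        h a * χ a * ((starRingEnd ℂ) (h b) * (starRingEnd ℂ) (χ b)) =
        (h a * (starRingEnd ℂ) (h b)) * if b = a then (q.totient : ℂ) else 0 := by
      intro a b
      rw [← key, mul_sum]
      exact sum_congr rfl fun _ _ => by ring
    simp_rw [this]
    rw [mul_sum]
    refine sum_congr rfl fun a _ => ?_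
    simp
    ring
  exact_mod_cast e

theorem sum_mul_char_eq {q : ℕ} [NeZero q] (s : Finset ℕ) (w : ℕ → ℂ) (χ : DirichletCharacter ℂ q) :
    ∑ n ∈ s, w n * χ n =
      ∑ a : (ZMod q)ˣ, (∑ n ∈ s.filter fun n : ℕ => (n : ZMod q) = a, w n) * χ a := by
  classical
  have h1 : ∑ n ∈ s, w n * χ n = ∑ a : ZMod q, (∑ n ∈ s.filter fun n : ℕ => (n : ZMod q) = a, w n) * χ a := by
    rw [← sum_fiberwise s (fun n : ℕ => (n : ZMod q))]
    refine sum_congr rfl fun a _ => ?_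
    rw [sum_mul]
    exact sum_congr rfl fun n hn => by rw [(mem_filter.1 hn).2]
  rw [h1]
  symm
  refine sum_of_injOn (fun a : (ZMod q)ˣ => (a : ZMod q)) (fun a _ b _ h => Units.ext h) (by simp) ?_
    (fun _ _ => rfl)
  intro a _ ha
  rw [χ.map_nonunit, mul_zero]
  rintro ⟨u, rfl⟩
  exact ha ⟨u, by simp⟩

theorem sum_char_units_eq_zero {q : ℕ} [NeZero q] {χ : DirichletCharacter ℂ q} (hχ : χ ≠ 1) :
    ∑ a : (ZMod q)ˣ, χ a = 0 := by
  have h := MulChar.sum_eq_zero_of_ne_one hχ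
  rw [← h]
  refine sum_of_injOn (fun a : (ZMod q)ˣ => (a : ZMod q)) (fun a _ b _ h => Units.ext h) (by simp) ?_
    (fun _ _ => rfl)
  intro a _ ha
  rw [χ.map_nonunit]
  rintro ⟨u, rfl⟩
  exact ha ⟨u, by simp⟩

/-- If a weight is nearly equidistributed among the reduced residue classes, then its nonprincipal
character sums are small on average. -/
theorem sum_ne_one_norm_sq_le {q : ℕ} [NeZero q] {S : Finset (DirichletCharacter ℂ q)} (hS : 1 ∉ S)
    (s : Finset ℕ) (w : ℕ → ℂ) (M : ℂ) {B : ℝ}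
    (hB : ∀ a : (ZMod q)ˣ, ‖∑ n ∈ s.filter (fun n : ℕ => (n : ZMod q) = a), w n - M‖ ≤ B) :
    ∑ χ ∈ S, ‖∑ n ∈ s, w n * χ n‖ ^ 2 ≤
      (q.totient * B) ^ 2 := by
  have e : ∀ χ ∈ S, ‖∑ n ∈ s, w n * χ n‖ ^ 2 =
      ‖∑ a : (ZMod q)ˣ, (∑ n ∈ s.filter (fun n : ℕ => (n : ZMod q) = a), w n - M) * χ a‖ ^ 2 := by
    intro χ hχ
    rw [sum_mul_char_eq]
    simp_rw [sub_mul]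
    rw [sum_sub_distrib, ← mul_sum, sum_char_units_eq_zero (ne_of_mem_of_not_mem hχ hS), mul_zero, sub_zero]
  rw [sum_congr rfl e]
  refine (sum_le_sum_of_subset_of_nonneg (subset_univ _) fun _ _ _ => by positivity).trans ?_
  rw [sum_norm_sq_units, mul_pow, sq (q.totient : ℝ), mul_assoc]
  gcongr
  calc _ ≤ ∑ a : (ZMod q)ˣ, B ^ 2 := by gcongr; exact hB _
    _ = _ := by rw [sum_const, card_univ, ZMod.card_units_eq_totient, nsmul_eq_mul]

theorem sum_norm_sq_le {q : ℕ} [NeZero q] (s : Finset ℕ) (w : ℕ → ℝ) (hw : ∀ n, 0 ≤ w n) {B : ℝ}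
    (hB : ∀ a : (ZMod q)ˣ, ∑ n ∈ s.filter (fun n : ℕ => (n : ZMod q) = a), w n ≤ B) :
    ∑ χ : DirichletCharacter ℂ q, ‖∑ n ∈ s, (w n : ℂ) * χ n‖ ^ 2 ≤ (q.totient * B) ^ 2 := by
  simp_rw [sum_mul_char_eq]
  rw [sum_norm_sq_units, mul_pow, sq (q.totient : ℝ), mul_assoc]
  gcongr
  calc _ ≤ ∑ a : (ZMod q)ˣ, B ^ 2 := by
        refine sum_le_sum fun a _ => ?_
        rw [← Complex.ofReal_sum, Complex.norm_real]
        refine pow_le_pow_left₀ (norm_nonneg _) ?_ 2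
        rw [Real.norm_eq_abs, abs_of_nonneg (sum_nonneg fun _ _ => hw _)]
        exact hB a
    _ = _ := by rw [sum_const, card_univ, ZMod.card_units_eq_totient, nsmul_eq_mul]

end PretentiousSieve

namespace PretentiousSieve

open Finset

open Classical in
/-- A character restricted to `z`-rough integers, with the term at `1` removed, twisted by
`n ^ (-it)`. -/
noncomputable def twisted {q : ℕ} (z : ℝ) (χ : DirichletCharacter ℂ q) (t : ℝ) (n : ℕ) : ℂ :=
  if 1 < n ∧ Rough z n then χ n * (n : ℂ) ^ (-(t * Complex.I)) else 0

theorem norm_natCast_cpow_le_one (n : ℕ) (t : ℝ) : ‖(n : ℂ) ^ (-(t * Complex.I))‖ ≤ 1 := by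
  rcases n.eq_zero_or_pos with rfl | hn
  · by_cases h : (-(t * Complex.I)) = 0
    · rw [h]; simp
    · rw [Nat.cast_zero, Complex.zero_cpow h]; simp
  · rw [Complex.norm_natCast_cpow_of_pos hn]; simp

theorem norm_twisted_le {q : ℕ} (z : ℝ) (χ : DirichletCharacter ℂ q) (t : ℝ) (n : ℕ) :
    ‖twisted z χ t n‖ ≤ 1 := by
  unfold twisted
  split_ifs
  · rw [norm_mul]
    exact mul_le_one₀ (χ.norm_le_one _) (norm_nonneg _) (norm_natCast_cpow_le_one n t)
  · simp

theorem psum_twisted {q : ℕ} (z : ℝ) (χ : DirichletCharacter ℂ q) (t y : ℝ) [DecidablePred (Rough z)] :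
    psum (twisted z χ t) y =
      ∑ n ∈ (Ioc 1 ⌊y⌋₊).filter fun n => Rough z n, χ n * (n : ℂ) ^ (-(t * Complex.I)) := by
  classical
  rw [psum]
  symm
  have : (Ioc 1 ⌊y⌋₊).filter (fun n => Rough z n) =
      (Icc 1 ⌊y⌋₊).filter (fun n => 1 < n ∧ Rough z n) := by
    ext n
    simp only [mem_filter, mem_Ioc, mem_Icc]
    constructor
    · rintro ⟨⟨h1, h2⟩, h3⟩; exact ⟨⟨h1.le, h2⟩, h1, h3⟩
    · rintro ⟨⟨h1, h2⟩, h3, h4⟩; exact ⟨⟨h3, h2⟩, h4⟩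
  rw [this, sum_filter]
  refine sum_congr rfl fun n _ => ?_
  unfold twisted
  congr

theorem card_rough_eq_roughCount (z y : ℝ) [DecidablePred (Rough z)] :
    #((Ioc 1 ⌊y⌋₊).filter fun n => Rough z n) = roughCount z 1 (y - 1) (1 : ZMod 1) := by
  unfold roughCount
  rw [Nat.floor_one, add_sub_cancel]
  congr 1
  ext n
  simp only [mem_filter, and_congr_right_iff]
  intro _
  exact ⟨fun h => ⟨Subsingleton.elim _ _, h⟩, fun h => h.2⟩

theorem norm_psum_twisted_le_roughCount {q : ℕ} (z : ℝ) (χ : DirichletCharacter ℂ q) (t y : ℝ) :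
    ‖psum (twisted z χ t) y‖ ≤ roughCount z 1 (y - 1) (1 : ZMod 1) := by
  classical
  rw [psum_twisted, ← card_rough_eq_roughCount]
  refine (norm_sum_le _ _).trans ?_
  rw [card_eq_sum_ones, Nat.cast_sum]
  refine sum_le_sum fun n _ => ?_
  rw [norm_mul, Nat.cast_one]
  exact mul_le_one₀ (χ.norm_le_one _) (norm_nonneg _) (norm_natCast_cpow_le_one n t)

theorem sum_norm_sq_psum_twisted_le : ∃ C : ℝ, 0 ≤ C ∧ ∀ (q : ℕ) (Q z : ℝ), Regime q Q z →
    ∀ S : Finset (DirichletCharacter ℂ q), 1 ∉ S → ∀ y : ℝ, 1 ≤ y →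
      ∑ χ ∈ S, ‖psum (twisted z χ 0) y‖ ^ 2 ≤
        (C * (y ^ (1 - saving z) / Real.log z)) ^ 2 := by
  classical
  obtain ⟨C, hC, H⟩ := roughCount_equidistribution
  refine ⟨C, hC, fun q Q z hR S hS y hy => ?_⟩
  have : NeZero q := ⟨hR.pos.ne'⟩
  obtain ⟨M, hM⟩ := H q Q z hR y hy
  have hφ : 0 < (q.totient : ℝ) := by exact_mod_cast Nat.totient_pos.2 hR.pos
  have h := sum_ne_one_norm_sq_le hS ((Ioc 1 ⌊y⌋₊).filter fun n => Rough z n) (fun _ => 1) M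
    (B := C * (y ^ (1 - saving z) / (q.totient * Real.log z))) (by
      intro a
      have := hM a a.isUnit
      rw [← Real.norm_eq_abs, ← Complex.norm_real] at this
      convert this using 3
      rw [roughCount, Nat.floor_one, add_sub_cancel, filter_filter, sum_const, nsmul_eq_mul, mul_one]
      push_cast
      congr 3
      ext n
      simp only [mem_filter, and_comm])
  convert h using 1
  · refine sum_congr rfl fun χ _ => ?_
    rw [psum_twisted]
    simp
  · field_simp

theorem norm_psum_twisted_le : ∃ C : ℝ, 0 ≤ C ∧ ∀ (q : ℕ) (Q z : ℝ), Regime q Q z →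
    ∀ χ : DirichletCharacter ℂ q, χ ≠ 1 → ∀ t : ℝ, |t| ≤ 2 * Q ^ 6 → ∀ y : ℝ, 1 ≤ y →
      ‖psum (twisted z χ t) y‖ ≤ C / Real.log z * y ^ (1 - saving z) := by
  classical
  obtain ⟨C₁, hC₁, H₁⟩ := roughCount_le_of_le
  obtain ⟨C₂, hC₂, H₂⟩ := norm_rough_char_sum_le
  refine ⟨C₁ + (C₂ * Real.exp 1 + 40), by positivity, fun q Q z hR χ hχ t ht y hy => ?_⟩
  have hl := hR.one_le_log_z
  have hX : 0 ≤ y ^ (1 - saving z) / Real.log z := by positivity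
  rcases le_or_gt y (z ^ 40) with h | h
  · refine (norm_psum_twisted_le_roughCount z χ t y).trans ((H₁ 1 Q z hR.one y hy h _ isUnit_one).trans ?_)
    rw [Nat.totient_one, Nat.cast_one, one_mul, div_mul_eq_mul_div, mul_div_assoc]
    gcongr
    have := Real.exp_pos 1
    have : 0 ≤ C₂ * Real.exp 1 := by positivity
    linarith
  · obtain ⟨e1, e2⟩ := large_range_aux hR.exp_le h.le
    set b := ⌊saving z * Real.log y⌋₊
    have h0 := H₂ z hR.two_le_z b q hR.pos χ hχ t y hy
    have hz2 := hR.two_le_z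
    have hQ2 := hR.two_le
    have hly : 1 ≤ Real.log y := by
      rw [Real.le_log_iff_exp_le (by linarith)]
      exact hR.exp_le.trans ((le_self_pow₀ (by linarith [hR.two_le_z]) (by norm_num)).trans h.le)
    have hsplit : ∑ n ∈ (Ioc 0 ⌊y⌋₊).filter (fun n => Rough z n), χ n * (n : ℂ) ^ (-(t * Complex.I)) =
        1 + psum (twisted z χ t) y := by
      rw [psum_twisted]
      have : (Ioc 0 ⌊y⌋₊).filter (fun n => Rough z n) =
          insert 1 ((Ioc 1 ⌊y⌋₊).filter fun n => Rough z n) := by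
        ext n
        have h1 : Rough z 1 := fun p hp h => absurd (Nat.dvd_one.1 h) hp.one_lt.ne'
        have h2 : 1 ≤ ⌊y⌋₊ := Nat.one_le_floor_iff _ |>.2 hy
        simp only [mem_filter, mem_Ioc, mem_insert]
        constructor
        · rintro ⟨⟨h3, h4⟩, h5⟩
          by_cases h6 : n = 1
          · exact .inl h6
          · exact .inr ⟨⟨by lia, h4⟩, h5⟩
        · rintro (rfl | ⟨⟨h3, h4⟩, h5⟩)
          · exact ⟨⟨one_pos, h2⟩, h1⟩
          · exact ⟨⟨by lia, h4⟩, h5⟩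
      rw [this, sum_insert (by simp)]
      simp
    rw [hsplit] at h0
    have h1 : ‖psum (twisted z χ t) y‖ ≤ ‖1 + psum (twisted z χ t) y‖ + 1 := by
      have := norm_sub_le (1 + psum (twisted z χ t) y) 1
      rwa [add_sub_cancel_left, norm_one] at this
    have f1 : C₂ * Real.exp (-b) * (y / Real.log z) ≤
        C₂ * Real.exp 1 * (y ^ (1 - saving z) / Real.log z) := by
      calc _ = C₂ * ((Real.exp (-b) * y) / Real.log z) := by ring
        _ ≤ C₂ * ((Real.exp 1 * y ^ (1 - saving z)) / Real.log z) := by gcongr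
        _ = _ := by ring
    have f2 : 4 * z ^ (4 * b + 8) * (q * (1 + |t| * Real.log y)) + 1 ≤
        40 * (y ^ (1 - saving z) / Real.log z) := by
      rw [← mul_div_assoc, le_div_iff₀ (by positivity)]
      have g2 : Real.log z ≤ z := (Real.log_le_sub_one_of_pos (by linarith)).trans (by linarith)
      have hz0 : 0 ≤ z := by linarith
      have hQ1 : 1 ≤ Q := by linarith
      have g1 : q * (1 + |t| * Real.log y) ≤ z * Real.log y := by
        have a1 : (1:ℝ) ≤ Q ^ 6 := one_le_pow₀ hQ1
        calc q * (1 + |t| * Real.log y) ≤ Q * (1 * Real.log y + (2 * Q ^ 6) * Real.log y) := by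
              gcongr
              · exact hR.le
              · linarith
          _ ≤ Q * (Q ^ 6 * Real.log y + (2 * Q ^ 6) * Real.log y) := by gcongr
          _ = (3 * Q ^ 7) * Real.log y := by ring
          _ ≤ z * Real.log y := by
            gcongr
            rw [hR.z_eq]
            calc 3 * Q ^ 7 ≤ 2 ^ 2 * Q ^ 7 := by gcongr; norm_num
              _ ≤ Q ^ 2 * Q ^ 7 := by gcongr
              _ = Q ^ 9 := by ring
              _ ≤ Q ^ 100 := pow_le_pow_right₀ hQ1 (by norm_num)
      have g3 : 1 ≤ z ^ (4 * b + 8) * (z * Real.log y) :=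
        one_le_mul_of_one_le_of_one_le (one_le_pow₀ (by linarith))
          (one_le_mul_of_one_le_of_one_le (by linarith) hly)
      have g4 : 0 ≤ z ^ (4 * b + 8) := by positivity
      calc (4 * z ^ (4 * b + 8) * (q * (1 + |t| * Real.log y)) + 1) * Real.log z
          ≤ (4 * z ^ (4 * b + 8) * (z * Real.log y) + z ^ (4 * b + 8) * (z * Real.log y)) * z := by
            gcongr
        _ = 5 * (z ^ (4 * b + 8) * (z ^ 2 * Real.log y)) := by ring
        _ ≤ 5 * (8 * y ^ (1 - saving z)) := by gcongr
        _ = _ := by ring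
    have : 0 ≤ C₁ * (y ^ (1 - saving z) / Real.log z) := by positivity
    calc _ ≤ C₁ * (y ^ (1 - saving z) / Real.log z) +
          (C₂ * Real.exp 1 * (y ^ (1 - saving z) / Real.log z) +
            40 * (y ^ (1 - saving z) / Real.log z)) := by linarith
      _ = _ := by ring

/-- The number of `z`-rough integers in `(1, y]` is at most `C y / log z`, for all `y ≥ 1`. -/
theorem norm_psum_twisted_le_trivial : ∃ C : ℝ, 0 ≤ C ∧ ∀ (q : ℕ) (Q z : ℝ), Regime q Q z →
    ∀ (χ : DirichletCharacter ℂ q) (t y : ℝ), 1 ≤ y →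
      ‖psum (twisted z χ t) y‖ ≤ C / Real.log z * y := by
  obtain ⟨C, hC, H⟩ := roughCount_le
  refine ⟨20 * C, by positivity, fun q Q z hR χ t y hy => ?_⟩
  refine (norm_psum_twisted_le_roughCount z χ t y).trans ?_
  have hl := hR.one_le_log_z
  rcases le_or_gt y z with h | h
  · rw [roughCount_eq_zero hy h]
    simp only [Nat.cast_zero]
    positivity
  have hQ2 := hR.two_le
  have hQ1 : 1 ≤ Q := by linarith
  have h1 : ((1:ℕ):ℝ) * (Q ^ 5) ^ 9 ≤ y - 1 := by
    have e2 : Q ^ 45 * 2 ≤ z := by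
      rw [hR.z_eq]
      calc Q ^ 45 * 2 ≤ Q ^ 45 * Q := by gcongr
        _ = Q ^ 46 := by ring
        _ ≤ Q ^ 100 := pow_le_pow_right₀ hQ1 (by norm_num)
    have e3 : 1 ≤ Q ^ 45 := one_le_pow₀ hQ1
    push_cast
    ring_nf at e2 ⊢
    linarith
  have h2 := H (Q ^ 5) (hQ2.trans (le_self_pow₀ hQ1 (by norm_num))) 1 one_pos 1 (y - 1) zero_le_one h1 1
    isUnit_one
  have h3 : (roughCount z 1 (y - 1) (1 : ZMod 1) : ℝ) ≤ roughCount (Q ^ 5) 1 (y - 1) (1 : ZMod 1) := by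
    exact_mod_cast roughCount_mono (by rw [hR.z_eq]; exact pow_le_pow_right₀ hQ1 (by norm_num)) _
  have h4 : Real.log (Q ^ 5) = Real.log z / 20 := by
    rw [hR.log_z, Real.log_pow]; push_cast; ring
  rw [h4] at h2
  refine h3.trans (h2.trans ?_)
  rw [Nat.totient_one, Nat.cast_one, one_mul]
  calc C * ((y - 1) / (Real.log z / 20)) = 20 * C / Real.log z * (y - 1) := by field_simp
    _ ≤ _ := by gcongr; linarith

end PretentiousSieve

namespace PretentiousSieve

open Finset

open scoped ArithmeticFunction.vonMangoldt

theorem sum_vonMangoldt_dvd_le {p : ℕ} (hp : p.Prime) {N : ℕ} (hN : 1 ≤ N) :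
    ∑ n ∈ (Icc 1 N).filter (fun n => p ∣ n), Λ n ≤ Real.log N := by
  have h1 : ∑ n ∈ (Icc 1 N).filter (fun n => p ∣ n), Λ n ≤
      ∑ n ∈ (Icc 1 (Nat.log p N)).image (fun k => p ^ k), Λ n := by
    rw [← sum_filter_ne_zero]
    refine sum_le_sum_of_subset_of_nonneg (fun n hn => ?_)
      fun _ _ _ => ArithmeticFunction.vonMangoldt_nonneg
    rw [mem_filter, mem_filter, mem_Icc] at hn
    obtain ⟨hn, h0⟩ := hn
    rw [ne_eq, ArithmeticFunction.vonMangoldt_eq_zero_iff, not_not, isPrimePow_nat_iff] at h0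
    obtain ⟨r, k, hr, hk, rfl⟩ := h0
    have : p = r := (Nat.prime_dvd_prime_iff_eq hp hr).1 (hp.dvd_of_dvd_pow hn.2)
    subst this
    rw [mem_image]
    refine ⟨k, mem_Icc.2 ⟨hk, ?_⟩, rfl⟩
    exact Nat.le_log_of_pow_le hp.one_lt hn.1.2
  refine h1.trans ?_
  rw [sum_image (fun a _ b _ h => Nat.pow_right_injective hp.two_le h)]
  have h2 : ∀ k ∈ Icc 1 (Nat.log p N), Λ (p ^ k) = Real.log p := by
    intro k hk
    rw [mem_Icc] at hk
    rw [ArithmeticFunction.vonMangoldt_apply_pow (by lia), ArithmeticFunction.vonMangoldt_apply_prime hp]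
  rw [sum_congr rfl h2, sum_const, Nat.card_Icc, add_tsub_cancel_right, nsmul_eq_mul, ← Real.log_pow]
  have h3 : p ^ Nat.log p N ≤ N := Nat.pow_log_le_self p (by lia)
  refine Real.log_le_log ?_ (by exact_mod_cast h3)
  have := hp.pos
  positivity

open Classical in
theorem sum_vonMangoldt_not_rough_le {v : ℝ} (hv : 0 ≤ v) {N : ℕ} (hN : 1 ≤ N) :
    ∑ n ∈ (Icc 1 N).filter (fun n => ¬ Rough v n), Λ n ≤ v * Real.log N := by
  calc _ ≤ ∑ p ∈ (Icc 1 ⌊v⌋₊).filter Nat.Prime, ∑ n ∈ (Icc 1 N).filter (fun n => p ∣ n), Λ n := by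
        rw [sum_comm' (t' := Icc 1 N)
          (s' := fun n => ((Icc 1 ⌊v⌋₊).filter Nat.Prime).filter fun p => p ∣ n) (by
            intro x y; simp only [mem_filter]; tauto), sum_filter]
        refine sum_le_sum fun n _ => ?_
        have h0 : 0 ≤ Λ n := ArithmeticFunction.vonMangoldt_nonneg
        rw [sum_const, nsmul_eq_mul]
        by_cases h : Rough v n
        · rw [if_neg (not_not.2 h)]
          positivity
        · rw [if_pos h]
          unfold Rough at h
          push Not at h
          obtain ⟨p, hp, hpn, hpv⟩ := h
          have : 1 ≤ #(((Icc 1 ⌊v⌋₊).filter Nat.Prime).filter fun p => p ∣ n) := by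
            rw [Nat.one_le_iff_ne_zero, ← Nat.pos_iff_ne_zero, card_pos]
            exact ⟨p, by simp [hp, hpn, Nat.le_floor hpv, hp.one_lt.le]⟩
          have h2 : (1:ℝ) ≤ #(((Icc 1 ⌊v⌋₊).filter Nat.Prime).filter fun p => p ∣ n) := by
            exact_mod_cast this
          nlinarith
    _ ≤ ∑ p ∈ (Icc 1 ⌊v⌋₊).filter Nat.Prime, Real.log N :=
        sum_le_sum fun p hp => sum_vonMangoldt_dvd_le (mem_filter.1 hp).2 hN
    _ ≤ v * Real.log N := by
        rw [sum_const, nsmul_eq_mul]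
        have := Real.log_natCast_nonneg N
        gcongr
        calc ((#((Icc 1 ⌊v⌋₊).filter Nat.Prime) : ℕ) : ℝ) ≤ #(Icc 1 ⌊v⌋₊) := by
              exact_mod_cast card_filter_le _ _
          _ = ⌊v⌋₊ := by rw [Nat.card_Icc, add_tsub_cancel_right]
          _ ≤ v := Nat.floor_le hv

theorem log_two_mul_le_rpow {u : ℝ} (hu : 2 ≤ u) : Real.log (2 * u) ≤ 40 * u ^ (1 / 20 : ℝ) := by
  have h1 : Real.log (2 * u) ≤ 2 * Real.log u := by
    rw [Real.log_mul (by norm_num) (by linarith)]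
    have := Real.log_le_log two_pos hu
    linarith
  have h2 := Real.log_le_rpow_div (show 0 ≤ u by linarith) (show (0:ℝ) < 1 / 20 by norm_num)
  linarith

theorem vonMangoldt_ap_le : ∃ C : ℝ, 1 ≤ C ∧ ∀ q : ℕ, 0 < q → ∀ u : ℝ, 2 ^ 60 ≤ u →
    (q:ℝ) ^ 10 ≤ u → ∀ w h : ℝ, 0 ≤ w → √u ≤ h → w + h ≤ 2 * u → ∀ a : ZMod q, IsUnit a →
      ∑ n ∈ (Ioc ⌊w⌋₊ ⌊w + h⌋₊).filter (fun n : ℕ => (n : ZMod q) = a), Λ n ≤ C * (h / q.totient) := by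
  classical
  obtain ⟨C, hC, H⟩ := roughCount_le
  refine ⟨120 * C + 40, by linarith, fun q hq u hu hqu w h hw hh hwh a ha => ?_⟩
  have hu1 : 1 ≤ u := le_trans (by norm_num) hu
  have hu2 : 2 ≤ u := le_trans (by norm_num) hu
  have hu0 : 0 < u := by linarith
  set v := u ^ (1 / 60 : ℝ) with hv
  have hv60 : v ^ 60 = u := by
    rw [hv, ← Real.rpow_natCast, ← Real.rpow_mul hu0.le]; norm_num
  have hv2 : 2 ≤ v := by
    by_contra hlt
    push Not at hlt
    have : v ^ 60 < 2 ^ 60 := pow_lt_pow_left₀ hlt (by positivity) (by norm_num)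
    linarith
  have hv1 : 1 ≤ v := by linarith
  have hqv : (q:ℝ) ≤ v ^ 6 := by
    rw [← pow_le_pow_iff_left₀ (by positivity) (by positivity) (show 10 ≠ 0 by norm_num), ← pow_mul, hv60]
    exact hqu
  have hsq : √u = v ^ 30 := by
    rw [← hv60, show v ^ 60 = (v ^ 30) ^ 2 by ring, Real.sqrt_sq (by positivity)]
  rw [hsq] at hh
  have hφ : 0 < (q.totient : ℝ) := by exact_mod_cast Nat.totient_pos.2 hq
  have hφq : (q.totient : ℝ) ≤ v ^ 6 := (show (q.totient : ℝ) ≤ q by exact_mod_cast Nat.totient_le q).trans hqv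
  have hh0 : 0 < h := lt_of_lt_of_le (by positivity) hh
  have hlv : Real.log u = 60 * Real.log v := by rw [← hv60, Real.log_pow]; norm_num
  have hlv0 : 0 < Real.log v := Real.log_pos (by linarith)
  have hl2 : Real.log (2 * u) ≤ 2 * Real.log u := by
    rw [Real.log_mul (by norm_num) (by linarith)]
    have := Real.log_le_log two_pos hu2
    linarith
  have hcount := H v hv2 q hq w h hw (by
    calc q * v ^ 9 ≤ v ^ 6 * v ^ 9 := by gcongr
      _ = v ^ 15 := by ring
      _ ≤ v ^ 30 := pow_le_pow_right₀ hv1 (by norm_num)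
      _ ≤ h := hh) a ha
  have hmem : ∀ n ∈ Ioc ⌊w⌋₊ ⌊w + h⌋₊, 1 ≤ n ∧ (n:ℝ) ≤ 2 * u := by
    intro n hn
    rw [mem_Ioc] at hn
    exact ⟨by lia, ((Nat.le_floor_iff (by linarith)).1 hn.2).trans hwh⟩
  rw [← sum_filter_add_sum_filter_not _ (fun n => Rough v n), filter_filter]
  have p1 : ∑ n ∈ (Ioc ⌊w⌋₊ ⌊w + h⌋₊).filter (fun n : ℕ => (n : ZMod q) = a ∧ Rough v n), Λ n ≤
      120 * C * (h / q.totient) := by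
    calc _ ≤ ∑ n ∈ (Ioc ⌊w⌋₊ ⌊w + h⌋₊).filter (fun n : ℕ => (n : ZMod q) = a ∧ Rough v n),
          2 * Real.log u := by
          refine sum_le_sum fun n hn => ?_
          obtain ⟨h1, h2⟩ := hmem n (mem_filter.1 hn).1
          refine ArithmeticFunction.vonMangoldt_le_log.trans ((Real.log_le_log ?_ h2).trans hl2)
          exact_mod_cast h1
      _ = roughCount v w h a * (2 * Real.log u) := by
          rw [sum_const, nsmul_eq_mul]
          unfold roughCount
          congr 2
      _ ≤ (C * (h / (q.totient * Real.log v))) * (2 * Real.log u) := by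
          gcongr
          linarith [Real.log_nonneg hu1]
      _ = _ := by rw [hlv]; field_simp; ring
  have p2 : ∑ n ∈ ((Ioc ⌊w⌋₊ ⌊w + h⌋₊).filter (fun n : ℕ => (n : ZMod q) = a)).filter
      (fun n => ¬ Rough v n), Λ n ≤ 40 * (h / q.totient) := by
    have hN : 1 ≤ ⌊2 * u⌋₊ := Nat.one_le_floor_iff _ |>.2 (by linarith)
    calc _ ≤ ∑ n ∈ (Icc 1 ⌊2 * u⌋₊).filter (fun n => ¬ Rough v n), Λ n := by
          refine sum_le_sum_of_subset_of_nonneg (fun n hn => ?_)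
            fun _ _ _ => ArithmeticFunction.vonMangoldt_nonneg
          rw [mem_filter, mem_filter] at hn
          obtain ⟨h1, h2⟩ := hmem n hn.1.1
          exact mem_filter.2 ⟨mem_Icc.2 ⟨h1, Nat.le_floor h2⟩, hn.2⟩
      _ ≤ v * Real.log ⌊2 * u⌋₊ := sum_vonMangoldt_not_rough_le (by linarith) hN
      _ ≤ v * Real.log (2 * u) := by
          have : (0:ℝ) < ⌊2 * u⌋₊ := by exact_mod_cast hN
          gcongr
          exact Nat.floor_le (by linarith)
      _ ≤ v * (40 * v ^ 3) := by
          gcongr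
          refine (log_two_mul_le_rpow hu2).trans (le_of_eq ?_)
          rw [hv, ← Real.rpow_natCast, ← Real.rpow_mul hu0.le]; norm_num
      _ ≤ 40 * (h / q.totient) := by
          rw [← mul_div_assoc, le_div_iff₀ hφ]
          calc v * (40 * v ^ 3) * q.totient ≤ v * (40 * v ^ 3) * v ^ 6 := by gcongr
            _ = 40 * v ^ 10 := by ring
            _ ≤ 40 * v ^ 30 := by gcongr; norm_num
            _ ≤ 40 * h := by gcongr
  calc _ ≤ 120 * C * (h / q.totient) + 40 * (h / q.totient) := add_le_add p1 p2
    _ = _ := by ring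

end PretentiousSieve

namespace PretentiousSieve

open Finset

/-- The Dirichlet character obtained from `χ` by removing the primes up to `z`. -/
noncomputable def siftChar {q : ℕ} (z : ℝ) (χ : DirichletCharacter ℂ q) :
    DirichletCharacter ℂ (q * primorial ⌊z⌋₊) :=
  DirichletCharacter.changeLevel (dvd_mul_right _ _) χ

theorem coprime_primorial_iff {z : ℝ} (hz : 0 ≤ z) (n : ℕ) :
    n.Coprime (primorial ⌊z⌋₊) ↔ Rough z n := by
  unfold primorial
  rw [Nat.coprime_prod_right_iff]
  constructor
  · intro h p hp hpn
    by_contra hle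
    push Not at hle
    have := h p (by simpa [hp, Nat.lt_succ_iff] using Nat.le_floor hle)
    exact hp.one_lt.ne' (Nat.Coprime.eq_one_of_dvd (Nat.Coprime.symm this) hpn)
  · intro h p hp
    simp only [mem_filter, mem_range, Nat.lt_succ_iff] at hp
    rw [Nat.coprime_comm, hp.2.coprime_iff_not_dvd]
    intro hpn
    have h1 := h p hp.2 hpn
    have h2 := (Nat.le_floor_iff hz).1 hp.1
    linarith

open Classical in
theorem siftChar_apply {q : ℕ} {z : ℝ} (hz : 0 ≤ z) (χ : DirichletCharacter ℂ q) (n : ℕ) :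
    siftChar z χ n = if Rough z n then χ n else 0 := by
  by_cases h : n.Coprime (q * primorial ⌊z⌋₊)
  · obtain ⟨h1, h2⟩ := Nat.coprime_mul_iff_right.1 h
    have h3 := DirichletCharacter.changeLevel_eq_cast_of_dvd χ (dvd_mul_right q (primorial ⌊z⌋₊))
      (ZMod.unitOfCoprime n h)
    rw [ZMod.coe_unitOfCoprime, ZMod.cast_natCast (dvd_mul_right _ _)] at h3
    rw [if_pos ((coprime_primorial_iff hz n).1 h2), siftChar, h3]
  · rw [MulChar.map_nonunit _ (fun hu => h ((ZMod.isUnit_iff_coprime _ _).1 hu))]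
    split_ifs with hr
    · rw [MulChar.map_nonunit _ fun hu => h (Nat.coprime_mul_iff_right.2
        ⟨(ZMod.isUnit_iff_coprime _ _).1 hu, (coprime_primorial_iff hz n).2 hr⟩)]
    · rfl

/-- The Dirichlet series of `χ` restricted to `z`-rough integers. -/
noncomputable def siftL {q : ℕ} (z : ℝ) (χ : DirichletCharacter ℂ q) (s : ℂ) : ℂ :=
  LSeries (fun n : ℕ => siftChar z χ n) s

theorem rough_one (z : ℝ) : Rough z 1 := fun _ hp h => absurd (Nat.dvd_one.1 h) hp.one_lt.ne'

theorem siftL_eq {q : ℕ} {z : ℝ} (hz : 0 ≤ z) (χ : DirichletCharacter ℂ q) (t : ℝ) {s : ℂ}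
    (hs : 1 < s.re) :
    siftL z χ s = 1 + (s - t * Complex.I) *
      mel (psum (twisted z χ t)) (s - t * Complex.I) := by
  classical
  have hs' : 1 < (s - t * Complex.I).re := by simpa using hs
  have hsp := subpoly_of_norm_le_one (norm_twisted_le z χ t)
  rw [← hsp.lseries_eq hs']
  have h1 : siftL z χ s = LSeries (LSeries.delta + twisted z χ t) (s - t * Complex.I) := by
    unfold siftL LSeries
    refine tsum_congr fun n => ?_
    rcases n.eq_zero_or_pos with rfl | hn
    · simp
    rw [LSeries.term_of_ne_zero hn.ne', LSeries.term_of_ne_zero hn.ne', siftChar_apply hz,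
      Pi.add_apply]
    have hn0 : (n:ℂ) ≠ 0 := by exact_mod_cast hn.ne'
    have key : (if Rough z n then χ n else 0) * (n:ℂ) ^ (-(t * Complex.I)) =
        LSeries.delta n + twisted z χ t n := by
      unfold twisted LSeries.delta
      by_cases hn1 : n = 1
      · subst hn1
        simp [rough_one]
      · have : 1 < n := by lia
        by_cases hr : Rough z n <;> simp [hn1, hr, this]
    rw [← key, Complex.cpow_sub _ _ hn0, Complex.cpow_neg]
    have h2 : (n:ℂ) ^ (t * Complex.I) ≠ 0 := by simp [Complex.cpow_eq_zero_iff, hn0]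
    have h3 : (n:ℂ) ^ s ≠ 0 := by simp [Complex.cpow_eq_zero_iff, hn0]
    field_simp
  rw [h1, LSeries_add, LSeries_delta, Pi.one_apply]
  · exact LSeriesSummable_of_bounded_of_one_lt_re (m := 1) (fun n _ => by
      unfold LSeries.delta; split_ifs <;> simp) hs'
  · exact LSeriesSummable_of_bounded_of_one_lt_re (m := 1) (fun n _ => norm_twisted_le z χ t n) hs'

theorem hasDerivAt_siftL {q : ℕ} {z : ℝ} (hz : 0 ≤ z) (χ : DirichletCharacter ℂ q) (t : ℝ) {s : ℂ}
    (hs : 1 < s.re) :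
    HasDerivAt (siftL z χ) (mel (psum (twisted z χ t)) (s - t * Complex.I) -
      (s - t * Complex.I) * mel (logMul (psum (twisted z χ t))) (s - t * Complex.I)) s := by
  have hsp := (subpoly_of_norm_le_one (norm_twisted_le z χ t)).slowGrowth
  have hs' : 1 < (s - t * Complex.I).re := by simpa using hs
  have h0 : HasDerivAt (fun s : ℂ => s - t * Complex.I) 1 s := (hasDerivAt_id s).sub_const _
  have h1 := (hsp.hasDerivAt_mel hs').comp s h0
  have h2 := (h0.mul h1).const_add 1
  refine (h2.congr_of_eventuallyEq ?_).congr_deriv ?_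
  · have : ∀ᶠ w in nhds s, 1 < w.re :=
      Complex.continuous_re.continuousAt.eventually (eventually_gt_nhds hs)
    filter_upwards [this] with w hw
    rw [siftL_eq hz χ t hw]
    rfl
  · simp only [Function.comp]
    ring

theorem sub_ofReal_mul_I (σ t : ℝ) : ((σ : ℂ) + t * Complex.I) - t * Complex.I = σ := by ring

theorem Regime.two_div_saving {q : ℕ} {Q z : ℝ} (_ : Regime q Q z) : 2 / saving z = 32 * Real.log z := by
  unfold saving; field_simp; ring

/-- `|F| ≪ 1` and `|F'| ≪ log z` for the sifted Dirichlet series of a nonprincipal character. -/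
theorem norm_siftL_le : ∃ C : ℝ, 1 ≤ C ∧ ∀ (q : ℕ) (Q z : ℝ), Regime q Q z →
    ∀ χ : DirichletCharacter ℂ q, χ ≠ 1 → ∀ t : ℝ, |t| ≤ 2 * Q ^ 6 → ∀ σ : ℝ, 1 < σ → σ ≤ 2 →
      ‖siftL z χ (σ + t * Complex.I)‖ ≤ C ∧
      ‖deriv (siftL z χ) (σ + t * Complex.I)‖ ≤ C * Real.log z := by
  obtain ⟨C, hC, H⟩ := norm_psum_twisted_le
  refine ⟨1 + 64 * C + 32 * C + 2 * (64 * 32) * C, by linarith, fun q Q z hR χ hχ t ht σ h1 h2 => ?_⟩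
  have hl := hR.one_le_log_z
  have hz : 0 ≤ z := by linarith [hR.two_le_z]
  have hs : 1 < ((σ : ℂ) + t * Complex.I).re := by simpa using h1
  have hsg := (subpoly_of_norm_le_one (norm_twisted_le z χ t)).slowGrowth
  have b0 := hsg.norm_mel_le hR.saving_pos (H q Q z hR χ hχ t ht) (s := σ) (by simp; linarith) 0
  have b1 := hsg.norm_mel_le hR.saving_pos (H q Q z hR χ hχ t ht) (s := σ) (by simp; linarith) 1
  simp only [Function.iterate_zero, id_eq, pow_zero, one_mul, hR.two_div_saving, Function.iterate_one,
    pow_one, Nat.cast_one, mul_one] at b0 b1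
  have e0 : C / Real.log z * (32 * Real.log z) = 32 * C := by field_simp
  have e1 : C / Real.log z * (32 * Real.log z * (32 * Real.log z)) = 32 * 32 * C * Real.log z := by
    field_simp
  rw [e0] at b0
  rw [e1] at b1
  have hσ : ‖(σ : ℂ)‖ ≤ 2 := by
    rw [Complex.norm_real, Real.norm_eq_abs, abs_of_pos (by linarith)]; exact h2
  constructor
  · rw [siftL_eq hz χ t hs, sub_ofReal_mul_I]
    refine (norm_add_le _ _).trans ?_
    rw [norm_one, norm_mul]
    have : ‖(σ : ℂ)‖ * ‖mel (psum (twisted z χ t)) σ‖ ≤ 2 * (32 * C) := by gcongr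
    linarith
  · rw [(hasDerivAt_siftL hz χ t hs).deriv, sub_ofReal_mul_I]
    refine (norm_sub_le _ _).trans ?_
    rw [norm_mul]
    have h3 : ‖(σ : ℂ)‖ * ‖mel (logMul (psum (twisted z χ t))) σ‖ ≤ 2 * (32 * 32 * C * Real.log z) := by
      gcongr
    have h4 : 32 * C ≤ 32 * C * Real.log z := le_mul_of_one_le_right (by positivity) hl
    have h5 : 0 ≤ C * Real.log z := by positivity
    linarith

theorem norm_siftL_le_trivial : ∃ C : ℝ, 0 ≤ C ∧ ∀ (q : ℕ) (Q z : ℝ), Regime q Q z →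
    ∀ (χ : DirichletCharacter ℂ q) (t η : ℝ), 0 < η → η ≤ 1 →
      ‖siftL z χ (((1 + η : ℝ) : ℂ) + t * Complex.I)‖ ≤ 1 + C / (η * Real.log z) := by
  obtain ⟨C, hC, H⟩ := norm_psum_twisted_le_trivial
  refine ⟨4 * C, by positivity, fun q Q z hR χ t η h1 h2 => ?_⟩
  have hl := hR.one_le_log_z
  have hz : 0 ≤ z := by linarith [hR.two_le_z]
  have hs : 1 < (((1 + η : ℝ) : ℂ) + t * Complex.I).re := by
    rw [Complex.add_re, Complex.ofReal_re]; simpa using h1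
  have hsg := (subpoly_of_norm_le_one (norm_twisted_le z χ t)).slowGrowth
  have b0 := hsg.norm_mel_le (α := 1) h1 (fun y hy => by rw [Real.rpow_one]; exact H q Q z hR χ t y hy)
    (s := ((1 + η : ℝ) : ℂ)) (by rw [Complex.ofReal_re]) 0
  simp only [Function.iterate_zero, id_eq, pow_zero, one_mul] at b0
  rw [siftL_eq hz χ t hs, sub_ofReal_mul_I]
  refine (norm_add_le _ _).trans ?_
  rw [norm_one, norm_mul, Complex.norm_real, Real.norm_eq_abs, abs_of_pos (by linarith)]
  gcongr
  calc (1 + η) * ‖mel (psum (twisted z χ t)) ((1 + η : ℝ) : ℂ)‖ ≤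
        2 * (C / Real.log z * (2 / η)) := by gcongr; linarith
    _ = _ := by field_simp; ring

end PretentiousSieve

namespace PretentiousSieve

open Finset

section Repulsion

open scoped ArithmeticFunction.vonMangoldt

theorem norm_vonMangoldt_div_log_le_one (n : ℕ) : Λ n / Real.log n ≤ 1 :=
  div_le_one_of_le₀ ArithmeticFunction.vonMangoldt_le_log (Real.log_natCast_nonneg n)

theorem hasSum_re_log_LSeries {N : ℕ} (χ : DirichletCharacter ℂ N) {σ : ℝ} (hσ : 1 < σ) (t : ℝ) :
    ∃ l : ℝ, ‖LSeries (fun n : ℕ => χ n) (σ + t * Complex.I)‖ = Real.exp l ∧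
      HasSum (fun n : ℕ => Λ n / Real.log n * (n:ℝ) ^ (-σ) * (χ n * (n:ℂ) ^ (-(t * Complex.I))).re) l := by
  have hs : 1 < ((σ : ℂ) + t * Complex.I).re := by simpa using hσ
  refine ⟨(LSeries (fun n : ℕ => χ n * Λ n / Real.log n) (σ + t * Complex.I)).re, ?_, ?_⟩
  · rw [← Complex.norm_exp, DirichletCharacter.LSeries_eq_exp_LSeries χ hs]
  · have hsum : LSeriesSummable (fun n : ℕ => χ n * Λ n / Real.log n) (σ + t * Complex.I) := by
      refine LSeriesSummable_of_bounded_of_one_lt_re (m := 1) (fun n _ => ?_) hs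
      rw [mul_div_assoc, norm_mul, ← Complex.ofReal_div, Complex.norm_real, Real.norm_of_nonneg (by
        have := Real.log_natCast_nonneg n
        have : 0 ≤ Λ n := ArithmeticFunction.vonMangoldt_nonneg
        positivity)]
      exact mul_le_one₀ (χ.norm_le_one _) (by
        have := Real.log_natCast_nonneg n
        have : 0 ≤ Λ n := ArithmeticFunction.vonMangoldt_nonneg
        positivity) (norm_vonMangoldt_div_log_le_one n)
    have h := Complex.hasSum_re hsum.hasSum
    refine h.congr_fun fun n => ?_
    rcases n.eq_zero_or_pos with rfl | hn
    · simp
    have hn0 : (n:ℂ) ≠ 0 := by exact_mod_cast hn.ne'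
    rw [LSeries.term_of_ne_zero hn.ne', Complex.cpow_add _ _ hn0, Complex.cpow_neg,
      Real.rpow_neg (Nat.cast_nonneg n)]
    rw [← Complex.re_ofReal_mul]
    congr 1
    push_cast
    rw [Complex.ofReal_cpow (Nat.cast_nonneg n)]
    push_cast
    have h2 : (n:ℂ) ^ (t * Complex.I) ≠ 0 := by simp [Complex.cpow_eq_zero_iff, hn0]
    have h3 : (n:ℂ) ^ (σ:ℂ) ≠ 0 := by simp [Complex.cpow_eq_zero_iff, hn0]
    field_simp

theorem three_add_re_nonneg {u w : ℂ} (hu : ‖u‖ = 1) (hw : ‖w‖ = 1) :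
    0 ≤ 3 + 2 * u.re + 2 * w.re + 2 * (u * (starRingEnd ℂ) w).re := by
  have h1 : u.re ^ 2 + u.im ^ 2 = 1 := by
    have := Complex.sq_norm u
    rw [hu, Complex.normSq_apply] at this; nlinarith
  have h2 : w.re ^ 2 + w.im ^ 2 = 1 := by
    have := Complex.sq_norm w
    rw [hw, Complex.normSq_apply] at this; nlinarith
  rw [Complex.mul_re, Complex.conj_re, Complex.conj_im]
  nlinarith [sq_nonneg (1 + u.re + w.re), sq_nonneg (u.im + w.im)]

theorem one_le_norm_LSeries_prod {N : ℕ} (a b : DirichletCharacter ℂ N) {σ : ℝ} (hσ : 1 < σ)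
    (t t' : ℝ) :
    1 ≤ ‖LSeries (fun n : ℕ => (1 : DirichletCharacter ℂ N) n) (σ + (0:ℝ) * Complex.I)‖ ^ 3 *
      ‖LSeries (fun n : ℕ => a n) (σ + t * Complex.I)‖ ^ 2 *
      ‖LSeries (fun n : ℕ => b n) (σ + t' * Complex.I)‖ ^ 2 *
      ‖LSeries (fun n : ℕ => (a * b⁻¹) n) (σ + (t - t' : ℝ) * Complex.I)‖ ^ 2 := by
  obtain ⟨l₀, e₀, h₀⟩ := hasSum_re_log_LSeries (1 : DirichletCharacter ℂ N) hσ 0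
  obtain ⟨l₁, e₁, h₁⟩ := hasSum_re_log_LSeries a hσ t
  obtain ⟨l₂, e₂, h₂⟩ := hasSum_re_log_LSeries b hσ t'
  obtain ⟨l₃, e₃, h₃⟩ := hasSum_re_log_LSeries (a * b⁻¹) hσ (t - t')
  rw [e₀, e₁, e₂, e₃]
  simp_rw [← Real.exp_nat_mul, ← Real.exp_add]
  rw [Real.one_le_exp_iff]
  have h := (((h₀.mul_left 3).add (h₁.mul_left 2)).add (h₂.mul_left 2)).add (h₃.mul_left 2)
  push_cast
  refine h.nonneg fun n => ?_
  rcases n.eq_zero_or_pos with rfl | hn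
  · simp
  have hw : 0 ≤ Λ n / Real.log n * (n:ℝ) ^ (-σ) := by
    have := Real.log_natCast_nonneg n
    have : 0 ≤ Λ n := ArithmeticFunction.vonMangoldt_nonneg
    positivity
  by_cases hu : IsUnit (n : ZMod N)
  · have hn0 : (n:ℂ) ≠ 0 := by exact_mod_cast hn.ne'
    have hnorm : ∀ (χ : DirichletCharacter ℂ N) (t : ℝ), ‖χ n * (n:ℂ) ^ (-(t * Complex.I))‖ = 1 := by
      intro χ t
      rw [norm_mul, ← hu.unit_spec, DirichletCharacter.unit_norm_eq_one χ hu.unit,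
        Complex.norm_natCast_cpow_of_pos hn]
      simp
    have key := three_add_re_nonneg (hnorm a t) (hnorm b t')
    have e1 : (1 : DirichletCharacter ℂ N) n * (n:ℂ) ^ (-((0:ℝ) * Complex.I)) = 1 := by
      rw [MulChar.one_apply hu]; simp
    have e2 : (a * b⁻¹) n * (n:ℂ) ^ (-((t - t' : ℝ) * Complex.I)) =
        a n * (n:ℂ) ^ (-(t * Complex.I)) * (starRingEnd ℂ) (b n * (n:ℂ) ^ (-(t' * Complex.I))) := by
      have e3 : (starRingEnd ℂ) ((n:ℂ) ^ (-(t' * Complex.I))) = (n:ℂ) ^ (t' * Complex.I) := by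
        have := Complex.cpow_conj (n:ℂ) (-(t' * Complex.I))
          (by rw [Complex.natCast_arg]; exact Real.pi_pos.ne)
        rw [Complex.conj_natCast] at this
        rw [← this]
        simp
      rw [map_mul, e3, MulChar.mul_apply, ← MulChar.star_apply', RCLike.star_def]
      rw [show (-((t - t' : ℝ) * Complex.I)) = -(t * Complex.I) + t' * Complex.I by push_cast; ring,
        Complex.cpow_add _ _ hn0]
      ring
    rw [e1, e2, Complex.one_re]
    have := mul_nonneg hw key
    linarith
  · have h0 : ∀ χ : DirichletCharacter ℂ N, χ n = 0 := fun χ => MulChar.map_nonunit _ hu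
    simp [h0]

end Repulsion

theorem siftChar_mul_inv {q : ℕ} (z : ℝ) (χ χ' : DirichletCharacter ℂ q) :
    siftChar z (χ * χ'⁻¹) = siftChar z χ * (siftChar z χ')⁻¹ := by
  simp [siftChar, map_mul, map_inv]

theorem siftChar_one {q : ℕ} (z : ℝ) : siftChar z (1 : DirichletCharacter ℂ q) = 1 := by
  simp [siftChar]

theorem one_le_norm_siftL_prod {q : ℕ} (z : ℝ) (χ χ' : DirichletCharacter ℂ q) {σ : ℝ} (hσ : 1 < σ)
    (t t' : ℝ) :
    1 ≤ ‖siftL z (1 : DirichletCharacter ℂ q) (σ + (0:ℝ) * Complex.I)‖ ^ 3 *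
      ‖siftL z χ (σ + t * Complex.I)‖ ^ 2 * ‖siftL z χ' (σ + t' * Complex.I)‖ ^ 2 *
      ‖siftL z (χ * χ'⁻¹) (σ + (t - t' : ℝ) * Complex.I)‖ ^ 2 := by
  unfold siftL
  rw [siftChar_mul_inv, siftChar_one]
  exact one_le_norm_LSeries_prod _ _ hσ t t'

theorem norm_siftL_sub_le : ∃ C : ℝ, 1 ≤ C ∧ ∀ (q : ℕ) (Q z : ℝ), Regime q Q z →
    ∀ χ : DirichletCharacter ℂ q, χ ≠ 1 → ∀ t : ℝ, |t| ≤ 2 * Q ^ 6 → ∀ σ σ₀ : ℝ, 1 < σ → σ ≤ σ₀ →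
      σ₀ ≤ 2 → ‖siftL z χ (σ₀ + t * Complex.I) - siftL z χ (σ + t * Complex.I)‖ ≤
        C * Real.log z * (σ₀ - σ) := by
  obtain ⟨C, hC, H⟩ := norm_siftL_le
  refine ⟨C, hC, fun q Q z hR χ hχ t ht σ σ₀ h1 h2 h3 => ?_⟩
  have hz : 0 ≤ z := by linarith [hR.two_le_z]
  have hd : ∀ x ∈ Set.Icc σ σ₀, HasDerivWithinAt (fun x : ℝ => siftL z χ (x + t * Complex.I))
      (deriv (siftL z χ) (x + t * Complex.I)) (Set.Icc σ σ₀) x := by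
    intro x hx
    have hs : 1 < ((x : ℂ) + t * Complex.I).re := by simpa using h1.trans_le hx.1
    have e := (hasDerivAt_siftL hz χ t hs).differentiableAt.hasDerivAt
    have e2 := HasDerivAt.comp_ofReal (z := x) (e := fun w : ℂ => siftL z χ (w + t * Complex.I))
      (e' := deriv (siftL z χ) (x + t * Complex.I)) (e.comp_add_const _ _)
    exact e2.hasDerivWithinAt
  have := Convex.norm_image_sub_le_of_norm_hasDerivWithin_le hd
    (fun x hx => (H q Q z hR χ hχ t ht x (h1.trans_le hx.1) (hx.2.trans h3)).2) (convex_Icc σ σ₀)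
    (Set.left_mem_Icc.2 h2) (Set.right_mem_Icc.2 h2)
  rwa [Real.norm_of_nonneg (by linarith)] at this

/-- At most one nonprincipal character has a sifted Dirichlet series that is small near the line
`Re s = 1`. -/
theorem exists_exceptional : ∃ c K : ℝ, 0 < c ∧ 1 ≤ K ∧ ∀ (q : ℕ) (Q z : ℝ), Regime q Q z →
    ∃ χ₁ : DirichletCharacter ℂ q, ∀ χ : DirichletCharacter ℂ q, χ ≠ 1 → χ ≠ χ₁ →
      ∀ t : ℝ, |t| ≤ Q ^ 6 → ∀ σ : ℝ, 1 < σ → σ ≤ 1 + 1 / (K * Real.log z) →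
        c ≤ ‖siftL z χ (σ + t * Complex.I)‖ := by
  obtain ⟨C₁, hC₁, H₁⟩ := norm_siftL_le
  obtain ⟨C₂, hC₂, H₂⟩ := norm_siftL_le_trivial
  obtain ⟨C₃, hC₃, H₃⟩ := norm_siftL_sub_le
  set D := (1 + C₂) ^ 3 * C₁ ^ 2 with hD
  have hD1 : 1 ≤ D := one_le_mul_of_one_le_of_one_le (one_le_pow₀ (by linarith)) (one_le_pow₀ hC₁)
  set L := 2 * C₃ * D with hL
  have hL1 : 1 ≤ L := by nlinarith
  have hL0 : 0 < L := by linarith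
  refine ⟨1 / (2 * D) * (1 / L ^ 3), L ^ 4, by positivity, one_le_pow₀ hL1, fun q Q z hR => ?_⟩
  have hl := hR.one_le_log_z
  have hQ6 : 0 ≤ Q ^ 6 := pow_nonneg (by linarith [hR.two_le]) 6
  set η := 1 / (L ^ 4 * Real.log z) with hη
  have hη0 : 0 < η := by positivity
  have hη1 : η ≤ 1 := by
    rw [hη, div_le_one (by positivity)]
    exact one_le_mul_of_one_le_of_one_le (one_le_pow₀ hL1) hl
  have hpair : ∀ χ χ' : DirichletCharacter ℂ q, χ ≠ χ' → ∀ t t' : ℝ, |t| ≤ Q ^ 6 → |t'| ≤ Q ^ 6 →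
      ‖siftL z χ ((1 + η : ℝ) + t * Complex.I)‖ < 1 / D * (1 / L ^ 3) →
      1 / D * (1 / L ^ 3) ≤ ‖siftL z χ' ((1 + η : ℝ) + t' * Complex.I)‖ := by
    intro χ χ' hne t t' ht ht' h
    by_contra! h'
    have h0 := one_le_norm_siftL_prod z χ χ' (show 1 < 1 + η by linarith) t t'
    have a0 : ‖siftL z (1 : DirichletCharacter ℂ q) ((1 + η : ℝ) + (0:ℝ) * Complex.I)‖ ≤
        (1 + C₂) * L ^ 4 := by
      refine (H₂ q Q z hR 1 0 η hη0 hη1).trans ?_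
      have : C₂ / (η * Real.log z) = C₂ * L ^ 4 := by rw [hη]; field_simp
      rw [this]
      have : 1 ≤ L ^ 4 := one_le_pow₀ hL1
      linarith
    have a3 := (H₁ q Q z hR (χ * χ'⁻¹) (fun h => hne (mul_inv_eq_one.1 h)) (t - t')
      ((abs_sub _ _).trans (by linarith)) (1 + η) (by linarith) (by linarith)).1
    have : ‖siftL z (1 : DirichletCharacter ℂ q) ((1 + η : ℝ) + (0:ℝ) * Complex.I)‖ ^ 3 *
      ‖siftL z χ ((1 + η : ℝ) + t * Complex.I)‖ ^ 2 * ‖siftL z χ' ((1 + η : ℝ) + t' * Complex.I)‖ ^ 2 *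
      ‖siftL z (χ * χ'⁻¹) ((1 + η : ℝ) + (t - t' : ℝ) * Complex.I)‖ ^ 2 <
        ((1 + C₂) * L ^ 4) ^ 3 * (1 / D * (1 / L ^ 3)) ^ 2 * (1 / D * (1 / L ^ 3)) ^ 2 * C₁ ^ 2 := by
      calc _ ≤ ((1 + C₂) * L ^ 4) ^ 3 * (1 / D * (1 / L ^ 3)) ^ 2 *
            ‖siftL z χ' ((1 + η : ℝ) + t' * Complex.I)‖ ^ 2 * C₁ ^ 2 := by gcongr
        _ < _ := by gcongr
    have e : ((1 + C₂) * L ^ 4) ^ 3 * (1 / D * (1 / L ^ 3)) ^ 2 * (1 / D * (1 / L ^ 3)) ^ 2 * C₁ ^ 2 =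
        1 / D ^ 3 := by
      have : D ≠ 0 := by positivity
      field_simp
      exact hD.symm
    have e2 : 1 / D ^ 3 ≤ 1 := by
      rw [div_le_one (by positivity)]; exact one_le_pow₀ hD1
    linarith
  have hgood : ∀ χ : DirichletCharacter ℂ q, χ ≠ 1 → ∀ t : ℝ, |t| ≤ Q ^ 6 →
      1 / D * (1 / L ^ 3) ≤ ‖siftL z χ ((1 + η : ℝ) + t * Complex.I)‖ →
      ∀ σ : ℝ, 1 < σ → σ ≤ 1 + η → 1 / (2 * D) * (1 / L ^ 3) ≤ ‖siftL z χ (σ + t * Complex.I)‖ := by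
    intro χ hχ t ht h σ h1 h2
    have h3 := H₃ q Q z hR χ hχ t (by linarith) σ (1 + η) h1 h2 (by linarith)
    have h4 : C₃ * Real.log z * (1 + η - σ) ≤ 1 / (2 * D) * (1 / L ^ 3) := by
      calc C₃ * Real.log z * (1 + η - σ) ≤ C₃ * Real.log z * η := by gcongr; linarith
        _ = C₃ * (1 / L) * (1 / L ^ 3) := by rw [hη]; field_simp
        _ = 1 / (2 * D) * (1 / L ^ 3) := by
          congr 1
          rw [hL]; field_simp
    have h5 := norm_sub_norm_le (siftL z χ ((1 + η : ℝ) + t * Complex.I)) (siftL z χ (σ + t * Complex.I))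
    have h6 : 1 / D * (1 / L ^ 3) = 2 * (1 / (2 * D) * (1 / L ^ 3)) := by field_simp
    linarith
  by_cases hex : ∃ χ : DirichletCharacter ℂ q, ∃ t : ℝ, |t| ≤ Q ^ 6 ∧
      ‖siftL z χ ((1 + η : ℝ) + t * Complex.I)‖ < 1 / D * (1 / L ^ 3)
  · obtain ⟨χ₁, t₁, ht₁, h₁⟩ := hex
    exact ⟨χ₁, fun χ h1 h2 t ht => hgood χ h1 t ht (hpair χ₁ χ (Ne.symm h2) t₁ t ht₁ ht h₁)⟩
  · push Not at hex
    exact ⟨1, fun χ h1 _ t ht => hgood χ h1 t ht (hex χ t ht)⟩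

end PretentiousSieve

namespace PretentiousSieve

open MeasureTheory Set Filter Topology
open scoped ArithmeticFunction.vonMangoldt

/-- The summatory function of `Λ χ` over `z`-rough integers. -/
noncomputable def roughPsi {q : ℕ} (z : ℝ) (χ : DirichletCharacter ℂ q) : ℝ → ℂ :=
  psum fun n => (Λ n : ℂ) * siftChar z χ n

theorem subpoly_vonMangoldt_mul_siftChar {q : ℕ} (z : ℝ) (χ : DirichletCharacter ℂ q) :
    Subpoly fun n => (Λ n : ℂ) * siftChar z χ n :=
  subpoly_vonMangoldt_mul fun n => (siftChar z χ).norm_le_one n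

theorem slowGrowth_roughPsi {q : ℕ} (z : ℝ) (χ : DirichletCharacter ℂ q) :
    SlowGrowth (roughPsi z χ) :=
  (subpoly_vonMangoldt_mul_siftChar z χ).slowGrowth

theorem slowGrowth_psum_twisted {q : ℕ} (z : ℝ) (χ : DirichletCharacter ℂ q) (t : ℝ) :
    SlowGrowth (psum (twisted z χ t)) :=
  (subpoly_of_norm_le_one (norm_twisted_le z χ t)).slowGrowth

theorem norm_LSeries_le {g : ℕ → ℂ} {M a : ℝ} (ha : 0 < a) (ha1 : a ≤ 1)
    (hg : ∀ n : ℕ, 1 ≤ n → ‖g n‖ ≤ M * (n:ℝ) ^ a) {s : ℂ} (hs : 1 + 2 * a ≤ s.re) :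
    ‖LSeries g s‖ ≤ 4 * M / a := by
  have hM : 0 ≤ M := by simpa using (norm_nonneg _).trans (hg 1 le_rfl)
  have h1 : Subpoly (fun _ => (1:ℂ)) := subpoly_of_norm_le_one (by simp)
  set w : ℂ := ((1 + a : ℝ) : ℂ) with hw
  have hwre : w.re = 1 + a := by simp [hw]
  have hsum : LSeriesSummable (fun _ => (1:ℂ)) w :=
    LSeriesSummable_of_bounded_of_one_lt_re (m := 1) (by simp) (by rw [hwre]; linarith)
  have hreal : ∀ n : ℕ, LSeries.term (fun _ => (1:ℂ)) w n =
      ((if n = 0 then 0 else (n:ℝ) ^ (-(1 + a)) : ℝ) : ℂ) := by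
    intro n
    by_cases h : n = 0
    · simp [h]
    · rw [LSeries.term_of_ne_zero h, if_neg h, Complex.ofReal_cpow (by positivity)]
      push_cast
      rw [Complex.cpow_neg, hw]
      push_cast
      simp
  have hsum' : Summable (fun n : ℕ => if n = 0 then 0 else (n:ℝ) ^ (-(1 + a))) := by
    have : Summable fun n : ℕ => LSeries.term (fun _ => (1:ℂ)) w n := hsum
    simp_rw [hreal] at this
    exact_mod_cast this
  have hle : ∑' n : ℕ, (if n = 0 then 0 else (n:ℝ) ^ (-(1 + a))) ≤ 4 / a := by
    have e : LSeries (fun _ => (1:ℂ)) w = ((∑' n : ℕ, (if n = 0 then 0 else (n:ℝ) ^ (-(1 + a))) : ℝ) : ℂ) := by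
      rw [LSeries, Complex.ofReal_tsum]
      exact tsum_congr hreal
    have h2 := h1.slowGrowth.norm_mel_le (M := 1) (α := 1) ha (fun y hy => by
      simp only [psum, Finset.sum_const, Nat.card_Icc, Nat.add_sub_cancel, nsmul_eq_mul, mul_one,
        Real.rpow_one, one_mul, Complex.norm_natCast]
      exact Nat.floor_le (by linarith)) (s := w) (by rw [hwre]) 0
    have h3 : ‖LSeries (fun _ => (1:ℂ)) w‖ ≤ 2 * (2 / a) := by
      rw [h1.lseries_eq (by rw [hwre]; linarith), norm_mul]
      have : ‖w‖ ≤ 2 := by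
        rw [hw, Complex.norm_real, Real.norm_of_nonneg (by linarith)]; linarith
      have h4 : ‖mel (psum fun _ => (1:ℂ)) w‖ ≤ 2 / a := by simpa using h2
      gcongr
    rw [e, Complex.norm_real] at h3
    refine (le_abs_self _).trans (h3.trans (le_of_eq (by ring)))
  calc ‖LSeries g s‖ ≤ ∑' n : ℕ, M * (if n = 0 then 0 else (n:ℝ) ^ (-(1 + a))) := by
        refine tsum_of_norm_bounded (hsum'.mul_left M).hasSum fun n => ?_
        by_cases h : n = 0
        · simp [h]
        · have hn : 1 ≤ n := Nat.one_le_iff_ne_zero.2 h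
          have hn' : (1:ℝ) ≤ n := by exact_mod_cast hn
          rw [LSeries.term_of_ne_zero h, if_neg h, norm_div, Complex.norm_natCast_cpow_of_pos hn,
            div_eq_mul_inv, ← Real.rpow_neg (by linarith)]
          calc ‖g n‖ * (n:ℝ) ^ (-s.re) ≤ (M * (n:ℝ) ^ a) * (n:ℝ) ^ (-(1 + 2 * a)) := by
                gcongr
                exact hg n hn
            _ = M * (n:ℝ) ^ (-(1 + a)) := by
                rw [mul_assoc, ← Real.rpow_add (by linarith)]; ring_nf
    _ ≤ M * (4 / a) := by rw [tsum_mul_left]; gcongr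
    _ = _ := by ring

section Formulas

variable {q : ℕ} {z : ℝ}

theorem deriv_siftL (hz : 0 ≤ z) (χ : DirichletCharacter ℂ q) {s : ℂ} (hs : 1 < s.re) :
    deriv (siftL z χ) s = mel (psum (twisted z χ 0)) s -
      s * mel (logMul (psum (twisted z χ 0))) s := by
  simpa using (hasDerivAt_siftL hz χ 0 hs).deriv

theorem siftL_ne_zero (hq : 0 < q) (χ : DirichletCharacter ℂ q) {s : ℂ} (hs : 1 < s.re) :
    siftL z χ s ≠ 0 := by
  have : NeZero (q * primorial ⌊z⌋₊) := ⟨(Nat.mul_pos hq (primorial_pos _)).ne'⟩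
  exact DirichletCharacter.LSeries_ne_zero_of_one_lt_re _ hs

theorem mel_roughPsi (χ : DirichletCharacter ℂ q) {s : ℂ} (hs : 1 < s.re) :
    mel (roughPsi z χ) s = -deriv (siftL z χ) s / (siftL z χ s * s) := by
  have h1 := (subpoly_vonMangoldt_mul_siftChar z χ).lseries_eq hs
  have h2 := DirichletCharacter.LSeries_twist_vonMangoldt_eq (siftChar z χ) hs
  have h3 : LSeries (fun n => (Λ n : ℂ) * siftChar z χ n) s =
      -deriv (siftL z χ) s / siftL z χ s := by
    rw [show siftL z χ = LSeries (fun n : ℕ => siftChar z χ n) from rfl, ← h2]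
    congr 1
    ext n
    simp [mul_comm]
  have hs0 : s ≠ 0 := by rintro rfl; simp at hs; linarith
  rw [h3] at h1
  rw [roughPsi, ← div_div, h1, mul_div_cancel_left₀ _ hs0]

theorem mel_logMul_roughPsi (hq : 0 < q) (hz : 0 ≤ z) (χ : DirichletCharacter ℂ q) {s : ℂ}
    (hs : 1 < s.re) :
    mel (logMul (roughPsi z χ)) s =
      (s * mel (logMul^[2] (psum (twisted z χ 0))) s - 2 * mel (logMul (psum (twisted z χ 0))) s) /
        (siftL z χ s * s) -
      deriv (siftL z χ) s * (deriv (siftL z χ) s * s + siftL z χ s) / (siftL z χ s * s) ^ 2 := by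
  have hs0 : s ≠ 0 := by rintro rfl; simp at hs; linarith
  have hF := siftL_ne_zero (z := z) hq χ hs
  have hA := slowGrowth_psum_twisted z χ 0
  have d1 := (slowGrowth_roughPsi z χ).hasDerivAt_mel hs
  have dF : HasDerivAt (siftL z χ) (deriv (siftL z χ) s) s :=
    (hasDerivAt_siftL hz χ 0 hs).differentiableAt.hasDerivAt
  have dF' : HasDerivAt (deriv (siftL z χ)) (-mel (logMul (psum (twisted z χ 0))) s -
      (1 * mel (logMul (psum (twisted z χ 0))) s +
        s * -mel (logMul (logMul (psum (twisted z χ 0)))) s)) s := by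
    refine ((hA.hasDerivAt_mel hs).sub ((hasDerivAt_id s).mul
      (hA.mul_log.hasDerivAt_mel hs))).congr_of_eventuallyEq ?_
    have : ∀ᶠ w in nhds s, 1 < w.re :=
      Complex.continuous_re.continuousAt.eventually (eventually_gt_nhds hs)
    filter_upwards [this] with w hw
    rw [deriv_siftL hz χ hw]
    rfl
  have d2 := (dF'.neg.div (dF.mul (hasDerivAt_id s)) (mul_ne_zero hF hs0)).congr_of_eventuallyEq
    (f₁ := mel (roughPsi z χ)) (by
      have : ∀ᶠ w in nhds s, 1 < w.re :=
        Complex.continuous_re.continuousAt.eventually (eventually_gt_nhds hs)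
      filter_upwards [this] with w hw
      rw [mel_roughPsi χ hw]
      rfl)
  have e := d1.unique d2
  rw [neg_eq_iff_eq_neg] at e
  rw [e, show logMul^[2] (psum (twisted z χ 0)) = logMul (logMul (psum (twisted z χ 0))) from rfl]
  simp only [id, Pi.mul_apply, Pi.neg_apply]
  field_simp
  ring

theorem norm_mel_logMul_roughPsi_le (hq : 0 < q) (hz : 0 ≤ z) (χ : DirichletCharacter ℂ q) {s : ℂ}
    (hs : 1 < s.re) {c C l : ℝ} (hc : 0 < c) (hc1 : c ≤ 1) (hC : 1 ≤ C) (hl : 1 ≤ l)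
    (hF : c ≤ ‖siftL z χ s‖) (hF' : ‖deriv (siftL z χ) s‖ ≤ C * l) :
    ‖mel (logMul (roughPsi z χ)) s‖ ≤ 4 * C / c ^ 2 *
      (l * ‖mel (logMul^[0] (psum (twisted z χ 0))) s‖ + l * ‖mel (logMul^[1] (psum (twisted z χ 0))) s‖ +
        ‖mel (logMul^[2] (psum (twisted z χ 0))) s‖) := by
  have hs1 : 1 ≤ ‖s‖ := hs.le.trans ((le_abs_self _).trans (Complex.abs_re_le_norm s))
  have hs0 : s ≠ 0 := by rintro rfl; simp at hs; linarith
  have hF0 := siftL_ne_zero (z := z) hq χ hs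
  rw [mel_logMul_roughPsi hq hz χ hs]
  have hd := deriv_siftL hz χ hs
  simp only [Function.iterate_zero, Function.iterate_one, id]
  set H := mel (psum (twisted z χ 0)) s
  set H1 := mel (logMul (psum (twisted z χ 0))) s
  set H2 := mel (logMul^[2] (psum (twisted z χ 0))) s
  set F := siftL z χ s
  set F' := deriv (siftL z χ) s
  have e : (s * H2 - 2 * H1) / (F * s) - F' * (F' * s + F) / (F * s) ^ 2 =
      H2 / F - 2 * H1 / F / s - F' / F / F * (H / s - H1) - (H / s - H1) / F / s := by
    have : F' * (F' * s + F) = (H - s * H1) * (F' * s + F) := by rw [hd]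
    rw [this]
    field_simp
    ring
  have hdiv : ∀ w : ℂ, ‖w / F‖ ≤ ‖w‖ / c := fun w => by rw [norm_div]; gcongr
  have hdivs : ∀ w : ℂ, ‖w / s‖ ≤ ‖w‖ := fun w => by
    rw [norm_div]; exact div_le_self (norm_nonneg _) hs1
  have hP : ‖H / s - H1‖ ≤ ‖H‖ + ‖H1‖ := (norm_sub_le _ _).trans (by gcongr; exact hdivs H)
  have b1 : ‖H2 / F‖ ≤ ‖H2‖ / c := hdiv _
  have b2 : ‖2 * H1 / F / s‖ ≤ 2 * ‖H1‖ / c := (hdivs _).trans ((hdiv _).trans (by simp))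
  have b3 : ‖F' / F / F * (H / s - H1)‖ ≤ C * l / c / c * (‖H‖ + ‖H1‖) := by
    rw [norm_mul]
    gcongr
    exact (hdiv _).trans (by gcongr; exact (hdiv _).trans (by gcongr))
  have b4 : ‖(H / s - H1) / F / s‖ ≤ (‖H‖ + ‖H1‖) / c :=
    (hdivs _).trans ((hdiv _).trans (by gcongr))
  rw [e]
  have hk : 1 / c ≤ C / c ^ 2 := by
    rw [div_le_div_iff₀ hc (by positivity)]; nlinarith
  have hH := norm_nonneg H
  have hH1 := norm_nonneg H1
  have hH2 := norm_nonneg H2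
  have hB : 0 < C / c ^ 2 := by positivity
  calc _ ≤ ‖H2‖ / c + 2 * ‖H1‖ / c + C * l / c / c * (‖H‖ + ‖H1‖) + (‖H‖ + ‖H1‖) / c := by
        refine (norm_sub_le _ _).trans (add_le_add ((norm_sub_le _ _).trans (add_le_add
          ((norm_sub_le _ _).trans (add_le_add b1 b2)) b3)) b4)
    _ = 1 / c * (‖H2‖ + 3 * ‖H1‖ + ‖H‖) + C / c ^ 2 * (l * (‖H‖ + ‖H1‖)) := by field_simp; ring
    _ ≤ C / c ^ 2 * (‖H2‖ + 3 * (l * ‖H1‖) + l * ‖H‖) + C / c ^ 2 * (l * (‖H‖ + ‖H1‖)) := by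
        gcongr
        · exact le_mul_of_one_le_left hH1 hl
        · exact le_mul_of_one_le_left hH hl
    _ ≤ _ := by
        have : 0 ≤ C / c ^ 2 * ‖H2‖ := by positivity
        have : 0 ≤ C / c ^ 2 * (l * ‖H‖) := by positivity
        have : 0 ≤ C / c ^ 2 * (l * ‖H1‖) := by positivity
        have e : 4 * C / c ^ 2 = 4 * (C / c ^ 2) := by ring
        rw [e]
        nlinarith

/-- A crude bound for `mel (logMul (roughPsi z χ))` with decay in the imaginary direction. -/
theorem norm_mel_logMul_roughPsi_le_div (χ : DirichletCharacter ℂ q) {η : ℝ}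
    (hη : 0 < η) (hη1 : η ≤ 1) {s : ℂ} (hs : 1 + η ≤ s.re) :
    ‖mel (logMul (roughPsi z χ)) s‖ ≤ 144 * (1 / η) ^ 3 / ‖s‖ := by
  set g : ℕ → ℂ := fun n => (Λ n : ℂ) * siftChar z χ n with hg
  have hs' : 1 < s.re := by linarith
  have hs1 : 1 ≤ ‖s‖ := hs'.le.trans ((le_abs_self _).trans (Complex.abs_re_le_norm s))
  have hs0 : s ≠ 0 := by rintro rfl; simp at hs; linarith
  have hgn : ∀ n : ℕ, ‖g n‖ ≤ Real.log n := fun n => by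
    rw [hg, norm_mul, Complex.norm_real, Real.norm_of_nonneg ArithmeticFunction.vonMangoldt_nonneg]
    calc Λ n * _ ≤ Λ n * 1 := by
          gcongr
          exact (siftChar z χ).norm_le_one n
      _ ≤ Real.log n := by rw [mul_one]; exact ArithmeticFunction.vonMangoldt_le_log
  have hsp : Subpoly g := subpoly_vonMangoldt_mul_siftChar z χ
  have hlog : ∀ n : ℕ, 1 ≤ n → ∀ k : ℕ, Real.log n ^ k ≤ (k / (η / 2)) ^ k * (n:ℝ) ^ (η / 2) :=
    fun n hn k => log_pow_le (by exact_mod_cast hn) (half_pos hη) k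
  have b0 : ‖LSeries g s‖ ≤ 4 * (2 / η) / (η / 2) :=
    norm_LSeries_le (half_pos hη) (by linarith) (fun n hn => (hgn n).trans
      (by
        have := hlog n hn 1
        rwa [pow_one, pow_one, Nat.cast_one, one_div_div] at this)) (by linarith)
  have b1 : ‖LSeries (LSeries.logMul g) s‖ ≤ 4 * (16 / η ^ 2) / (η / 2) := by
    refine norm_LSeries_le (half_pos hη) (by linarith) (fun n hn => ?_) (by linarith)
    have h0 := Real.log_natCast_nonneg n
    rw [LSeries.logMul, norm_mul, ← Complex.ofReal_natCast, ← Complex.ofReal_log (Nat.cast_nonneg n),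
      Complex.norm_real, Real.norm_of_nonneg h0]
    calc Real.log n * ‖g n‖ ≤ Real.log n ^ 2 := by rw [sq]; gcongr; exact hgn n
      _ ≤ _ := hlog n hn 2
      _ = _ := by push_cast; congr 1; field_simp; norm_num
  have habs : LSeries.abscissaOfAbsConv g < s.re := by
    have h : LSeriesSummable g ((1 + η / 2 : ℝ) : ℂ) := by
      have := DirichletCharacter.LSeriesSummable_twist_vonMangoldt (siftChar z χ)
        (s := ((1 + η / 2 : ℝ) : ℂ)) (by rw [Complex.ofReal_re]; linarith)
      convert this using 1
      ext n
      simp [hg, mul_comm]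
    refine h.abscissaOfAbsConv_le.trans_lt ?_
    rw [Complex.ofReal_re]
    exact_mod_cast (show 1 + η / 2 < s.re by linarith)
  have d1 := (slowGrowth_roughPsi z χ).hasDerivAt_mel hs'
  have d2 := ((LSeries_hasDerivAt habs).div (hasDerivAt_id s) hs0).congr_of_eventuallyEq
    (f₁ := mel (roughPsi z χ)) (by
      have : ∀ᶠ w in nhds s, 1 < w.re :=
        Complex.continuous_re.continuousAt.eventually (eventually_gt_nhds hs')
      filter_upwards [this] with w hw
      have hw0 : w ≠ 0 := by rintro rfl; simp at hw; linarith
      simp only [Pi.div_apply, id]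
      rw [hsp.lseries_eq hw, mul_div_cancel_left₀ _ hw0]
      rfl)
  have e := d1.unique d2
  rw [neg_eq_iff_eq_neg] at e
  have e2 : mel (logMul (roughPsi z χ)) s = LSeries (LSeries.logMul g) s / s + LSeries g s / s / s := by
    rw [e]; simp only [id]; field_simp; ring
  have h16 : 16 / η ^ 2 ≤ 16 * (1 / η) ^ 3 := by
    rw [div_pow, one_pow, mul_one_div]
    exact div_le_div_of_nonneg_left (by norm_num) (by positivity)
      (pow_le_pow_of_le_one hη.le hη1 (by norm_num))
  calc _ ≤ ‖LSeries (LSeries.logMul g) s‖ / ‖s‖ + ‖LSeries g s‖ / ‖s‖ / ‖s‖ := by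
        rw [e2, ← norm_div, ← norm_div, ← norm_div]; exact norm_add_le _ _
    _ ≤ (128 * (1 / η) ^ 3) / ‖s‖ + (16 * (1 / η) ^ 3) / ‖s‖ / 1 := by
        gcongr
        · exact b1.trans (le_of_eq (by field_simp; norm_num))
        · exact b0.trans (le_trans (le_of_eq (by field_simp; norm_num)) h16)
    _ = _ := by ring

end Formulas

end PretentiousSieve

namespace PretentiousSieve

open MeasureTheory Set Filter Topology
open scoped ArithmeticFunction.vonMangoldt

theorem SlowGrowth.integrableOn_norm_sq {A : ℝ → ℂ} (hA : SlowGrowth A) {σ : ℝ} (hσ : 1 < σ) :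
    IntegrableOn (fun y : ℝ => ‖A y‖ ^ 2 * y ^ (-2 * σ - 1)) (Ioi 0) := by
  obtain ⟨C, hC⟩ := hA.bound ((1 + σ) / 2) (by linarith)
  have h1 : IntegrableOn (fun y : ℝ => C ^ 2 * y ^ (-σ)) (Ioi 1) :=
    (integrableOn_Ioi_rpow_of_lt (by linarith) one_pos).const_mul _
  have h2 : IntegrableOn (fun y : ℝ => ‖A y‖ ^ 2 * y ^ (-2 * σ - 1)) (Ioi 1) := by
    refine h1.mono' ?_ ?_
    · exact ((hA.meas.norm.pow_const 2).mul (by fun_prop)).aestronglyMeasurable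
    · refine (ae_restrict_iff' measurableSet_Ioi).2 (.of_forall fun y hy => ?_)
      have hy' : (1:ℝ) < y := hy
      have hy0 : 0 < y := by linarith
      rw [Real.norm_of_nonneg (by positivity)]
      calc _ ≤ (C * y ^ ((1 + σ) / 2)) ^ 2 * y ^ (-2 * σ - 1) := by
            gcongr
            exact hC y hy'.le
        _ = C ^ 2 * (y ^ (1 + σ) * y ^ (-2 * σ - 1)) := by
            rw [mul_pow, ← Real.rpow_mul_natCast hy0.le, mul_assoc]
            congr 3
            push_cast; ring
        _ = _ := by rw [← Real.rpow_add hy0]; ring_nf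
  have h3 : IntegrableOn (fun y : ℝ => ‖A y‖ ^ 2 * y ^ (-2 * σ - 1)) (Iio 1) := by
    refine integrableOn_zero.congr_fun (fun y hy => ?_) measurableSet_Iio
    simp [hA.zero y hy]
  have h4 : IntegrableOn (fun y : ℝ => ‖A y‖ ^ 2 * y ^ (-2 * σ - 1)) (Ici 1) :=
    (integrableOn_Ici_iff_integrableOn_Ioi (by finiteness)).2 h2
  refine (h3.union h4).mono_set fun y _ => ?_
  exact (lt_or_ge y 1).imp id id

theorem sum_integral_norm_sq_eq {ι : Type*} (S : Finset ι) {A : ι → ℝ → ℂ}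
    (hA : ∀ i, SlowGrowth (A i)) {σ : ℝ} (hσ : 1 < σ) :
    ∑ i ∈ S, ∫ t : ℝ, ‖mel (A i) (σ + t * Complex.I)‖ ^ 2 =
      2 * Real.pi * ∫ y in Ioi (0:ℝ), (∑ i ∈ S, ‖A i y‖ ^ 2) * y ^ (-2 * σ - 1) := by
  simp_rw [Finset.sum_mul]
  rw [integral_finsetSum _ fun i _ => (hA i).integrableOn_norm_sq hσ, Finset.mul_sum]
  exact Finset.sum_congr rfl fun i _ => ((hA i).mel_plancherel hσ).2

theorem sum_integral_mel_twisted_le (k : ℕ) : ∃ C : ℝ, 0 ≤ C ∧ ∀ (q : ℕ) (Q z : ℝ), Regime q Q z →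
    ∀ S : Finset (DirichletCharacter ℂ q), 1 ∉ S → ∀ σ : ℝ, 1 < σ →
      Real.log z * ∑ χ ∈ S, ∫ t : ℝ, ‖mel (logMul^[k] (psum (twisted z χ 0))) (σ + t * Complex.I)‖ ^ 2 ≤
        C * Real.log z ^ (2 * k) := by
  obtain ⟨C, hC, H⟩ := sum_norm_sq_psum_twisted_le
  refine ⟨2 * Real.pi * C ^ 2 * ((64 * k) ^ (2 * k) * 16), by positivity, fun q Q z hR S hS σ hσ => ?_⟩
  have hl := hR.one_le_log_z
  have hl0 : 0 < Real.log z := by linarith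
  have hβ := hR.saving_pos
  have hA := fun χ : DirichletCharacter ℂ q => slowGrowth_psum_twisted z χ 0
  rw [sum_integral_norm_sq_eq S (fun χ => (hA χ).iterate k) hσ]
  have hzero : ∀ y < (1:ℝ), (∑ χ ∈ S, ‖logMul^[k] (psum (twisted z χ 0)) y‖ ^ 2) * y ^ (-2 * σ - 1) = 0 := by
    intro y hy
    rw [Finset.sum_eq_zero, zero_mul]
    intro χ _
    rw [((hA χ).iterate k).zero y hy]; simp
  rw [setIntegral_Ioi_zero_eq hzero]
  obtain ⟨i1, i2⟩ := integrableOn_log_pow (show 0 < 2 * saving z by linarith) (2 * k)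
  have hInt : IntegrableOn (fun y => (∑ χ ∈ S, ‖logMul^[k] (psum (twisted z χ 0)) y‖ ^ 2) *
      y ^ (-2 * σ - 1)) (Ioi 1) := by
    simp_rw [Finset.sum_mul]
    exact integrable_finsetSum _ fun χ _ => (((hA χ).iterate k).integrableOn_norm_sq hσ).mono_set
      (Ioi_subset_Ioi zero_le_one)
  have hle : ∫ y in Ioi (1:ℝ), (∑ χ ∈ S, ‖logMul^[k] (psum (twisted z χ 0)) y‖ ^ 2) * y ^ (-2 * σ - 1) ≤
      (C / Real.log z) ^ 2 * ((2 * (2 * k : ℕ) / (2 * saving z)) ^ (2 * k) * (2 / (2 * saving z))) := by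
    refine le_trans ?_ (mul_le_mul_of_nonneg_left i2 (by positivity))
    rw [← integral_const_mul]
    refine setIntegral_mono_on hInt (i1.const_mul _) measurableSet_Ioi fun y hy => ?_
    have hy' : (1:ℝ) < y := hy
    have hy0 : 0 < y := by linarith
    have hly := Real.log_nonneg hy'.le
    have e1 : ∑ χ ∈ S, ‖logMul^[k] (psum (twisted z χ 0)) y‖ ^ 2 =
        Real.log y ^ (2 * k) * ∑ χ ∈ S, ‖psum (twisted z χ 0) y‖ ^ 2 := by
      rw [Finset.mul_sum]
      refine Finset.sum_congr rfl fun χ _ => ?_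
      rw [logMul_iterate, norm_mul, norm_pow, Complex.norm_real, Real.norm_of_nonneg hly, mul_pow,
        ← pow_mul, mul_comm k]
    rw [e1]
    calc _ ≤ Real.log y ^ (2 * k) * (C * (y ^ (1 - saving z) / Real.log z)) ^ 2 * y ^ (-3:ℝ) := by
          gcongr
          · exact H q Q z hR S hS y hy'.le
          · exact hy'.le
          · linarith
      _ = (C / Real.log z) ^ 2 * (Real.log y ^ (2 * k) * ((y ^ (1 - saving z)) ^ 2 * y ^ (-3:ℝ))) := by
          field_simp
      _ = _ := by
          rw [← Real.rpow_mul_natCast hy0.le, ← Real.rpow_add hy0]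
          congr 3
          push_cast; ring
  have hs : 1 / saving z = 16 * Real.log z := by unfold saving; field_simp
  calc _ ≤ Real.log z * (2 * Real.pi * ((C / Real.log z) ^ 2 *
        ((2 * (2 * k : ℕ) / (2 * saving z)) ^ (2 * k) * (2 / (2 * saving z))))) := by gcongr
    _ = Real.log z * (2 * Real.pi * ((C / Real.log z) ^ 2 *
        ((2 * k * (1 / saving z)) ^ (2 * k) * (1 / saving z)))) := by
        congr 4
        · push_cast; field_simp
        · field_simp
    _ ≤ 2 * Real.pi * C ^ 2 * ((64 * k) ^ (2 * k) * 16) * Real.log z ^ (2 * k) := by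
        rw [hs]
        have : Real.log z * (2 * Real.pi * ((C / Real.log z) ^ 2 *
          ((2 * k * (16 * Real.log z)) ^ (2 * k) * (16 * Real.log z)))) =
          2 * Real.pi * C ^ 2 * ((32 * k) ^ (2 * k) * 16) * Real.log z ^ (2 * k) := by
          rw [show 2 * (k:ℝ) * (16 * Real.log z) = (32 * k) * Real.log z by ring, mul_pow (32 * (k:ℝ))]
          field_simp
        rw [this]
        gcongr
        norm_num

theorem integral_inv_one_add_div_sq {T : ℝ} (hT : 0 < T) :
    Integrable (fun t : ℝ => (1 + (t / T) ^ 2)⁻¹) ∧ ∫ t : ℝ, (1 + (t / T) ^ 2)⁻¹ = T * Real.pi := by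
  constructor
  · exact integrable_inv_one_add_sq.comp_div hT.ne'
  · rw [Measure.integral_comp_div (fun u : ℝ => (1 + u ^ 2)⁻¹) T, integral_univ_inv_one_add_sq,
      abs_of_pos hT, smul_eq_mul]

theorem card_characters_le {q : ℕ} (hq : 0 < q) (S : Finset (DirichletCharacter ℂ q)) : S.card ≤ q := by
  have : NeZero q := ⟨hq.ne'⟩
  have := Fintype.ofFinite (DirichletCharacter ℂ q)
  refine (Finset.card_le_univ S).trans ?_
  rw [← Nat.card_eq_fintype_card, DirichletCharacter.card_eq_totient_of_hasEnoughRootsOfUnity]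
  exact Nat.totient_le q

theorem sum_integral_mel_roughPsi_le : ∃ C K : ℝ, 0 ≤ C ∧ 1 ≤ K ∧ ∀ (q : ℕ) (Q z : ℝ), Regime q Q z →
    ∃ χ₁ : DirichletCharacter ℂ q, ∀ S : Finset (DirichletCharacter ℂ q), 1 ∉ S → χ₁ ∉ S →
      ∀ η : ℝ, 0 < η → η ≤ 1 / (K * Real.log z) → q * (1 / η) ^ 6 ≤ Q ^ 6 →
        ∑ χ ∈ S, ∫ t : ℝ, ‖mel (logMul (roughPsi z χ)) (((1 + η : ℝ) : ℂ) + t * Complex.I)‖ ^ 2 ≤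
          C * Real.log z ^ 3 := by
  obtain ⟨c₀, K, hc₀, hK, H⟩ := exists_exceptional
  obtain ⟨C₁, hC₁, H₁⟩ := norm_siftL_le
  obtain ⟨D0, hD0, E0⟩ := sum_integral_mel_twisted_le 0
  obtain ⟨D1, hD1, E1⟩ := sum_integral_mel_twisted_le 1
  obtain ⟨D2, hD2, E2⟩ := sum_integral_mel_twisted_le 2
  set c := min c₀ 1 with hc
  have hc0 : 0 < c := lt_min hc₀ one_pos
  have hc1 : c ≤ 1 := min_le_right _ _
  set B := 4 * C₁ / c ^ 2 with hB
  refine ⟨3 * B ^ 2 * (D0 + D1 + D2) + 2 * 144 ^ 2 * Real.pi, K, by positivity, hK,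
    fun q Q z hR => ?_⟩
  obtain ⟨χ₁, hχ₁⟩ := H q Q z hR
  refine ⟨χ₁, fun S hS1 hSχ η hη hηK hηQ => ?_⟩
  have hz : 0 ≤ z := by linarith [hR.two_le_z]
  have hl := hR.one_le_log_z
  have hl0 : 0 < Real.log z := by linarith
  have hη1 : η ≤ 1 := hηK.trans (by
    rw [div_le_one (by positivity)]; exact one_le_mul_of_one_le_of_one_le hK hl)
  have hQ0 : 0 < Q := by linarith [hR.two_le]
  set T := Q ^ 6 with hT
  have hT0 : 0 < T := by positivity
  set σ : ℝ := 1 + η with hσ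
  have hσ1 : 1 < σ := by linarith
  set h : ℕ → DirichletCharacter ℂ q → ℝ → ℝ := fun k χ t =>
    ‖mel (logMul^[k] (psum (twisted z χ 0))) ((σ : ℂ) + t * Complex.I)‖ ^ 2 with hh
  have hInt : ∀ k χ, Integrable (h k χ) := fun k χ =>
    (((slowGrowth_psum_twisted z χ 0).iterate k).mel_plancherel hσ1).1
  obtain ⟨iT, eT⟩ := integral_inv_one_add_div_sq hT0
  set P := 2 * (144 * (1 / η) ^ 3) ^ 2 / T ^ 2 with hP
  have hP0 : 0 ≤ P := by positivity
  have hpt : ∀ χ ∈ S, ∀ t : ℝ, ‖mel (logMul (roughPsi z χ)) ((σ : ℂ) + t * Complex.I)‖ ^ 2 ≤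
      3 * B ^ 2 * (Real.log z ^ 2 * h 0 χ t + Real.log z ^ 2 * h 1 χ t + h 2 χ t) +
        P * (1 + (t / T) ^ 2)⁻¹ := by
    intro χ hχ t
    have hre : ((σ : ℂ) + t * Complex.I).re = σ := by simp
    rcases le_or_gt |t| T with ht | ht
    · have hχ1 : χ ≠ 1 := fun e => hS1 (e ▸ hχ)
      have hχ2 : χ ≠ χ₁ := fun e => hSχ (e ▸ hχ)
      have h1 := norm_mel_logMul_roughPsi_le hR.pos hz χ (s := (σ : ℂ) + t * Complex.I)
        (by rw [hre]; exact hσ1) hc0 hc1 hC₁ hl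
        ((min_le_left _ _).trans (hχ₁ χ hχ1 hχ2 t ht σ hσ1 (by linarith)))
        (H₁ q Q z hR χ hχ1 t (by linarith) σ hσ1 (by linarith)).2
      have h2 : ∀ a b d : ℝ, (a + b + d) ^ 2 ≤ 3 * (a ^ 2 + b ^ 2 + d ^ 2) := fun a b d => by
        nlinarith [sq_nonneg (a - b), sq_nonneg (b - d), sq_nonneg (a - d)]
      refine le_add_of_le_of_nonneg ((pow_le_pow_left₀ (norm_nonneg _) h1 2).trans ?_) (by positivity)
      rw [mul_pow]
      refine (mul_le_mul_of_nonneg_left (h2 _ _ _) (by positivity)).trans (le_of_eq ?_)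
      simp only [hh]
      ring
    · have h1 := norm_mel_logMul_roughPsi_le_div (z := z) χ hη hη1 (s := (σ : ℂ) + t * Complex.I)
        (by rw [hre])
      have h2 : |t| ≤ ‖(σ : ℂ) + t * Complex.I‖ := by
        have := Complex.abs_im_le_norm ((σ : ℂ) + t * Complex.I)
        simpa using this
      have ht0 : 0 < |t| := hT0.trans ht
      refine le_add_of_nonneg_of_le (by positivity) ?_
      calc _ ≤ (144 * (1 / η) ^ 3 / |t|) ^ 2 := by
            refine pow_le_pow_left₀ (norm_nonneg _) (h1.trans ?_) 2
            gcongr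
        _ = (144 * (1 / η) ^ 3) ^ 2 * (1 / t ^ 2) := by rw [div_pow, sq_abs]; ring
        _ ≤ (144 * (1 / η) ^ 3) ^ 2 * (2 / (T ^ 2 + t ^ 2)) := by
            have : T ^ 2 ≤ t ^ 2 := by rw [← sq_abs t]; gcongr
            have : 0 < t ^ 2 := (pow_pos hT0 2).trans_le this
            gcongr ?_ * ?_
            rw [div_le_div_iff₀ (by positivity) (by positivity)]
            linarith
        _ = _ := by rw [hP]; field_simp
  have hsum : ∀ k, ∑ χ ∈ S, ∫ t, h k χ t = ∑ χ ∈ S, ∫ t : ℝ,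
    ‖mel (logMul^[k] (psum (twisted z χ 0))) ((σ : ℂ) + t * Complex.I)‖ ^ 2 := fun k => rfl
  have F0 := E0 q Q z hR S hS1 σ hσ1
  have F1 := E1 q Q z hR S hS1 σ hσ1
  have F2 := E2 q Q z hR S hS1 σ hσ1
  rw [← hsum] at F0 F1 F2
  have hI : ∀ χ ∈ S, ∫ t : ℝ, ‖mel (logMul (roughPsi z χ)) ((σ : ℂ) + t * Complex.I)‖ ^ 2 ≤
      3 * B ^ 2 * (Real.log z ^ 2 * (∫ t, h 0 χ t) + Real.log z ^ 2 * (∫ t, h 1 χ t) + ∫ t, h 2 χ t) +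
        P * (T * Real.pi) := by
    intro χ hχ
    have j0 := (hInt 0 χ).const_mul (Real.log z ^ 2)
    have j1 := (hInt 1 χ).const_mul (Real.log z ^ 2)
    have j2 := hInt 2 χ
    have := integral_mono (((slowGrowth_roughPsi z χ).mul_log).mel_plancherel hσ1).1
      ((((j0.add j1).add j2).const_mul (3 * B ^ 2)).add (iT.const_mul P)) (hpt χ hχ)
    refine this.trans (le_of_eq ?_)
    rw [integral_add' (((j0.add j1).add j2).const_mul (3 * B ^ 2)) (iT.const_mul P),
      integral_const_mul, integral_const_mul, eT, integral_add' (j0.add j1) j2, integral_add' j0 j1,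
      integral_const_mul, integral_const_mul]
  have hcard : (S.card : ℝ) ≤ q := by exact_mod_cast card_characters_le hR.pos S
  have hPT : S.card * (P * (T * Real.pi)) ≤ 2 * 144 ^ 2 * Real.pi * Real.log z ^ 3 := by
    calc S.card * (P * (T * Real.pi)) ≤ q * (P * (T * Real.pi)) := by gcongr
      _ = 2 * 144 ^ 2 * Real.pi * (q * (1 / η) ^ 6 / T) := by rw [hP]; field_simp
      _ ≤ 2 * 144 ^ 2 * Real.pi * 1 := by
          gcongr
          rw [div_le_one hT0]; exact hηQ
      _ ≤ _ := by
          gcongr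
          exact one_le_pow₀ hl
  refine (Finset.sum_le_sum hI).trans ?_
  rw [Finset.sum_add_distrib, ← Finset.mul_sum, Finset.sum_add_distrib, Finset.sum_add_distrib,
    ← Finset.mul_sum, ← Finset.mul_sum, Finset.sum_const, nsmul_eq_mul]
  have G0 : Real.log z ^ 2 * ∑ χ ∈ S, ∫ t, h 0 χ t ≤ D0 * Real.log z ^ 3 := by
    calc _ = Real.log z * (Real.log z * ∑ χ ∈ S, ∫ t, h 0 χ t) := by ring
      _ ≤ Real.log z * (D0 * Real.log z ^ (2 * 0)) := by gcongr
      _ = D0 * Real.log z ^ 1 := by ring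
      _ ≤ _ := by
          gcongr
          norm_num
  have G1 : Real.log z ^ 2 * ∑ χ ∈ S, ∫ t, h 1 χ t ≤ D1 * Real.log z ^ 3 := by
    calc _ = Real.log z * (Real.log z * ∑ χ ∈ S, ∫ t, h 1 χ t) := by ring
      _ ≤ Real.log z * (D1 * Real.log z ^ (2 * 1)) := by gcongr
      _ = _ := by ring
  have G2 : ∑ χ ∈ S, ∫ t, h 2 χ t ≤ D2 * Real.log z ^ 3 := by
    refine le_of_mul_le_mul_left (F2.trans (le_of_eq ?_)) hl0
    ring
  calc _ ≤ 3 * B ^ 2 * (D0 * Real.log z ^ 3 + D1 * Real.log z ^ 3 + D2 * Real.log z ^ 3) +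
        2 * 144 ^ 2 * Real.pi * Real.log z ^ 3 := by gcongr
    _ = _ := by ring

end PretentiousSieve

namespace PretentiousSieve

open MeasureTheory Set Filter Topology
open scoped ArithmeticFunction.vonMangoldt

section l2

variable {ι : Type*} (S : Finset ι)

/-- The `ℓ²` norm over the index set `S`. -/
noncomputable def l2 (v : ι → ℂ) : ℝ := ‖(WithLp.toLp 2 fun i : S => v i : EuclideanSpace ℂ S)‖

theorem l2_eq (v : ι → ℂ) : l2 S v = √(∑ i ∈ S, ‖v i‖ ^ 2) := by
  rw [l2, EuclideanSpace.norm_eq, ← Finset.sum_coe_sort S]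

theorem l2_nonneg (v : ι → ℂ) : 0 ≤ l2 S v := norm_nonneg _

theorem l2_sq (v : ι → ℂ) : l2 S v ^ 2 = ∑ i ∈ S, ‖v i‖ ^ 2 := by
  rw [l2_eq, Real.sq_sqrt (Finset.sum_nonneg fun _ _ => by positivity)]

variable {S}

theorem l2_le {v : ι → ℂ} {B : ℝ} (hB : 0 ≤ B) (h : ∑ i ∈ S, ‖v i‖ ^ 2 ≤ B ^ 2) : l2 S v ≤ B := by
  rw [l2_eq]; exact Real.sqrt_le_iff.2 ⟨hB, h⟩

theorem l2_add_le (v w : ι → ℂ) : l2 S (fun i => v i + w i) ≤ l2 S v + l2 S w :=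
  norm_add_le (WithLp.toLp 2 fun i : S => v i : EuclideanSpace ℂ S) (WithLp.toLp 2 fun i : S => w i)

theorem l2_sub_le (v w : ι → ℂ) : l2 S (fun i => v i - w i) ≤ l2 S v + l2 S w :=
  norm_sub_le (WithLp.toLp 2 fun i : S => v i : EuclideanSpace ℂ S) (WithLp.toLp 2 fun i : S => w i)

theorem l2_sum_le {κ : Type*} (s : Finset κ) (v : κ → ι → ℂ) :
    l2 S (fun i => ∑ k ∈ s, v k i) ≤ ∑ k ∈ s, l2 S (v k) := by
  classical
  induction s using Finset.induction_on with
  | empty => simp [l2_eq]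
  | insert k s hk ih =>
    rw [Finset.sum_insert hk]
    simp_rw [Finset.sum_insert hk]
    exact (l2_add_le _ _).trans (by gcongr)

theorem l2_mul_le {c v : ι → ℂ} {M : ℝ} (hM : 0 ≤ M) (hc : ∀ i, ‖c i‖ ≤ M) :
    l2 S (fun i => c i * v i) ≤ M * l2 S v := by
  refine l2_le (mul_nonneg hM (l2_nonneg _ _)) ?_
  rw [mul_pow, l2_sq, Finset.mul_sum]
  refine Finset.sum_le_sum fun i _ => ?_
  rw [norm_mul, mul_pow]
  gcongr
  exact hc i

theorem l2_const_mul (c : ℂ) (v : ι → ℂ) : l2 S (fun i => c * v i) = ‖c‖ * l2 S v :=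
  norm_smul c (WithLp.toLp 2 fun i : S => v i : EuclideanSpace ℂ S)

end l2

theorem integrableOn_one_div_mul_log_sq {z : ℝ} (hz : 1 < z) :
    IntegrableOn (fun u : ℝ => 1 / (u * Real.log u ^ 2)) (Ioi z) ∧
    ∫ u in Ioi z, 1 / (u * Real.log u ^ 2) = 1 / Real.log z := by
  have hd : ∀ u ∈ Ici z, HasDerivAt (fun u : ℝ => -(Real.log u)⁻¹) (1 / (u * Real.log u ^ 2)) u := by
    intro u hu
    have hu' : 1 < u := hz.trans_le hu
    have hl := Real.log_pos hu'
    refine ((Real.hasDerivAt_log (by linarith : u ≠ 0)).inv hl.ne').neg.congr_deriv ?_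
    field_simp
  have hpos : ∀ u ∈ Ioi z, 0 ≤ 1 / (u * Real.log u ^ 2) := by
    intro u hu
    have : 0 < u := by have : z < u := hu; linarith
    positivity
  have hlim : Tendsto (fun u : ℝ => -(Real.log u)⁻¹) atTop (𝓝 0) := by
    simpa using (tendsto_inv_atTop_zero.comp Real.tendsto_log_atTop).neg
  refine ⟨integrableOn_Ioi_deriv_of_nonneg' hd hpos hlim, ?_⟩
  rw [integral_Ioi_of_hasDerivAt_of_nonneg' hd hpos hlim]
  simp

theorem measurable_l2_roughPsi {q : ℕ} (z : ℝ) (S : Finset (DirichletCharacter ℂ q)) :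
    Measurable fun u : ℝ => l2 S fun χ => roughPsi z χ u := by
  simp_rw [l2_eq]
  exact (Finset.measurable_fun_sum _ fun χ _ => ((slowGrowth_roughPsi z χ).meas.norm.pow_const 2)).sqrt

theorem integral_l2_roughPsi_le : ∃ C K : ℝ, 0 ≤ C ∧ 1 ≤ K ∧ ∀ (q : ℕ) (Q z : ℝ), Regime q Q z →
    ∃ χ₁ : DirichletCharacter ℂ q, ∀ S : Finset (DirichletCharacter ℂ q), 1 ∉ S → χ₁ ∉ S →
      ∀ x : ℝ, 2 ≤ x → K * Real.log z ≤ Real.log x → q * Real.log x ^ 6 ≤ Q ^ 6 →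
        IntegrableOn (fun u => (l2 S fun χ => roughPsi z χ u) / u ^ 2) (Ioc z (2 * x)) ∧
        ∫ u in Ioc z (2 * x), (l2 S fun χ => roughPsi z χ u) / u ^ 2 ≤ C * Real.log z := by
  obtain ⟨C, K, hC, hK, H⟩ := sum_integral_mel_roughPsi_le
  refine ⟨Real.exp 4 * C + 1, K, by positivity, hK, fun q Q z hR => ?_⟩
  obtain ⟨χ₁, hχ₁⟩ := H q Q z hR
  refine ⟨χ₁, fun S hS1 hSχ x hx hKx hqx => ?_⟩
  have hz := hR.two_le_z
  have hl := hR.one_le_log_z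
  set l := Real.log z with hl_def
  have hl0 : 0 < l := by linarith
  have hX : 0 < Real.log x := lt_of_lt_of_le (by positivity) hKx
  set η := 1 / Real.log x with hη
  have hη0 : 0 < η := by positivity
  have h1 := hχ₁ S hS1 hSχ η hη0 (one_div_le_one_div_of_le (by positivity) hKx)
    (by rwa [hη, one_div_one_div])
  have hσ : 1 < 1 + η := by linarith
  rw [sum_integral_norm_sq_eq S (fun χ => (slowGrowth_roughPsi z χ).mul_log) hσ] at h1
  set V : ℝ → ℝ := fun y => (∑ χ ∈ S, ‖logMul (roughPsi z χ) y‖ ^ 2) * y ^ (-2 * (1 + η) - 1) with hV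
  have hVint : IntegrableOn V (Ioi 0) := by
    simp_rw [hV, Finset.sum_mul]
    exact integrable_finsetSum _ fun χ _ => (slowGrowth_roughPsi z χ).mul_log.integrableOn_norm_sq hσ
  have hV0 : ∀ y ∈ Ioi (0:ℝ), 0 ≤ V y := by
    intro y hy
    have : (0:ℝ) < y := hy
    simp only [hV]
    positivity
  obtain ⟨iw, ew⟩ := integrableOn_one_div_mul_log_sq (show 1 < z by linarith)
  have hsub0 : Ioc z (2 * x) ⊆ Ioi 0 := fun u hu => mem_Ioi.2 (by linarith [hu.1])
  have hsub : Ioc z (2 * x) ⊆ Ioi z := fun u hu => hu.1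
  set N : ℝ → ℝ := fun u => l2 S fun χ => roughPsi z χ u with hN
  have hpt : ∀ u ∈ Ioc z (2 * x), N u / u ^ 2 ≤
      Real.exp 4 / (2 * l ^ 2) * V u + l ^ 2 / 2 * (1 / (u * Real.log u ^ 2)) := by
    rintro u ⟨hu1, hu2⟩
    have hu0 : 0 < u := by linarith
    have hlu : 0 < Real.log u := Real.log_pos (by linarith)
    have e1 : ∑ χ ∈ S, ‖logMul (roughPsi z χ) u‖ ^ 2 = Real.log u ^ 2 * N u ^ 2 := by
      rw [hN, l2_sq, Finset.mul_sum]
      refine Finset.sum_congr rfl fun χ _ => ?_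
      rw [logMul, norm_mul, mul_pow, Complex.norm_real, Real.norm_of_nonneg hlu.le]
    have e2 : u ^ (-(3:ℝ)) ≤ Real.exp 4 * u ^ (-2 * (1 + η) - 1) := by
      have h2 : Real.log u ≤ 2 * Real.log x := by
        calc Real.log u ≤ Real.log (2 * x) := Real.log_le_log hu0 hu2
          _ ≤ Real.log (x * x) := Real.log_le_log (by linarith) (by nlinarith)
          _ = _ := by rw [Real.log_mul (by linarith) (by linarith)]; ring
      have h3 : η * Real.log u ≤ 2 := by
        rw [hη, div_mul_eq_mul_div, one_mul, div_le_iff₀ hX]; exact h2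
      rw [Real.rpow_def_of_pos hu0, Real.rpow_def_of_pos hu0, ← Real.exp_add]
      refine Real.exp_le_exp.2 ?_
      nlinarith
    have e3 : Real.log u ^ 2 * N u ^ 2 / u ^ 3 ≤ Real.exp 4 * V u := by
      simp only [hV]
      rw [e1]
      have : u ^ (-(3:ℝ)) = 1 / u ^ 3 := by
        rw [Real.rpow_neg hu0.le, one_div]; norm_cast
      rw [this] at e2
      calc Real.log u ^ 2 * N u ^ 2 / u ^ 3 = Real.log u ^ 2 * N u ^ 2 * (1 / u ^ 3) := by ring
        _ ≤ Real.log u ^ 2 * N u ^ 2 * (Real.exp 4 * u ^ (-2 * (1 + η) - 1)) := by gcongr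
        _ = _ := by ring
    have e4 : N u / u ^ 2 ≤ 1 / (2 * l ^ 2) * (Real.log u ^ 2 * N u ^ 2 / u ^ 3) +
        l ^ 2 / 2 * (1 / (u * Real.log u ^ 2)) := by
      have e5 : 1 / (2 * l ^ 2) * (Real.log u ^ 2 * N u ^ 2 / u ^ 3) +
          l ^ 2 / 2 * (1 / (u * Real.log u ^ 2)) - N u / u ^ 2 =
          (1 - N u * Real.log u ^ 2 / (l ^ 2 * u)) ^ 2 * (l ^ 2 / (2 * u * Real.log u ^ 2)) := by
        field_simp
        ring
      have : 0 ≤ (1 - N u * Real.log u ^ 2 / (l ^ 2 * u)) ^ 2 * (l ^ 2 / (2 * u * Real.log u ^ 2)) := by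
        positivity
      linarith
    calc _ ≤ _ := e4
      _ ≤ 1 / (2 * l ^ 2) * (Real.exp 4 * V u) + l ^ 2 / 2 * (1 / (u * Real.log u ^ 2)) := by gcongr
      _ = _ := by ring
  have imaj : IntegrableOn (fun u => Real.exp 4 / (2 * l ^ 2) * V u +
      l ^ 2 / 2 * (1 / (u * Real.log u ^ 2))) (Ioc z (2 * x)) :=
    ((hVint.mono_set hsub0).const_mul _).add ((iw.mono_set hsub).const_mul _)
  have iN : IntegrableOn (fun u => N u / u ^ 2) (Ioc z (2 * x)) := by
    refine imaj.mono' ?_ ?_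
    · exact ((measurable_l2_roughPsi z S).div (by fun_prop)).aestronglyMeasurable
    · refine (ae_restrict_iff' measurableSet_Ioc).2 (.of_forall fun u hu => ?_)
      rw [Real.norm_of_nonneg (div_nonneg (l2_nonneg _ _) (sq_nonneg u))]
      exact hpt u hu
  refine ⟨iN, (setIntegral_mono_on iN imaj measurableSet_Ioc hpt).trans ?_⟩
  rw [integral_add ((hVint.mono_set hsub0).const_mul _) ((iw.mono_set hsub).const_mul _),
    integral_const_mul, integral_const_mul]
  have j1 : ∫ u in Ioc z (2 * x), V u ≤ C * l ^ 3 := by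
    have hle : ∫ u in Ioc z (2 * x), V u ≤ ∫ u in Ioi 0, V u :=
      setIntegral_mono_set hVint ((ae_restrict_iff' measurableSet_Ioi).2 (.of_forall hV0))
        hsub0.eventuallyLE
    have hnn : 0 ≤ ∫ u in Ioi 0, V u := setIntegral_nonneg measurableSet_Ioi hV0
    have hpi : 1 ≤ 2 * Real.pi := by linarith [Real.two_le_pi]
    exact hle.trans ((le_mul_of_one_le_left hnn hpi).trans h1)
  have j2 : ∫ u in Ioc z (2 * x), 1 / (u * Real.log u ^ 2) ≤ 1 / l := by
    rw [← ew]
    refine setIntegral_mono_set iw ((ae_restrict_iff' measurableSet_Ioi).2 (.of_forall ?_))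
      hsub.eventuallyLE
    intro u hu
    have : 0 < u := by have : z < u := hu; linarith
    simp only [Pi.zero_apply]
    positivity
  calc _ ≤ Real.exp 4 / (2 * l ^ 2) * (C * l ^ 3) + l ^ 2 / 2 * (1 / l) := by gcongr
    _ = (Real.exp 4 * C + 1) * l / 2 := by field_simp
    _ ≤ _ := by
      have : 0 ≤ (Real.exp 4 * C + 1) * l := by positivity
      linarith

end PretentiousSieve

namespace PretentiousSieve

open Finset
open scoped ArithmeticFunction.vonMangoldt ArithmeticFunction.Moebius

section partialSummation

theorem sum_mul_le_of_sum_le {c g : ℕ → ℝ} {E : ℝ} (hc : ∀ N, ∑ n ∈ Icc 1 N, c n ≤ E * N)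
    (hg : AntitoneOn g (Set.Ici 1)) (hg0 : ∀ n, 0 ≤ g n) (N : ℕ) :
    ∑ n ∈ Icc 1 N, c n * g n ≤ E * ∑ n ∈ Icc 1 N, g n := by
  have hd : ∀ N, ∑ n ∈ Icc 1 N, (c n - E) ≤ 0 := fun N => by
    rw [sum_sub_distrib, sum_const, Nat.card_Icc, nsmul_eq_mul, Nat.add_sub_cancel]
    linarith [hc N]
  have key : ∑ n ∈ Icc 1 N, (c n - E) * g n ≤ (∑ n ∈ Icc 1 N, (c n - E)) * g N := by
    induction N with
    | zero => simp
    | succ N ih =>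
      rw [sum_Icc_succ_top (by lia), sum_Icc_succ_top (by lia), add_mul]
      gcongr
      refine ih.trans ?_
      rcases N.eq_zero_or_pos with rfl | hN
      · simp
      · exact mul_le_mul_of_nonpos_left (hg hN (by simp) N.le_succ) (hd N)
  have h1 := key.trans (mul_nonpos_of_nonpos_of_nonneg (hd N) (hg0 N))
  simp_rw [sub_mul] at h1
  rw [sum_sub_distrib, ← mul_sum] at h1
  linarith

theorem sum_rpow_neg_le {γ : ℝ} (hγ0 : 0 ≤ γ) (hγ : γ < 1) (N : ℕ) :
    ∑ n ∈ Icc 1 N, (n:ℝ) ^ (-γ) ≤ (N:ℝ) ^ (1 - γ) / (1 - γ) := by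
  have hs : 0 < 1 - γ := by linarith
  induction N with
  | zero => simp [Real.zero_rpow hs.ne']
  | succ N ih =>
    rw [sum_Icc_succ_top (by lia)]
    refine (add_le_add_left ih _).trans ?_
    have hN : (0:ℝ) < (N:ℝ) + 1 := by positivity
    have h1 := rpow_one_add_le_one_add_mul_self (s := -1 / ((N:ℝ) + 1))
      (by rw [le_div_iff₀ hN]; linarith [(Nat.cast_nonneg N : (0:ℝ) ≤ N)]) hs.le (by linarith)
    have h2 : 1 + -1 / ((N:ℝ) + 1) = N / (N + 1) := by field_simp; ring
    rw [h2, Real.div_rpow (by positivity) hN.le, div_le_iff₀ (by positivity)] at h1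
    have h3 : ((N:ℝ) + 1) ^ (-γ) = (N + 1) ^ (1 - γ) / (N + 1) := by
      rw [← Real.rpow_sub_one hN.ne']; ring_nf
    push_cast
    rw [div_add' _ _ _ hs.ne', div_le_div_iff_of_pos_right hs, h3]
    refine (add_le_add_left h1 _).trans (le_of_eq ?_)
    ring

theorem sum_mul_div_rpow_le {c : ℕ → ℝ} {E : ℝ} (hE : 0 ≤ E)
    (hc : ∀ N, ∑ n ∈ Icc 1 N, c n ≤ E * N) {γ : ℝ} (hγ0 : 0 ≤ γ) (hγ : γ < 1) {x : ℝ} (hx : 0 < x) :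
    ∑ n ∈ Icc 1 ⌊x⌋₊, c n * (x / n) ^ γ ≤ E * x / (1 - γ) := by
  have hs : 0 < 1 - γ := by linarith
  have h1 := sum_mul_le_of_sum_le hc (g := fun n : ℕ => (n:ℝ) ^ (-γ)) (by
    intro a ha b _ hab
    have : (0:ℝ) < a := by exact_mod_cast (ha : 1 ≤ a)
    exact Real.rpow_le_rpow_of_nonpos this (by exact_mod_cast hab) (by linarith))
    (fun n => by positivity) ⌊x⌋₊
  have h2 : ∑ n ∈ Icc 1 ⌊x⌋₊, c n * (x / n) ^ γ = x ^ γ * ∑ n ∈ Icc 1 ⌊x⌋₊, c n * (n:ℝ) ^ (-γ) := by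
    rw [mul_sum]
    refine sum_congr rfl fun n _ => ?_
    rw [Real.div_rpow hx.le (by positivity), Real.rpow_neg (by positivity)]
    ring
  rw [h2]
  calc _ ≤ x ^ γ * (E * (x ^ (1 - γ) / (1 - γ))) := by
        gcongr
        refine h1.trans ?_
        gcongr
        refine (sum_rpow_neg_le hγ0 hγ _).trans ?_
        gcongr
        exact Nat.floor_le hx.le
    _ = E * (x ^ γ * x ^ (1 - γ)) / (1 - γ) := by ring
    _ = _ := by rw [← Real.rpow_add hx]; simp

theorem sum_div_le {c : ℕ → ℝ} {E : ℝ} (hE : 0 ≤ E)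
    (hc : ∀ N, ∑ n ∈ Icc 1 N, c n ≤ E * N) {x : ℝ} (hx : 1 ≤ x) :
    ∑ n ∈ Icc 1 ⌊x⌋₊, c n / n ≤ E * (1 + Real.log x) := by
  have h1 := sum_mul_le_of_sum_le hc (g := fun n : ℕ => (n:ℝ)⁻¹) (by
    intro a ha b _ hab
    have : (0:ℝ) < a := by exact_mod_cast (ha : 1 ≤ a)
    exact inv_anti₀ this (by exact_mod_cast hab)) (fun n => by positivity) ⌊x⌋₊
  have h2 := harmonic_floor_le_one_add_log x hx
  rw [harmonic_eq_sum_Icc] at h2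
  push_cast at h2
  simp_rw [div_eq_mul_inv]
  exact h1.trans (by gcongr)

theorem l2_sum_mul_le {ι : Type*} {S : Finset ι} {v : ℕ → ι → ℂ} {g : ℕ → ℝ} {B : ℝ} {N : ℕ}
    (hB : ∀ n ≤ N, l2 S (fun i => ∑ k ∈ Icc 1 n, v k i) ≤ B) (hg0 : ∀ n, 0 ≤ g n)
    (hg : MonotoneOn g (Set.Ici 1)) :
    l2 S (fun i => ∑ k ∈ Icc 1 N, (g k : ℂ) * v k i) ≤ 2 * (g N * B) := by
  have key : ∀ n ≤ N, l2 S (fun i => ∑ k ∈ Icc 1 n, (g k : ℂ) * v k i -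
      (g n : ℂ) * ∑ k ∈ Icc 1 n, v k i) ≤ g n * B := by
    intro n
    induction n with
    | zero =>
      intro h
      have := (l2_nonneg _ _).trans (hB 0 h)
      simpa [l2_eq] using mul_nonneg (hg0 0) this
    | succ n ih =>
      intro h
      rcases n.eq_zero_or_pos with rfl | hn
      · have := (l2_nonneg _ _).trans (hB 1 h)
        simpa [l2_eq] using mul_nonneg (hg0 1) this
      have h0 := hg (Set.mem_Ici.2 hn) (Set.mem_Ici.2 (by lia : 1 ≤ n + 1)) n.le_succ
      have e : (fun i => ∑ k ∈ Icc 1 (n + 1), (g k : ℂ) * v k i -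
          (g (n + 1) : ℂ) * ∑ k ∈ Icc 1 (n + 1), v k i) =
          fun i => (∑ k ∈ Icc 1 n, (g k : ℂ) * v k i - (g n : ℂ) * ∑ k ∈ Icc 1 n, v k i) -
            ((g (n + 1) - g n : ℝ) : ℂ) * ∑ k ∈ Icc 1 n, v k i := by
        funext i
        rw [sum_Icc_succ_top (by lia), sum_Icc_succ_top (by lia)]
        push_cast
        ring
      rw [e]
      refine (l2_sub_le _ _).trans ?_
      rw [l2_const_mul, Complex.norm_real, Real.norm_of_nonneg (by linarith)]
      have h1 := ih (by lia)
      have h2 := mul_le_mul_of_nonneg_left (hB n (by lia)) (by linarith : 0 ≤ g (n + 1) - g n)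
      linarith
  have e : (fun i => ∑ k ∈ Icc 1 N, (g k : ℂ) * v k i) = fun i =>
      (∑ k ∈ Icc 1 N, (g k : ℂ) * v k i - (g N : ℂ) * ∑ k ∈ Icc 1 N, v k i) +
        (g N : ℂ) * ∑ k ∈ Icc 1 N, v k i := by
    funext i; ring
  rw [e]
  refine (l2_add_le _ _).trans ?_
  rw [l2_const_mul, Complex.norm_real, Real.norm_of_nonneg (hg0 N)]
  have h1 := key N le_rfl
  have h2 := mul_le_mul_of_nonneg_left (hB N le_rfl) (hg0 N)
  linarith

end partialSummation

section identity

/-- The pointwise product of an arithmetic function with a sequence. -/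
noncomputable def twistBy (f : ℕ → ℂ) (F : ArithmeticFunction ℝ) : ArithmeticFunction ℂ :=
  ⟨fun n => (F n : ℂ) * f n, by simp⟩

theorem twistBy_apply (f : ℕ → ℂ) (F : ArithmeticFunction ℝ) (n : ℕ) :
    twistBy f F n = (F n : ℂ) * f n := rfl

theorem twistBy_mul {f : ℕ → ℂ} (hf : ∀ m n, f (m * n) = f m * f n) (F G : ArithmeticFunction ℝ) :
    twistBy f (F * G) = twistBy f F * twistBy f G := by
  ext n
  rw [twistBy_apply, ArithmeticFunction.mul_apply, ArithmeticFunction.mul_apply]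
  push_cast
  rw [sum_mul]
  refine sum_congr rfl fun p hp => ?_
  rw [← (Nat.mem_divisorsAntidiagonal.1 hp).1, hf, twistBy_apply, twistBy_apply]
  ring

theorem moebius_mul_log_sq :
    (μ : ArithmeticFunction ℝ) * ArithmeticFunction.log.pmul ArithmeticFunction.log =
      ArithmeticFunction.pmul Λ ArithmeticFunction.log + Λ * Λ := by
  have h : ArithmeticFunction.log.pmul ArithmeticFunction.log =
      (ArithmeticFunction.zeta : ArithmeticFunction ℝ) *
        (ArithmeticFunction.pmul Λ ArithmeticFunction.log + Λ * Λ) := by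
    have h1 : ArithmeticFunction.log.pmul ArithmeticFunction.log =
        ArithmeticFunction.pmul Λ ArithmeticFunction.log *
          (ArithmeticFunction.zeta : ArithmeticFunction ℝ) + Λ * ArithmeticFunction.log := by
      ext n
      rw [ArithmeticFunction.pmul_apply]
      nth_rw 1 [← ArithmeticFunction.vonMangoldt_mul_zeta]
      rw [ArithmeticFunction.add_apply, ArithmeticFunction.mul_apply, ArithmeticFunction.mul_apply,
        ArithmeticFunction.mul_apply, sum_mul, ← sum_add_distrib]
      refine sum_congr rfl fun p hp => ?_
      obtain ⟨hp1, hp2⟩ := Nat.mem_divisorsAntidiagonal.1 hp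
      rw [← hp1] at hp2 ⊢
      have ha : (p.1:ℝ) ≠ 0 := by exact_mod_cast left_ne_zero_of_mul hp2
      have hb : p.2 ≠ 0 := right_ne_zero_of_mul hp2
      rw [ArithmeticFunction.pmul_apply, ArithmeticFunction.natCoe_apply,
        ArithmeticFunction.zeta_apply_ne hb, ArithmeticFunction.log_apply,
        ArithmeticFunction.log_apply, ArithmeticFunction.log_apply, Nat.cast_mul,
        Real.log_mul ha (by exact_mod_cast hb)]
      push_cast
      ring
    rw [h1, ← ArithmeticFunction.vonMangoldt_mul_zeta]
    ring
  rw [h, ← mul_assoc, ArithmeticFunction.coe_moebius_mul_coe_zeta, one_mul]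

theorem sum_vonMangoldt_mul_log_eq {f : ℕ → ℂ} (hf : ∀ m n, f (m * n) = f m * f n) (x : ℝ) :
    ∑ n ∈ Icc 1 ⌊x⌋₊, ((Λ n * Real.log n : ℝ) : ℂ) * f n =
      ∑ a ∈ Icc 1 ⌊x⌋₊, ((μ a : ℂ) * f a) *
        ∑ n ∈ Icc 1 ⌊x / a⌋₊, ((Real.log n ^ 2 : ℝ) : ℂ) * f n -
      ∑ a ∈ Icc 1 ⌊x⌋₊, ((Λ a : ℂ) * f a) * psum (fun n => (Λ n : ℂ) * f n) (x / a) := by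
  have h1 := congrArg (fun F => ∑ n ∈ Ioc 0 ⌊x⌋₊, twistBy f F n) moebius_mul_log_sq
  have h2 : ∀ n, twistBy f (ArithmeticFunction.pmul Λ ArithmeticFunction.log + Λ * Λ) n =
      ((Λ n * Real.log n : ℝ) : ℂ) * f n + (twistBy f Λ * twistBy f Λ) n := by
    intro n
    rw [← twistBy_mul hf, twistBy_apply, twistBy_apply, ArithmeticFunction.add_apply,
      ArithmeticFunction.pmul_apply, ArithmeticFunction.log_apply]
    push_cast
    ring
  simp only [h2, sum_add_distrib] at h1
  rw [twistBy_mul hf, ArithmeticFunction.sum_Ioc_mul_eq_sum_sum,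
    ArithmeticFunction.sum_Ioc_mul_eq_sum_sum] at h1
  have hI : ∀ n, Ioc 0 n = Icc 1 n := fun n => rfl
  simp only [hI, twistBy_apply, ArithmeticFunction.pmul_apply, ArithmeticFunction.log_apply,
    ArithmeticFunction.intCoe_apply] at h1
  simp only [psum, Nat.floor_div_natCast]
  rw [eq_sub_iff_add_eq, ← h1]
  simp [sq]

end identity

end PretentiousSieve

namespace PretentiousSieve

open Finset
open scoped ArithmeticFunction.vonMangoldt ArithmeticFunction.Moebius

open Classical in
/-- The von Mangoldt function restricted to `z`-rough integers. -/
noncomputable def roughLambda (z : ℝ) (n : ℕ) : ℝ := if Rough z n then Λ n else 0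

theorem roughLambda_nonneg (z : ℝ) (n : ℕ) : 0 ≤ roughLambda z n := by
  unfold roughLambda; split_ifs <;> simp [ArithmeticFunction.vonMangoldt_nonneg]

theorem roughLambda_le (z : ℝ) (n : ℕ) : roughLambda z n ≤ Λ n := by
  unfold roughLambda; split_ifs <;> simp [ArithmeticFunction.vonMangoldt_nonneg]

theorem roughLambda_eq_zero {z : ℝ} {n : ℕ} (h : (n:ℝ) ≤ z) : roughLambda z n = 0 := by
  unfold roughLambda
  split_ifs with hr
  · rcases Nat.lt_or_ge 1 n with hn | hn
    · exact absurd (hr.lt hn) (not_lt.2 h)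
    · interval_cases n <;> simp
  · rfl

theorem vonMangoldt_mul_siftChar {q : ℕ} {z : ℝ} (hz : 0 ≤ z) (χ : DirichletCharacter ℂ q) (n : ℕ) :
    (Λ n : ℂ) * siftChar z χ n = (roughLambda z n : ℂ) * χ n := by
  classical
  rw [siftChar_apply hz, roughLambda]
  split_ifs <;> simp

theorem roughPsi_eq {q : ℕ} {z : ℝ} (hz : 0 ≤ z) (χ : DirichletCharacter ℂ q) (y : ℝ) :
    roughPsi z χ y = ∑ n ∈ Icc 1 ⌊y⌋₊, (roughLambda z n : ℂ) * χ n := by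
  simp_rw [roughPsi, psum, vonMangoldt_mul_siftChar hz]

theorem roughPsi_eq_zero {q : ℕ} {z : ℝ} (hz : 0 ≤ z) (χ : DirichletCharacter ℂ q) {y : ℝ}
    (hy : y ≤ z) : roughPsi z χ y = 0 := by
  rw [roughPsi_eq hz]
  refine sum_eq_zero fun n hn => ?_
  obtain ⟨h1, h2⟩ := mem_Icc.1 hn
  rw [roughLambda_eq_zero, Complex.ofReal_zero, zero_mul]
  exact ((Nat.le_floor_iff' (by lia)).1 h2).trans hy

theorem Regime.le_z {q : ℕ} {Q z : ℝ} (hR : Regime q Q z) : 2 ^ 60 ≤ z ∧ (q:ℝ) ^ 10 ≤ z := by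
  have h2 := hR.two_le
  have h1 : Q ^ 60 ≤ Q ^ 100 := pow_le_pow_right₀ (by linarith) (by norm_num)
  have h3 : Q ^ 10 ≤ Q ^ 60 := pow_le_pow_right₀ (by linarith) (by norm_num)
  rw [hR.z_eq]
  exact ⟨(pow_le_pow_left₀ (by norm_num) h2 60).trans h1,
    ((pow_le_pow_left₀ (by positivity) hR.le 10).trans h3).trans h1⟩

theorem sum_roughLambda_le (z : ℝ) (N : ℕ) :
    ∑ n ∈ Icc 1 N, roughLambda z n ≤ (Real.log 4 + 4) * N := by
  have h := Chebyshev.psi_le_const_mul_self (x := N) (by positivity)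
  rw [Chebyshev.psi, Nat.floor_natCast] at h
  exact (sum_le_sum fun n _ => roughLambda_le z n).trans h

theorem l2_le_of_sum_residue_le {q : ℕ} (hq : 0 < q) (S : Finset (DirichletCharacter ℂ q)) (s : Finset ℕ)
    {w : ℕ → ℝ} (hw : ∀ n, 0 ≤ w n) {B : ℝ} (hB : 0 ≤ B)
    (h : ∀ a : ZMod q, IsUnit a →
      ∑ n ∈ s.filter (fun n : ℕ => (n : ZMod q) = a), w n ≤ B / q.totient) :
    l2 S (fun χ => ∑ n ∈ s, (w n : ℂ) * χ n) ≤ B := by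
  have : NeZero q := ⟨hq.ne'⟩
  refine l2_le hB ?_
  refine (sum_le_sum_of_subset_of_nonneg (subset_univ S) fun _ _ _ => by positivity).trans ?_
  refine (sum_norm_sq_le s w hw (fun a => h a a.isUnit)).trans (le_of_eq ?_)
  have : (q.totient : ℝ) ≠ 0 := by exact_mod_cast (Nat.totient_pos.2 hq).ne'
  rw [mul_div_cancel₀ _ this]

theorem l2_vonMangoldt_le : ∃ C : ℝ, 1 ≤ C ∧ ∀ q : ℕ, 0 < q → ∀ u : ℝ, 2 ^ 60 ≤ u →
    (q:ℝ) ^ 10 ≤ u → ∀ w h : ℝ, 0 ≤ w → √u ≤ h → w + h ≤ 2 * u →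
    ∀ (c : ℕ → ℝ), (∀ n, 0 ≤ c n) → (∀ n, c n ≤ Λ n) → ∀ S : Finset (DirichletCharacter ℂ q),
      ∀ s ⊆ Ioc ⌊w⌋₊ ⌊w + h⌋₊, l2 S (fun χ => ∑ n ∈ s, (c n : ℂ) * χ n) ≤ C * h := by
  obtain ⟨C, hC, H⟩ := vonMangoldt_ap_le
  refine ⟨C, hC, fun q hq u hu hqu w h hw hh hwh c hc0 hc S s hs => ?_⟩
  have hh0 : 0 ≤ h := (Real.sqrt_nonneg _).trans hh
  refine l2_le_of_sum_residue_le hq S s hc0 (by positivity) fun a ha => ?_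
  rw [mul_div_assoc]
  refine (sum_le_sum fun n _ => hc n).trans ?_
  refine (sum_le_sum_of_subset_of_nonneg (filter_subset_filter _ hs) fun _ _ _ =>
    ArithmeticFunction.vonMangoldt_nonneg).trans ?_
  exact H q hq u hu hqu w h hw hh hwh a ha

theorem sum_roughLambda_residue_le : ∃ C : ℝ, 0 ≤ C ∧ ∀ (q : ℕ) (Q z : ℝ), Regime q Q z →
    ∀ a : ZMod q, IsUnit a → ∀ N : ℕ,
      ∑ n ∈ (Icc 1 N).filter (fun n : ℕ => (n : ZMod q) = a), roughLambda z n ≤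
        C / q.totient * N := by
  obtain ⟨C, hC, H⟩ := vonMangoldt_ap_le
  refine ⟨C, by linarith, fun q Q z hR a ha N => ?_⟩
  obtain ⟨hz1, hz2⟩ := hR.le_z
  rcases le_or_gt (N:ℝ) z with hN | hN
  · rw [sum_eq_zero]
    · positivity
    · intro n hn
      refine roughLambda_eq_zero (le_trans ?_ hN)
      exact_mod_cast (mem_Icc.1 (mem_filter.1 hn).1).2
  · have h1 : √(N:ℝ) ≤ N := by
      refine Real.sqrt_le_iff.2 ⟨by positivity, ?_⟩
      have : (1:ℝ) ≤ N := by linarith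
      nlinarith
    have h := H q hR.pos N (by linarith) (by linarith) 0 N le_rfl h1 (by linarith) a ha
    rw [zero_add, Nat.floor_zero, Nat.floor_natCast] at h
    refine (sum_le_sum fun n _ => roughLambda_le z n).trans (h.trans (le_of_eq ?_))
    ring

theorem l2_log_mul_roughPsi_sub_le : ∃ C : ℝ, 0 ≤ C ∧ ∀ (q : ℕ) (Q z : ℝ), Regime q Q z →
    ∀ (S : Finset (DirichletCharacter ℂ q)) (x : ℝ), 1 ≤ x →
      l2 S (fun χ => (Real.log x : ℂ) * roughPsi z χ x -
        ∑ n ∈ Icc 1 ⌊x⌋₊, ((Λ n * Real.log n : ℝ) : ℂ) * siftChar z χ n) ≤ C * x := by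
  obtain ⟨C, hC, H⟩ := sum_roughLambda_residue_le
  refine ⟨4 * C, by positivity, fun q Q z hR S x hx => ?_⟩
  have hz : 0 ≤ z := by linarith [hR.two_le_z]
  have hle : ∀ n ∈ Icc 1 ⌊x⌋₊, 0 < (n:ℝ) ∧ 1 ≤ x / n := by
    intro n hn
    obtain ⟨h1, h2⟩ := mem_Icc.1 hn
    have h3 : (0:ℝ) < n := by exact_mod_cast h1
    exact ⟨h3, (one_le_div h3).2 ((Nat.le_floor_iff' (by lia)).1 h2)⟩
  have e : (fun χ : DirichletCharacter ℂ q => (Real.log x : ℂ) * roughPsi z χ x -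
      ∑ n ∈ Icc 1 ⌊x⌋₊, ((Λ n * Real.log n : ℝ) : ℂ) * siftChar z χ n) =
      fun χ => ∑ n ∈ Icc 1 ⌊x⌋₊, ((roughLambda z n * |Real.log (x / n)| : ℝ) : ℂ) * χ n := by
    funext χ
    rw [roughPsi_eq hz, mul_sum, ← sum_sub_distrib]
    refine sum_congr rfl fun n hn => ?_
    obtain ⟨h1, h2⟩ := hle n hn
    rw [abs_of_nonneg (Real.log_nonneg h2), Real.log_div (by linarith) h1.ne']
    have h3 := vonMangoldt_mul_siftChar hz χ n
    simp only [Complex.ofReal_mul, Complex.ofReal_sub]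
    linear_combination -(Real.log n : ℂ) * h3
  rw [e]
  refine l2_le_of_sum_residue_le hR.pos S _
    (fun n => mul_nonneg (roughLambda_nonneg z n) (abs_nonneg _)) (by positivity) fun a ha => ?_
  have hm := sum_mul_div_rpow_le (c := fun n => if (n : ZMod q) = a then roughLambda z n else 0)
    (E := C / q.totient) (by positivity) (fun N => by rw [← sum_filter]; exact H q Q z hR a ha N)
    (γ := 1 / 2) (by norm_num) (by norm_num) (x := x) (by linarith)
  rw [sum_filter]
  calc _ ≤ ∑ n ∈ Icc 1 ⌊x⌋₊, 2 * ((if (n : ZMod q) = a then roughLambda z n else 0) *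
        (x / n) ^ (1 / 2 : ℝ)) := by
        refine sum_le_sum fun n hn => ?_
        obtain ⟨h1, h2⟩ := hle n hn
        split_ifs with h
        · have h4 := Real.log_le_rpow_div (x := x / n) (by linarith) (ε := 1 / 2) (by norm_num)
          rw [abs_of_nonneg (Real.log_nonneg h2)]
          have := roughLambda_nonneg z n
          nlinarith
        · simp
    _ ≤ 2 * (C / q.totient * x / (1 - 1 / 2)) := by rw [← mul_sum]; gcongr
    _ = _ := by ring

theorem log_sq_mul_siftChar {q : ℕ} {z : ℝ} (hz : 0 ≤ z) (χ : DirichletCharacter ℂ q) {n : ℕ}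
    (hn : 1 ≤ n) :
    ((Real.log n ^ 2 : ℝ) : ℂ) * siftChar z χ n = ((Real.log n ^ 2 : ℝ) : ℂ) * twisted z χ 0 n := by
  classical
  rw [siftChar_apply hz, twisted]
  rcases hn.eq_or_lt with rfl | h
  · simp
  · simp [h]

theorem l2_sum_log_sq_le : ∃ C : ℝ, 0 ≤ C ∧ ∀ (q : ℕ) (Q z : ℝ), Regime q Q z →
    ∀ S : Finset (DirichletCharacter ℂ q), 1 ∉ S → ∀ y : ℝ, 1 ≤ y →
      l2 S (fun χ => ∑ n ∈ Icc 1 ⌊y⌋₊, ((Real.log n ^ 2 : ℝ) : ℂ) * siftChar z χ n) ≤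
        C * Real.log z * y ^ (1 - saving z / 2) := by
  obtain ⟨C, hC, H⟩ := sum_norm_sq_psum_twisted_le
  refine ⟨8192 * C, by positivity, fun q Q z hR S hS y hy => ?_⟩
  have hz : 0 ≤ z := by linarith [hR.two_le_z]
  have hl := hR.one_le_log_z
  have hβ := hR.saving_pos
  have hβ1 := hR.saving_le
  have e : (fun χ : DirichletCharacter ℂ q =>
      ∑ n ∈ Icc 1 ⌊y⌋₊, ((Real.log n ^ 2 : ℝ) : ℂ) * siftChar z χ n) =
      fun χ => ∑ n ∈ Icc 1 ⌊y⌋₊, ((Real.log n ^ 2 : ℝ) : ℂ) * twisted z χ 0 n := by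
    funext χ
    exact sum_congr rfl fun n hn => log_sq_mul_siftChar hz χ (mem_Icc.1 hn).1
  rw [e]
  have hB : ∀ n ≤ ⌊y⌋₊, l2 S (fun χ => ∑ k ∈ Icc 1 n, twisted z χ 0 k) ≤
      C * (y ^ (1 - saving z) / Real.log z) := by
    intro n hn
    rcases n.eq_zero_or_pos with rfl | h0
    · simp only [Nat.lt_one_iff, pos_of_gt, Icc_eq_empty_of_lt, sum_empty]
      refine l2_le (by positivity) ?_
      simp only [norm_zero, ne_eq, OfNat.ofNat_ne_zero, not_false_eq_true, zero_pow, sum_const_zero]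
      positivity
    · have h1 : (1:ℝ) ≤ n := by exact_mod_cast h0
      have h2 := l2_le (S := S) (v := fun χ => psum (twisted z χ 0) n) (by positivity)
        (H q Q z hR S hS n h1)
      simp only [psum, Nat.floor_natCast] at h2
      refine h2.trans ?_
      gcongr
      · linarith
      · exact (Nat.le_floor_iff (by linarith)).1 hn
  have hA := l2_sum_mul_le (v := fun n (χ : DirichletCharacter ℂ q) => twisted z χ 0 n)
    (g := fun n : ℕ => Real.log n ^ 2) hB (fun n => by positivity) (by
      intro a ha b _ hab
      have : (1:ℝ) ≤ a := by exact_mod_cast (ha : 1 ≤ a)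
      have h3 : (a:ℝ) ≤ b := by exact_mod_cast hab
      exact pow_le_pow_left₀ (Real.log_nonneg this) (Real.log_le_log (by linarith) h3) 2)
  refine hA.trans ?_
  have hy0 : (0:ℝ) < ⌊y⌋₊ := by exact_mod_cast Nat.floor_pos.2 hy
  have hlog : Real.log ⌊y⌋₊ ^ 2 ≤ Real.log y ^ 2 :=
    pow_le_pow_left₀ (Real.log_nonneg (by exact_mod_cast Nat.floor_pos.2 hy))
      (Real.log_le_log hy0 (Nat.floor_le (by linarith))) 2
  have hlog2 := log_pow_le hy (half_pos hβ) 2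
  have hc : (((2:ℕ):ℝ) / (saving z / 2)) ^ 2 = 4096 * Real.log z ^ 2 := by
    unfold saving; field_simp; norm_num
  rw [hc] at hlog2
  calc 2 * (Real.log ⌊y⌋₊ ^ 2 * (C * (y ^ (1 - saving z) / Real.log z)))
      ≤ 2 * ((4096 * Real.log z ^ 2 * y ^ (saving z / 2)) *
          (C * (y ^ (1 - saving z) / Real.log z))) := by
        gcongr
        exact hlog.trans hlog2
    _ = 8192 * C * Real.log z * (y ^ (saving z / 2) * y ^ (1 - saving z)) := by
        field_simp; ring
    _ = _ := by
        rw [← Real.rpow_add (by linarith)]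
        ring_nf

theorem l2_moebius_part_le : ∃ C : ℝ, 0 ≤ C ∧ ∀ (q : ℕ) (Q z : ℝ), Regime q Q z →
    ∀ S : Finset (DirichletCharacter ℂ q), 1 ∉ S → ∀ x : ℝ, 1 ≤ x →
      l2 S (fun χ => ∑ a ∈ Icc 1 ⌊x⌋₊, ((μ a : ℂ) * siftChar z χ a) *
        ∑ n ∈ Icc 1 ⌊x / a⌋₊, ((Real.log n ^ 2 : ℝ) : ℂ) * siftChar z χ n) ≤
        C * (x * Real.log z) := by
  classical
  obtain ⟨C, hC, H⟩ := l2_sum_log_sq_le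
  obtain ⟨C₁, hC₁, H₁⟩ := norm_psum_twisted_le_trivial
  refine ⟨C * (1 + 32 * C₁), by positivity, fun q Q z hR S hS x hx => ?_⟩
  have hz : 0 ≤ z := by linarith [hR.two_le_z]
  have hl := hR.one_le_log_z
  have hβ := hR.saving_pos
  have hβ1 := hR.saving_le
  set γ := 1 - saving z / 2 with hγ
  set t : ℕ → ℝ := fun n => if 1 < n ∧ Rough z n then 1 else 0 with ht
  have ht0 : ∀ n, 0 ≤ t n := fun n => by simp only [ht]; split_ifs <;> norm_num
  have hsum : ∀ N : ℕ, ∑ n ∈ Icc 1 N, t n ≤ C₁ / Real.log z * N := by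
    intro N
    rcases N.eq_zero_or_pos with rfl | hN
    · simp
    have h := H₁ 1 Q z hR.one 1 0 N (by exact_mod_cast hN)
    have e : psum (twisted z (1 : DirichletCharacter ℂ 1) 0) N = ((∑ n ∈ Icc 1 N, t n : ℝ) : ℂ) := by
      rw [psum, Nat.floor_natCast]
      push_cast
      refine sum_congr rfl fun n _ => ?_
      simp only [twisted, ht]
      split_ifs with h
      · rw [MulChar.one_apply (isUnit_of_subsingleton _)]; simp
      · simp
    rw [e, Complex.norm_real] at h
    exact (le_abs_self _).trans h
  have h1 : ∀ a ∈ Icc 1 ⌊x⌋₊, l2 S (fun χ => ((μ a : ℂ) * siftChar z χ a) *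
        ∑ n ∈ Icc 1 ⌊x / a⌋₊, ((Real.log n ^ 2 : ℝ) : ℂ) * siftChar z χ n) ≤
      C * Real.log z * (((if a = 1 then 1 else 0) + t a) * (x / a) ^ γ) := by
    intro a ha
    obtain ⟨ha1, ha2⟩ := mem_Icc.1 ha
    have h3 : (0:ℝ) < a := by exact_mod_cast ha1
    have h4 : 1 ≤ x / a := (one_le_div h3).2 ((Nat.le_floor_iff' (by lia)).1 ha2)
    have hr0 : (0:ℝ) ≤ (if a = 1 then 1 else 0) + t a := by
      have := ht0 a
      split_ifs <;> linarith
    refine (l2_mul_le hr0 fun χ => ?_).trans ((mul_le_mul_of_nonneg_left (H q Q z hR S hS _ h4)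
      hr0).trans (le_of_eq (by ring)))
    rw [norm_mul]
    have hμ : ‖(μ a : ℂ)‖ ≤ 1 := by
      rw [Complex.norm_intCast]
      exact_mod_cast ArithmeticFunction.abs_moebius_le_one
    rcases ha1.eq_or_lt with rfl | h
    · simp [ht]
    · by_cases hr : Rough z a
      · simp only [h.ne', if_false, ht, h, hr, and_self, if_true, zero_add]
        exact mul_le_one₀ hμ (norm_nonneg _) ((siftChar z χ).norm_le_one _)
      · rw [siftChar_apply hz]
        simp [hr, ht, h.ne']
  refine (l2_sum_le _ _).trans ((sum_le_sum h1).trans ?_)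
  rw [← mul_sum]
  simp_rw [add_mul]
  rw [sum_add_distrib]
  have h2 := sum_mul_div_rpow_le (by positivity) hsum (γ := γ) (by linarith) (by linarith)
    (x := x) (by linarith)
  have h3 : ∑ a ∈ Icc 1 ⌊x⌋₊, (if a = 1 then (1:ℝ) else 0) * (x / a) ^ γ ≤ x := by
    simp only [ite_mul, one_mul, zero_mul, sum_ite_eq']
    rw [if_pos (mem_Icc.2 ⟨le_rfl, Nat.floor_pos.2 hx⟩), Nat.cast_one, div_one]
    calc x ^ γ ≤ x ^ (1:ℝ) := Real.rpow_le_rpow_of_exponent_le hx (by linarith)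
      _ = x := Real.rpow_one x
  have h4 : C₁ / Real.log z * x / (1 - γ) = 32 * C₁ * x := by
    rw [hγ]; unfold saving; field_simp; ring
  rw [h4] at h2
  calc _ ≤ C * Real.log z * (x + 32 * C₁ * x) := by gcongr
    _ = _ := by ring

end PretentiousSieve

namespace PretentiousSieve

open Finset MeasureTheory
open scoped ArithmeticFunction.vonMangoldt ArithmeticFunction.Moebius

theorem sqrt_le_mul_of_one_div_le {Q p δ : ℝ} (hQ : 0 < Q) (hp : Q ^ 2 ≤ p) (hδ : 1 / Q ≤ δ) :
    √p ≤ δ * p := by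
  have hp0 : 0 < p := lt_of_lt_of_le (by positivity) hp
  have h1 : Q ≤ √p := Real.le_sqrt_of_sq_le hp
  have h2 : 1 ≤ δ * √p := by
    calc (1:ℝ) = 1 / Q * Q := by field_simp
      _ ≤ δ * √p := by gcongr; exact le_trans (by positivity) hδ
  calc √p = 1 * √p := by ring
    _ ≤ (δ * √p) * √p := by gcongr
    _ = δ * p := by rw [mul_assoc, Real.mul_self_sqrt hp0.le]

theorem Regime.sq_le {q : ℕ} {Q z : ℝ} (hR : Regime q Q z) : Q ^ 2 ≤ z / 2 ∧ 2 ^ 60 ≤ z / 2 := by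
  have h2 := hR.two_le
  have h1 : Q ^ 62 ≤ Q ^ 100 := pow_le_pow_right₀ (by linarith) (by norm_num)
  have h3 : (2:ℝ) ^ 60 ≤ Q ^ 60 := pow_le_pow_left₀ (by norm_num) h2 60
  have h4 : (2:ℝ) ^ 2 ≤ Q ^ 2 := pow_le_pow_left₀ (by norm_num) h2 2
  have h5 : Q ^ 62 = Q ^ 60 * Q ^ 2 := by ring
  rw [hR.z_eq]
  constructor <;> nlinarith

theorem sum_roughLambda_Ioc_le : ∃ C : ℝ, 0 ≤ C ∧ ∀ (q : ℕ) (Q z : ℝ), Regime q Q z →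
    ∀ p δ : ℝ, 0 ≤ p → 1 / Q ≤ δ → δ ≤ 1 →
      ∑ a ∈ Ioc ⌊p⌋₊ ⌊p + δ * p⌋₊, roughLambda z a ≤ C * (δ * p) := by
  obtain ⟨C, hC, H⟩ := vonMangoldt_ap_le
  refine ⟨C, by linarith, fun q Q z hR p δ hp hδ hδ1 => ?_⟩
  have hQ := hR.two_le
  have hδ0 : 0 < δ := lt_of_lt_of_le (by positivity) hδ
  have hpδ : δ * p ≤ p := mul_le_of_le_one_left hp hδ1
  obtain ⟨h1, h2⟩ := hR.sq_le
  rcases le_or_gt (p + δ * p) z with h | h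
  · rw [sum_eq_zero]
    · positivity
    · intro a ha
      refine roughLambda_eq_zero (le_trans ?_ h)
      obtain ⟨ha1, ha2⟩ := mem_Ioc.1 ha
      exact (Nat.le_floor_iff' (by lia)).1 ha2
  · have hpz : z / 2 ≤ p := by linarith
    have h3 := H 1 one_pos p (h2.trans hpz) (by push_cast; linarith) p (δ * p) hp
      (sqrt_le_mul_of_one_div_le (by linarith) (h1.trans hpz) hδ) (by linarith) 1 isUnit_one
    rw [filter_true_of_mem fun n _ => Subsingleton.elim _ _, Nat.totient_one, Nat.cast_one,
      div_one] at h3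
    exact (sum_le_sum fun n _ => roughLambda_le z n).trans h3

theorem l2_roughPsi_le_add : ∃ C : ℝ, 0 ≤ C ∧ ∀ (q : ℕ) (Q z : ℝ), Regime q Q z →
    ∀ (S : Finset (DirichletCharacter ℂ q)) (y u δ : ℝ), z ≤ y → 1 / Q ≤ δ → δ ≤ 1 → y ≤ u →
      u ≤ y + δ * y →
      l2 S (fun χ => roughPsi z χ y) ≤ l2 S (fun χ => roughPsi z χ u) + C * (δ * y) := by
  obtain ⟨C, hC, H⟩ := l2_vonMangoldt_le
  refine ⟨C, by linarith, fun q Q z hR S y u δ hy hδ hδ1 hyu huy => ?_⟩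
  have hQ := hR.two_le
  have hz : 0 ≤ z := by linarith [hR.two_le_z]
  have hy0 : 0 ≤ y := by linarith
  obtain ⟨h1, h2⟩ := hR.sq_le
  obtain ⟨h3, h4⟩ := hR.le_z
  have hδy : δ * y ≤ y := mul_le_of_le_one_left hy0 hδ1
  have h := H q hR.pos y (h3.trans hy) (h4.trans hy) y (δ * y) hy0
    (sqrt_le_mul_of_one_div_le (by linarith) (by linarith) hδ) (by linarith)
    (roughLambda z) (roughLambda_nonneg z) (roughLambda_le z) S (Ioc ⌊y⌋₊ ⌊u⌋₊)
    (Ioc_subset_Ioc_right (Nat.floor_mono huy))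
  have e : (fun χ : DirichletCharacter ℂ q => roughPsi z χ y) = fun χ => roughPsi z χ u -
      ∑ n ∈ Ioc ⌊y⌋₊ ⌊u⌋₊, (roughLambda z n : ℂ) * χ n := by
    funext χ
    rw [roughPsi_eq hz, roughPsi_eq hz, eq_sub_iff_add_eq]
    have hI : ∀ n, Icc 1 n = Ioc 0 n := fun n => rfl
    rw [hI, hI]
    exact sum_Ioc_consecutive _ (Nat.zero_le _) (Nat.floor_mono hyu)
  rw [e]
  exact (l2_sub_le _ _).trans (by gcongr)

theorem l2_roughPsi_le_integral : ∃ C : ℝ, 0 ≤ C ∧ ∀ (q : ℕ) (Q z : ℝ), Regime q Q z →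
    ∀ (S : Finset (DirichletCharacter ℂ q)) (y δ : ℝ), z ≤ y → 1 / Q ≤ δ → δ ≤ 1 →
      IntegrableOn (fun u => (l2 S fun χ => roughPsi z χ u) / u ^ 2) (Set.Ioc y (y + δ * y)) →
      l2 S (fun χ => roughPsi z χ y) ≤
        4 * y / δ * (∫ u in Set.Ioc y (y + δ * y), (l2 S fun χ => roughPsi z χ u) / u ^ 2) +
          C * (δ * y) := by
  obtain ⟨C, hC, H⟩ := l2_roughPsi_le_add
  refine ⟨C, hC, fun q Q z hR S y δ hy hδ hδ1 hInt => ?_⟩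
  have hQ := hR.two_le
  have hy0 : 0 < y := by linarith [hR.two_le_z]
  have hδ0 : 0 < δ := lt_of_lt_of_le (by positivity) hδ
  have hδy : δ * y ≤ y := mul_le_of_le_one_left hy0.le hδ1
  have hpos : 0 < δ * y := by positivity
  set N := fun u : ℝ => l2 S fun χ => roughPsi z χ u with hN
  have hpt : ∀ u ∈ Set.Ioc y (y + δ * y), (N y - C * (δ * y)) / (4 * y ^ 2) ≤ N u / u ^ 2 := by
    rintro u ⟨hu1, hu2⟩
    have h1 := H q Q z hR S y u δ hy hδ hδ1 hu1.le hu2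
    have h2 : 0 ≤ N u := l2_nonneg _ _
    have hu0 : 0 < u := by linarith
    calc _ ≤ N u / (4 * y ^ 2) := by gcongr; simp only [hN]; linarith
      _ ≤ _ := by
        gcongr
        nlinarith
  have hI := setIntegral_mono_on (integrableOn_const (by simp) (by simp)) hInt measurableSet_Ioc hpt
  rw [setIntegral_const, Real.volume_real_Ioc_of_le (by linarith), add_sub_cancel_left,
    smul_eq_mul] at hI
  have e : N y - C * (δ * y) = 4 * y / δ * (δ * y * ((N y - C * (δ * y)) / (4 * y ^ 2))) := by
    field_simp
  have hI2 := mul_le_mul_of_nonneg_left hI (by positivity : 0 ≤ 4 * y / δ)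
  rw [← e] at hI2
  linarith

theorem sum_roughLambda_mul_integral_le : ∃ C : ℝ, 0 ≤ C ∧ ∀ (q : ℕ) (Q z : ℝ), Regime q Q z →
    ∀ (x δ : ℝ) (M : ℝ → ℝ), 0 < x → 1 / Q ≤ δ → δ ≤ 1 → (∀ u, 0 ≤ M u) →
      IntegrableOn M (Set.Ioc z (2 * x)) →
      ∑ a ∈ (Icc 1 ⌊x⌋₊).filter (fun a : ℕ => z ≤ x / a), roughLambda z a *
        (4 * (x / a) / δ * ∫ u in Set.Ioc (x / a) (x / a + δ * (x / a)), M u) ≤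
      C * x * ∫ u in Set.Ioc z (2 * x), M u := by
  obtain ⟨C, hC, H⟩ := sum_roughLambda_Ioc_le
  refine ⟨4 * C, by positivity, fun q Q z hR x δ M hx hδ hδ1 hM hInt => ?_⟩
  have hQ := hR.two_le
  have hz := hR.two_le_z
  have hδ0 : 0 < δ := lt_of_lt_of_le (by positivity) hδ
  set A := (Icc 1 ⌊x⌋₊).filter (fun a : ℕ => z ≤ x / a) with hA
  have hA1 : ∀ a ∈ A, (1:ℝ) ≤ a ∧ z ≤ x / a := by
    intro a ha
    obtain ⟨h1, h2⟩ := mem_filter.1 ha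
    exact ⟨by exact_mod_cast (mem_Icc.1 h1).1, h2⟩
  set I : ℕ → Set ℝ := fun a => Set.Ioc (x / a) (x / a + δ * (x / a)) with hI
  have hsub : ∀ a ∈ A, I a ⊆ Set.Ioc z (2 * x) := by
    intro a ha
    obtain ⟨h1, h2⟩ := hA1 a ha
    refine Set.Ioc_subset_Ioc h2 ?_
    have h3 : x / a ≤ x := div_le_self hx.le h1
    have h4 : δ * (x / a) ≤ x / a := mul_le_of_le_one_left (by positivity) hδ1
    linarith
  have e1 : ∀ a ∈ A, roughLambda z a * (4 * (x / a) / δ * ∫ u in I a, M u) =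
      ∫ u in Set.Ioc z (2 * x), roughLambda z a * (4 * (x / a) / δ) * (I a).indicator M u := by
    intro a ha
    rw [integral_const_mul, setIntegral_indicator measurableSet_Ioc,
      Set.inter_eq_self_of_subset_right (hsub a ha), mul_assoc]
  have hi : ∀ a ∈ A, IntegrableOn (fun u => roughLambda z a * (4 * (x / a) / δ) *
      (I a).indicator M u) (Set.Ioc z (2 * x)) := fun a _ =>
    (hInt.indicator measurableSet_Ioc).const_mul _
  rw [sum_congr rfl e1, ← integral_finsetSum A hi, ← integral_const_mul]
  refine setIntegral_mono_on (integrable_finsetSum A hi) (hInt.const_mul _) measurableSet_Ioc ?_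
  rintro u ⟨hu1, hu2⟩
  have hu0 : 0 < u := by linarith
  have hp := H q Q z hR (x / u) δ (by positivity) hδ hδ1
  calc ∑ a ∈ A, roughLambda z a * (4 * (x / a) / δ) * (I a).indicator M u
      ≤ ∑ a ∈ A, (if a ∈ Ioc ⌊x / u⌋₊ ⌊x / u + δ * (x / u)⌋₊ then roughLambda z a else 0) *
          (4 * u / δ * M u) := by
        refine sum_le_sum fun a ha => ?_
        obtain ⟨ha1, -⟩ := hA1 a ha
        have ha0 : (0:ℝ) < a := by linarith
        by_cases hmem : u ∈ I a
        · obtain ⟨h1, h2⟩ := hmem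
          rw [Set.indicator_of_mem (show u ∈ I a from ⟨h1, h2⟩), if_pos]
          · have := roughLambda_nonneg z a
            have := hM u
            rw [mul_assoc]
            gcongr
          · rw [mem_Ioc, Nat.floor_lt (by positivity), Nat.le_floor_iff (by positivity)]
            rw [div_lt_iff₀ ha0] at h1
            have h3 : x / a + δ * (x / a) = (1 + δ) * x / a := by ring
            have h4 : x / u + δ * (x / u) = (1 + δ) * x / u := by ring
            rw [h3, le_div_iff₀ ha0] at h2
            rw [h4, le_div_iff₀ hu0, div_lt_iff₀ hu0]
            constructor <;> linarith
        · rw [Set.indicator_of_notMem hmem, mul_zero]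
          have := hM u
          split_ifs
          · have := roughLambda_nonneg z a
            positivity
          · simp
    _ = (∑ a ∈ A.filter (fun a => a ∈ Ioc ⌊x / u⌋₊ ⌊x / u + δ * (x / u)⌋₊), roughLambda z a) *
          (4 * u / δ * M u) := by rw [← sum_mul, ← sum_filter]
    _ ≤ C * (δ * (x / u)) * (4 * u / δ * M u) := by
        have := hM u
        gcongr
        refine (sum_le_sum_of_subset_of_nonneg ?_ fun a _ _ => roughLambda_nonneg z a).trans hp
        intro a ha
        exact (mem_filter.1 ha).2
    _ = 4 * C * x * M u := by field_simp

theorem l2_vonMangoldt_part_le : ∃ C K : ℝ, 0 ≤ C ∧ 1 ≤ K ∧ ∀ (q : ℕ) (Q z : ℝ), Regime q Q z →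
    ∃ χ₁ : DirichletCharacter ℂ q, ∀ S : Finset (DirichletCharacter ℂ q), 1 ∉ S → χ₁ ∉ S →
    ∀ x : ℝ, 2 ≤ x → K * Real.log z ≤ Real.log x → q * Real.log x ^ 6 ≤ Q ^ 6 → Real.log x ≤ Q →
      l2 S (fun χ => ∑ a ∈ Icc 1 ⌊x⌋₊, ((Λ a : ℂ) * siftChar z χ a) * roughPsi z χ (x / a)) ≤
        C * (x * Real.log z) := by
  obtain ⟨C₁, K, hC₁, hK, H₁⟩ := integral_l2_roughPsi_le
  obtain ⟨C₂, hC₂, H₂⟩ := l2_roughPsi_le_integral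
  obtain ⟨C₃, hC₃, H₃⟩ := sum_roughLambda_mul_integral_le
  have hlog4 : 0 ≤ Real.log 4 + 4 := by positivity
  refine ⟨C₃ * C₁ + 2 * (C₂ * (Real.log 4 + 4)), K, by positivity, hK, fun q Q z hR => ?_⟩
  obtain ⟨χ₁, hχ₁⟩ := H₁ q Q z hR
  refine ⟨χ₁, fun S hS hS1 x hx hKx hqx hxQ => ?_⟩
  obtain ⟨hInt, hle⟩ := hχ₁ S hS hS1 x hx hKx hqx
  have hz : 0 ≤ z := by linarith [hR.two_le_z]
  have hQ := hR.two_le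
  have hl := hR.one_le_log_z
  have hlX : Real.log z ≤ Real.log x := by nlinarith
  have hX : 1 ≤ Real.log x := hl.trans hlX
  set δ := Real.log z / Real.log x with hδ_def
  have hδ0 : 0 < δ := by positivity
  have hδ1 : δ ≤ 1 := (div_le_one (by linarith)).2 hlX
  have hδQ : 1 / Q ≤ δ := div_le_div₀ (by linarith) hl (by linarith) hxQ
  have hM : ∀ u : ℝ, 0 ≤ (l2 S fun χ => roughPsi z χ u) / u ^ 2 := fun u =>
    div_nonneg (l2_nonneg _ _) (sq_nonneg u)
  have h1 : ∀ a ∈ Icc 1 ⌊x⌋₊,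
      l2 S (fun χ => ((Λ a : ℂ) * siftChar z χ a) * roughPsi z χ (x / a)) ≤
        (if z ≤ x / a then roughLambda z a * (4 * (x / a) / δ *
          ∫ u in Set.Ioc (x / a) (x / a + δ * (x / a)), (l2 S fun χ => roughPsi z χ u) / u ^ 2)
          else 0) + C₂ * δ * x * (roughLambda z a / a) := by
    intro a ha
    have ha1 : (1:ℝ) ≤ a := by exact_mod_cast (mem_Icc.1 ha).1
    have hr := roughLambda_nonneg z a
    have h2 : l2 S (fun χ => ((Λ a : ℂ) * siftChar z χ a) * roughPsi z χ (x / a)) ≤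
        roughLambda z a * l2 S (fun χ => roughPsi z χ (x / a)) := by
      refine l2_mul_le hr fun χ => ?_
      rw [vonMangoldt_mul_siftChar hz, norm_mul, Complex.norm_real, Real.norm_of_nonneg hr]
      exact mul_le_of_le_one_right hr (χ.norm_le_one _)
    refine h2.trans ?_
    split_ifs with hza
    · have hsub : Set.Ioc (x / a) (x / a + δ * (x / a)) ⊆ Set.Ioc z (2 * x) := by
        refine Set.Ioc_subset_Ioc hza ?_
        have h3 : x / a ≤ x := div_le_self (by linarith) ha1
        have h4 : δ * (x / a) ≤ x / a := mul_le_of_le_one_left (by positivity) hδ1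
        linarith
      have h5 := H₂ q Q z hR S (x / a) δ hza hδQ hδ1 (hInt.mono_set hsub)
      refine (mul_le_mul_of_nonneg_left h5 hr).trans (le_of_eq ?_)
      ring
    · have h6 : l2 S (fun χ => roughPsi z χ (x / a)) ≤ 0 := by
        refine l2_le le_rfl (le_of_eq ?_)
        simp [roughPsi_eq_zero hz _ (not_le.1 hza).le]
      have h7 := mul_nonpos_of_nonneg_of_nonpos hr h6
      have h8 : 0 ≤ C₂ * δ * x * (roughLambda z a / a) := by positivity
      linarith
  refine (l2_sum_le _ _).trans ((sum_le_sum h1).trans ?_)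
  rw [sum_add_distrib, ← mul_sum, ← sum_filter]
  have h2 := H₃ q Q z hR x δ _ (by linarith) hδQ hδ1 hM hInt
  have h3 := sum_div_le hlog4 (sum_roughLambda_le z) (x := x) (by linarith)
  have h4 : δ * Real.log x = Real.log z := by rw [hδ_def]; field_simp
  calc _ ≤ C₃ * x * (C₁ * Real.log z) + C₂ * δ * x * ((Real.log 4 + 4) * (2 * Real.log x)) := by
        gcongr
        · exact h2.trans (by gcongr)
        · exact h3.trans (by gcongr; linarith)
    _ = C₃ * C₁ * (x * Real.log z) + 2 * (C₂ * (Real.log 4 + 4)) * (x * (δ * Real.log x)) := by ring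
    _ = _ := by rw [h4]; ring

theorem l2_roughPsi_le : ∃ C K : ℝ, 0 ≤ C ∧ 1 ≤ K ∧ ∀ (q : ℕ) (Q z : ℝ), Regime q Q z →
    ∃ χ₁ : DirichletCharacter ℂ q, ∀ S : Finset (DirichletCharacter ℂ q), 1 ∉ S → χ₁ ∉ S →
    ∀ x : ℝ, 2 ≤ x → K * Real.log z ≤ Real.log x → q * Real.log x ^ 6 ≤ Q ^ 6 → Real.log x ≤ Q →
      l2 S (fun χ => roughPsi z χ x) ≤ C * (x * (Real.log z / Real.log x)) := by
  obtain ⟨C₁, K, hC₁, hK, H₁⟩ := l2_vonMangoldt_part_le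
  obtain ⟨C₂, hC₂, H₂⟩ := l2_moebius_part_le
  obtain ⟨C₃, hC₃, H₃⟩ := l2_log_mul_roughPsi_sub_le
  refine ⟨C₃ + (C₂ + C₁), K, by positivity, hK, fun q Q z hR => ?_⟩
  obtain ⟨χ₁, hχ₁⟩ := H₁ q Q z hR
  refine ⟨χ₁, fun S hS hS1 x hx hKx hqx hxQ => ?_⟩
  have hl := hR.one_le_log_z
  have hX : 1 ≤ Real.log x := by nlinarith
  have h1 := hχ₁ S hS hS1 x hx hKx hqx hxQ
  have h2 := H₂ q Q z hR S hS x (by linarith)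
  have h3 := H₃ q Q z hR S x (by linarith)
  have e : (fun χ : DirichletCharacter ℂ q => (Real.log x : ℂ) * roughPsi z χ x) = fun χ =>
      ((Real.log x : ℂ) * roughPsi z χ x -
        ∑ n ∈ Icc 1 ⌊x⌋₊, ((Λ n * Real.log n : ℝ) : ℂ) * siftChar z χ n) +
      (∑ a ∈ Icc 1 ⌊x⌋₊, ((μ a : ℂ) * siftChar z χ a) *
        ∑ n ∈ Icc 1 ⌊x / a⌋₊, ((Real.log n ^ 2 : ℝ) : ℂ) * siftChar z χ n -
      ∑ a ∈ Icc 1 ⌊x⌋₊, ((Λ a : ℂ) * siftChar z χ a) * roughPsi z χ (x / a)) := by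
    funext χ
    have h := sum_vonMangoldt_mul_log_eq (f := fun n => siftChar z χ n)
      (fun m n => by push_cast; exact map_mul _ _ _) x
    rw [roughPsi, ← h]
    ring
  have h4 : Real.log x * l2 S (fun χ => roughPsi z χ x) ≤
      C₃ * x + (C₂ * (x * Real.log z) + C₁ * (x * Real.log z)) := by
    calc _ = l2 S (fun χ => (Real.log x : ℂ) * roughPsi z χ x) := by
          rw [l2_const_mul, Complex.norm_real, Real.norm_of_nonneg (by linarith)]
      _ ≤ _ := by
          rw [e]
          exact (l2_add_le _ _).trans (add_le_add h3 ((l2_sub_le _ _).trans (add_le_add h2 h1)))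
  have h5 : C₃ * x ≤ C₃ * (x * Real.log z) := by
    gcongr
    exact le_mul_of_one_le_right (by linarith) hl
  rw [mul_div_assoc', mul_div_assoc', le_div_iff₀ (by linarith)]
  linarith

end PretentiousSieve

namespace PretentiousSieve

open Finset
open scoped ArithmeticFunction.vonMangoldt

theorem norm_sum_vonMangoldt_sub_roughPsi_le {q : ℕ} {z x : ℝ} (hz : 0 ≤ z) (hx : 1 ≤ x)
    (χ : DirichletCharacter ℂ q) :
    ‖∑ n ∈ Icc 1 ⌊x⌋₊, (Λ n : ℂ) * χ n - roughPsi z χ x‖ ≤ z * Real.log x := by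
  classical
  rw [roughPsi_eq hz, ← sum_sub_distrib]
  calc _ ≤ ∑ n ∈ Icc 1 ⌊x⌋₊, if ¬ Rough z n then Λ n else 0 := by
        refine (norm_sum_le _ _).trans (sum_le_sum fun n _ => ?_)
        rw [← sub_mul, norm_mul, ← Complex.ofReal_sub, Complex.norm_real, roughLambda]
        refine (mul_le_of_le_one_right (norm_nonneg _) (χ.norm_le_one _)).trans ?_
        split_ifs <;> simp_all [abs_of_nonneg ArithmeticFunction.vonMangoldt_nonneg]
    _ ≤ z * Real.log ⌊x⌋₊ := by
        rw [← sum_filter]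
        convert! sum_vonMangoldt_not_rough_le hz (Nat.floor_pos.2 hx)
    _ ≤ z * Real.log x := by
        have h0 : (0:ℝ) < ⌊x⌋₊ := by exact_mod_cast Nat.floor_pos.2 hx
        gcongr
        exact Nat.floor_le (by linarith)

theorem log_mul_log_le {q : ℕ} (hq : 1 ≤ q) {x : ℝ} (hqx : (q:ℝ) ^ 10 ≤ x) (hx : 1 < x) :
    Real.log (q * Real.log x) ≤ Real.log x := by
  have hq0 : (0:ℝ) < q := by exact_mod_cast hq
  have hX := Real.log_pos hx
  rw [Real.log_mul hq0.ne' hX.ne']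
  have h1 : 10 * Real.log q ≤ Real.log x := by
    have := Real.log_le_log (by positivity) hqx
    rwa [Real.log_pow] at this
  have h2 : Real.log (Real.log x) ≤ Real.log x / 2 := by
    have h3 : Real.log (Real.log x) = 2 * Real.log (√(Real.log x)) := by
      rw [Real.log_sqrt hX.le]; ring
    have h4 := Real.log_le_sub_one_of_pos (Real.sqrt_pos.2 hX)
    nlinarith [Real.sq_sqrt hX.le, sq_nonneg (√(Real.log x) - 2)]
  linarith

theorem l2_sum_vonMangoldt_le : ∃ A : ℝ, 0 ≤ A ∧ ∀ q : ℕ, 1 ≤ q → ∀ x : ℝ, (q:ℝ) ^ 10 ≤ x →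
    Real.exp 100 ≤ x → ∃ χ₁ : DirichletCharacter ℂ q, ∀ S : Finset (DirichletCharacter ℂ q),
      1 ∉ S → χ₁ ∉ S → l2 S (fun χ => ∑ n ∈ Icc 1 ⌊x⌋₊, (Λ n : ℂ) * χ n) ≤
        A * (x * (Real.log (q * Real.log x) / Real.log x)) := by
  obtain ⟨C₁, K, hC₁, hK, H₁⟩ := l2_roughPsi_le
  obtain ⟨C₂, hC₂, H₂⟩ := l2_vonMangoldt_le
  refine ⟨100 * (K + 3) * C₂ + (100 * C₁ + 2), by positivity, fun q hq x hqx hx => ?_⟩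
  have hx0 : 0 < x := (Real.exp_pos _).trans_le hx
  have hX : 100 ≤ Real.log x := (Real.le_log_iff_exp_le hx0).2 hx
  have hx60 : 2 ^ 60 ≤ x := by
    refine le_trans ?_ hx
    rw [show (100:ℝ) = (100:ℕ) * 1 by norm_num, Real.exp_nat_mul]
    have : (2:ℝ) ≤ Real.exp 1 := by linarith [Real.add_one_le_exp (1:ℝ)]
    exact (pow_le_pow_right₀ (by norm_num) (by norm_num)).trans
      (pow_le_pow_left₀ (by norm_num) this 100)
  have hq1 : (1:ℝ) ≤ q := by exact_mod_cast hq
  set X := Real.log x with hX_def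
  set Q := q * X with hQ_def
  have hXQ : X ≤ Q := le_mul_of_one_le_left (by linarith) hq1
  have hR : Regime q Q (Q ^ 100) := ⟨hq, le_mul_of_one_le_right (by linarith) (by linarith),
    by linarith, rfl⟩
  set z := Q ^ 100 with hz_def
  have hQ2 := hR.two_le
  have hlz := hR.log_z
  have hlQ : 1 / 2 ≤ Real.log Q :=
    (by linarith [Real.log_two_gt_d9] : 1 / 2 ≤ Real.log 2).trans
      (Real.log_le_log (by norm_num) hQ2)
  have hρ0 : 0 ≤ x * (Real.log Q / X) := by
    have := hR.log_pos
    positivity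
  rcases le_or_gt ((K + 3) * Real.log z) X with hKX | hKX
  · obtain ⟨χ₁, hχ₁⟩ := H₁ q Q z hR
    refine ⟨χ₁, fun S hS hS1 => ?_⟩
    have hl := hR.one_le_log_z
    have h1 := hχ₁ S hS hS1 x (by linarith) (by nlinarith) (by
      rw [hQ_def, mul_pow]
      gcongr
      exact le_self_pow₀ hq1 (by norm_num)) hXQ
    have h2 : l2 S (fun χ => ∑ n ∈ Icc 1 ⌊x⌋₊, (Λ n : ℂ) * χ n - roughPsi z χ x) ≤
        2 * (x * (Real.log Q / X)) := by
      have hzX : 0 ≤ z * X := by have := hR.two_le_z; positivity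
      have hz3 : z ^ 3 ≤ x := by
        have hz0 : 0 < z := by linarith [hR.two_le_z]
        rw [← Real.log_le_log_iff (by positivity) hx0, Real.log_pow]
        push_cast
        nlinarith
      calc _ ≤ q * (z * X) := by
            refine l2_le (by positivity) ?_
            calc _ ≤ ∑ χ ∈ S, (z * X) ^ 2 := by
                  gcongr with χ _
                  exact norm_sum_vonMangoldt_sub_roughPsi_le (by linarith [hR.two_le_z])
                    (by linarith) χ
              _ ≤ q * (z * X) ^ 2 := by
                  rw [sum_const, nsmul_eq_mul]
                  gcongr
                  exact card_characters_le hq S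
              _ ≤ q * (q * (z * X) ^ 2) := le_mul_of_one_le_left (by positivity) hq1
              _ = _ := by ring
        _ = z * Q := by rw [hQ_def]; ring
        _ ≤ z * z := by
            have := hR.two_le_z
            gcongr
            exact hR.Q_le_z
        _ ≤ x / X := by
            rw [le_div_iff₀ (by linarith)]
            have := hR.two_le_z
            have h4 : X ≤ z := hXQ.trans hR.Q_le_z
            calc z * z * X ≤ z * z * z := by gcongr
              _ = z ^ 3 := by ring
              _ ≤ x := hz3
        _ ≤ x / X * (2 * Real.log Q) := le_mul_of_one_le_right (by positivity) (by linarith)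
        _ = _ := by ring
    have e : (fun χ : DirichletCharacter ℂ q => ∑ n ∈ Icc 1 ⌊x⌋₊, (Λ n : ℂ) * χ n) = fun χ =>
        roughPsi z χ x + (∑ n ∈ Icc 1 ⌊x⌋₊, (Λ n : ℂ) * χ n - roughPsi z χ x) := by
      funext χ; ring
    rw [e]
    refine (l2_add_le _ _).trans ?_
    have h3 : C₁ * (x * (Real.log z / X)) = 100 * C₁ * (x * (Real.log Q / X)) := by rw [hlz]; ring
    have h4 : 0 ≤ 100 * (K + 3) * C₂ * (x * (Real.log Q / X)) := by positivity
    linarith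
  · refine ⟨1, fun S _ _ => ?_⟩
    have h1 := H₂ q hq x hx60 hqx 0 x le_rfl
      (Real.sqrt_le_iff.2 ⟨hx0.le, by nlinarith⟩) (by linarith) Λ
      (fun _ => ArithmeticFunction.vonMangoldt_nonneg) (fun _ => le_rfl) S (Icc 1 ⌊x⌋₊)
      (by rw [zero_add, Nat.floor_zero]; exact subset_rfl)
    have h2 : x ≤ 100 * (K + 3) * (x * (Real.log Q / X)) := by
      rw [mul_div_assoc', mul_div_assoc', le_div_iff₀ (by linarith)]
      rw [hlz] at hKX
      nlinarith
    calc _ ≤ C₂ * x := h1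
      _ ≤ C₂ * (100 * (K + 3) * (x * (Real.log Q / X))) := by gcongr
      _ ≤ _ := by
        have : 0 ≤ (100 * C₁ + 2) * (x * (Real.log Q / X)) := by positivity
        linarith

end PretentiousSieve

open Complex
open scoped Classical

noncomputable section

theorem pretentious_large_sieve_primes (J : ℕ) (hJ : 1 ≤ J) (ε : ℝ) (hε : 0 < ε) :
    ∃ C : ℝ, 0 < C ∧ ∀ q : ℕ, 1 ≤ q → ∀ x : ℝ, (q : ℝ) ^ 10 ≤ x → C ≤ x →
    ∃ 𝒳 : Finset (DirichletCharacter ℂ q),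
      (1 : DirichletCharacter ℂ q) ∈ 𝒳 ∧ 𝒳.card ≤ J + 1 ∧
      (∑' χ : {χ : DirichletCharacter ℂ q // χ ∉ 𝒳},
          ‖∑ n ∈ Finset.Icc 1 ⌊x⌋₊,
              (ArithmeticFunction.vonMangoldt n : ℂ) *
                (χ : DirichletCharacter ℂ q) (n : ZMod q)‖ ^ 2) ≤
        C * x ^ 2 * (Real.log ((q : ℝ) * Real.log x) / Real.log x)
            ^ (2 * (1 - 1 / Real.sqrt ((J : ℝ) + 1)) - ε) := by
  obtain ⟨A, hA, H⟩ := PretentiousSieve.l2_sum_vonMangoldt_le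
  refine ⟨Real.exp 100 + A ^ 2, by positivity, fun q hq x hqx hx => ?_⟩
  have hx1 : Real.exp 100 ≤ x := by nlinarith
  have hx0 : 0 < x := (Real.exp_pos _).trans_le hx1
  have hX : 100 ≤ Real.log x := (Real.le_log_iff_exp_le hx0).2 hx1
  have hq1 : (1:ℝ) ≤ q := by exact_mod_cast hq
  obtain ⟨χ₁, hχ₁⟩ := H q hq x hqx hx1
  have : NeZero q := ⟨by lia⟩
  refine ⟨{1, χ₁}, by simp, Finset.card_le_two.trans (by lia), ?_⟩
  have hS := hχ₁ (Finset.univ.filter fun χ => χ ∉ ({1, χ₁} : Finset (DirichletCharacter ℂ q)))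
    (by simp) (by simp)
  set ρ := Real.log ((q : ℝ) * Real.log x) / Real.log x with hρ
  have hρ0 : 0 < ρ := div_pos (Real.log_pos (by nlinarith)) (by linarith)
  have hρ1 : ρ ≤ 1 := (div_le_one (by linarith)).2
    (PretentiousSieve.log_mul_log_le hq hqx (by linarith [Real.add_one_le_exp (100:ℝ)]))
  rw [tsum_fintype, ← Finset.sum_subtype (Finset.univ.filter fun χ =>
    χ ∉ ({1, χ₁} : Finset (DirichletCharacter ℂ q))) (fun χ => by simp)
    (fun χ : DirichletCharacter ℂ q => ‖∑ n ∈ Finset.Icc 1 ⌊x⌋₊,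
      (ArithmeticFunction.vonMangoldt n : ℂ) * χ (n : ZMod q)‖ ^ 2), ← PretentiousSieve.l2_sq]
  have hexp : ρ ^ (2:ℕ) ≤ ρ ^ (2 * (1 - 1 / Real.sqrt ((J : ℝ) + 1)) - ε) := by
    rw [← Real.rpow_natCast]
    refine Real.rpow_le_rpow_of_exponent_ge hρ0 hρ1 ?_
    have : 0 ≤ 1 / Real.sqrt ((J : ℝ) + 1) := by positivity
    push_cast
    linarith
  calc _ ≤ (A * (x * ρ)) ^ 2 := pow_le_pow_left₀ (PretentiousSieve.l2_nonneg _ _) hS 2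
    _ = A ^ 2 * x ^ 2 * ρ ^ 2 := by ring
    _ ≤ _ := by
      gcongr
      exact le_add_of_nonneg_left (Real.exp_pos _).le
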